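/- Let ω be a modulus of continuity of order n ∈ ℕ, let D ⊂ ℝ^d be a bounded Lipschitz domain, and let T be a homogeneous C^{n+1}-smooth Calderón–Zygmund operator. Assume: (i) for every polynomial P ∈ 𝒫_n one has T_D(P·χ_D) ∈ 𝒞_ω(D); and (ii) there exists a constant C such that for every cube Q ⊂ D centered at x₀ and every polynomial P that is homogeneous of degree n with respect to x − x₀ there exists a polynomial S_Q ∈ 𝒫_n with (1/|Q|)∫_Q |T_D(P·χ_D) − S_Q| dx ≤ C·‖P‖_{L^∞(D)}·ω̃(ℓ(Q)). Then the restricted operator T_D is bounded on 𝒞_ω(D): there exists C′ such that every f ∈ 𝒞_ω(D) satisfies T_D f ∈ 𝒞_ω(D) and ‖T_D f‖_{ω,D} + ‖T_D f‖_{L¹(D)} ≤ C′·(‖f‖_{ω,D} + ‖f‖_{L¹(D)}). -/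

import Mathlib

open MeasureTheory Filter Set Metric
open scoped ENNReal Topology InnerProductSpace

noncomputable section

/-- The axis-parallel closed cube in `ℝ^d` with center `x₀` and side length `l`. -/
def cube {d : ℕ} (x₀ : EuclideanSpace ℝ (Fin d)) (l : ℝ) : Set (EuclideanSpace ℝ (Fin d)) :=
  {x | ∀ i, |x i - x₀ i| ≤ l / 2}

/-- `𝒫_n`: functions on `ℝ^d` given by polynomials of total degree at most `n`. -/
def PolyLE (d n : ℕ) : Set (EuclideanSpace ℝ (Fin d) → ℝ) :=
  {P | ∃ p : MvPolynomial (Fin d) ℝ, p.totalDegree ≤ n ∧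
    ∀ x, MvPolynomial.eval (fun i => x i) p = P x}

/-- The Campanato-type Zygmund seminorm `‖f‖_{ω,D}` (valued in `ℝ≥0∞`). -/
def zygSeminorm {d : ℕ} (ω : ℝ → ℝ) (n : ℕ) (D : Set (EuclideanSpace ℝ (Fin d)))
    (f : EuclideanSpace ℝ (Fin d) → ℝ) : ℝ≥0∞ :=
  ⨆ (x₀ : EuclideanSpace ℝ (Fin d)) (l : ℝ) (_ : 0 < l) (_ : cube x₀ l ⊆ D),
    ⨅ (P : EuclideanSpace ℝ (Fin d) → ℝ) (_ : P ∈ PolyLE d n),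
      (ENNReal.ofReal (ω l * l ^ d))⁻¹ * ∫⁻ x in cube x₀ l, ENNReal.ofReal |f x - P x|

/-- The `L¹(D)` norm (valued in `ℝ≥0∞`). -/
def l1Norm {d : ℕ} (D : Set (EuclideanSpace ℝ (Fin d)))
    (f : EuclideanSpace ℝ (Fin d) → ℝ) : ℝ≥0∞ :=
  ∫⁻ x in D, ENNReal.ofReal |f x|

/-- The two regularity conditions of order `m` for a modulus of continuity:
`ω(t)/t^q` almost decreasing for some `m ≤ q < m+1`, and `ω(t)/t^r` almost
increasing for some `m-1 < r < m`. -/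
def ModulusConds (ω : ℝ → ℝ) (m : ℕ) : Prop :=
  (∃ q : ℝ, (m : ℝ) ≤ q ∧ q < (m : ℝ) + 1 ∧ ∃ C : ℝ, 0 < C ∧
      ∀ s t : ℝ, 1 < s → 0 < t → ω (s * t) ≤ C * s ^ q * ω t) ∧
  (∃ r : ℝ, (m : ℝ) - 1 < r ∧ r < (m : ℝ) ∧ ∃ C : ℝ, 0 < C ∧
      ∀ s t : ℝ, 0 < s → s < 1 → 0 < t → ω (s * t) ≤ C * s ^ r * ω t)

/-- `ω` is a modulus of continuity of order `n`: continuous, increasing, `ω(0)=0`,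
nonnegative, and `n` is the smallest positive integer satisfying the two
regularity conditions. -/
structure IsModulusOfOrder (ω : ℝ → ℝ) (n : ℕ) : Prop where
  continuousOn : ContinuousOn ω (Set.Ici 0)
  monotoneOn : MonotoneOn ω (Set.Ici 0)
  nonneg : ∀ t, 0 ≤ t → 0 ≤ ω t
  map_zero : ω 0 = 0
  npos : 0 < n
  conds : ModulusConds ω n
  minimal : ∀ m : ℕ, 0 < m → ModulusConds ω m → n ≤ m

/-- `ξ(r) = ∫_r^1 ω(t) t^{-n-1} dt`. -/
def xi (ω : ℝ → ℝ) (n : ℕ) (r : ℝ) : ℝ :=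
  ∫ t in Set.Ioc r 1, ω t / t ^ (n + 1)

/-- The associated modulus of continuity `ω̃(x) = ω(x)/max{1, ξ(x)}`. -/
def omegaTilde (ω : ℝ → ℝ) (n : ℕ) (x : ℝ) : ℝ :=
  ω x / max 1 (xi ω n x)

/-- `D ⊂ ℝ^d` is a bounded Lipschitz domain: it is open, connected, bounded, and near
every boundary point, after a rigid motion, it coincides inside an `R`-window with the
region above the graph of a Lipschitz function (with Lipschitz constant at most `δ`). -/
def IsLipschitzDomain {d : ℕ} (D : Set (EuclideanSpace ℝ (Fin d))) : Prop :=
  IsOpen D ∧ IsConnected D ∧ Bornology.IsBounded D ∧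
  ∃ δ R : ℝ, 0 < δ ∧ 0 < R ∧
    ∀ a ∈ frontier D,
      ∃ (g : EuclideanSpace ℝ (Fin d) ≃ᵢ EuclideanSpace ℝ (Fin d)) (j : Fin d)
        (A : EuclideanSpace ℝ (Fin d) → ℝ),
        g a = 0 ∧
        LipschitzWith (Real.toNNReal δ) A ∧
        (∀ x y : EuclideanSpace ℝ (Fin d), (∀ i, i ≠ j → x i = y i) → A x = A y) ∧
        (g '' D) ∩ cube 0 R = {x ∈ cube (0 : EuclideanSpace ℝ (Fin d)) R | A x < x j}

/-- `Ω` is the density of a `C^k`-smooth homogeneous Calderón–Zygmund kernel: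
homogeneous of degree `0`, `C^k` away from the origin, with zero mean on the
unit sphere. -/
structure IsCZDensity (d : ℕ) (k : ℕ∞) (Ω : EuclideanSpace ℝ (Fin d) → ℝ) : Prop where
  homog : ∀ c : ℝ, 0 < c → ∀ x : EuclideanSpace ℝ (Fin d), Ω (c • x) = Ω x
  smooth : ContDiffOn ℝ k Ω {x : EuclideanSpace ℝ (Fin d) | x ≠ 0}
  meanZero : ∫ x : Metric.sphere (0 : EuclideanSpace ℝ (Fin d)) 1,
      Ω x ∂((volume : Measure (EuclideanSpace ℝ (Fin d))).toSphere) = 0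

/-- `g = T_D f`: `g` vanishes off `D` and, for a.e. `y ∈ D`, `g y` is the principal
value `lim_{ε→0+} ∫_{x ∈ D, |y-x|>ε} f(x) K(y-x) dx` (here `f` is implicitly
multiplied by `χ_D`). -/
def IsRestrictedCZ {d : ℕ} (D : Set (EuclideanSpace ℝ (Fin d)))
    (K : EuclideanSpace ℝ (Fin d) → ℝ) (f g : EuclideanSpace ℝ (Fin d) → ℝ) : Prop :=
  (∀ y, y ∉ D → g y = 0) ∧
  ∀ᵐ y ∂(volume.restrict D),
    Tendsto (fun ε : ℝ => ∫ x in {x ∈ D | ε < dist y x}, f x * K (y - x))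
      (𝓝[>] (0 : ℝ)) (𝓝 (g y))

/-- `P` is a polynomial of near best approximation (with constant `C₀`) for `f`
on the cube with center `x₀` and side length `l`. -/
def IsNearBestApprox {d : ℕ} (ω : ℝ → ℝ) (n : ℕ) (D : Set (EuclideanSpace ℝ (Fin d)))
    (f : EuclideanSpace ℝ (Fin d) → ℝ) (C₀ : ℝ) (x₀ : EuclideanSpace ℝ (Fin d)) (l : ℝ)
    (P : EuclideanSpace ℝ (Fin d) → ℝ) : Prop :=
  P ∈ PolyLE d n ∧
    (ENNReal.ofReal (l ^ d))⁻¹ * ∫⁻ x in cube x₀ l, ENNReal.ofReal |f x - P x| ≤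
      ENNReal.ofReal (C₀ * ω l) * zygSeminorm ω n D f



namespace ZT

abbrev EE (d : ℕ) := EuclideanSpace ℝ (Fin d)

lemma abs_coord_le {d : ℕ} (x : EE d) (i : Fin d) : |x i| ≤ ‖x‖ := by
  have := EuclideanSpace.norm_eq x
  rw [this]
  apply Real.le_sqrt_of_sq_le
  rw [sq_abs]
  have h := Finset.single_le_sum (f := fun i => ‖x i‖ ^ 2) (fun i _ => by positivity) (Finset.mem_univ i)
  simpa using h

lemma norm_le_of_coord {d : ℕ} (x : EE d) {a : ℝ} (ha : 0 ≤ a) (h : ∀ i, |x i| ≤ a) :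
    ‖x‖ ≤ d * a := by
  rw [EuclideanSpace.norm_eq x]
  apply Real.sqrt_le_iff.2
  refine ⟨by positivity, ?_⟩
  calc ∑ i, ‖x i‖ ^ 2 ≤ ∑ i : Fin d, a ^ 2 := by
        apply Finset.sum_le_sum
        intro i _
        exact pow_le_pow_left₀ (norm_nonneg _) (h i) 2
    _ = d * a ^ 2 := by simp
    _ ≤ (d * a) ^ 2 := by
        rw [mul_pow]
        apply mul_le_mul_of_nonneg_right _ (by positivity)
        rcases Nat.eq_zero_or_pos d with h | h
        · simp [h]
        · have : (1 : ℝ) ≤ d := by exact_mod_cast h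
          nlinarith

lemma mem_cube {d : ℕ} {x x₀ : EE d} {l : ℝ} : x ∈ cube x₀ l ↔ ∀ i, |x i - x₀ i| ≤ l / 2 := Iff.rfl

lemma mem_cube_self {d : ℕ} (x₀ : EE d) {l : ℝ} (hl : 0 ≤ l) : x₀ ∈ cube x₀ l := by
  intro i; simp; positivity

lemma norm_sub_le_of_mem_cube {d : ℕ} {x x₀ : EE d} {l : ℝ} (hl : 0 ≤ l) (h : x ∈ cube x₀ l) :
    ‖x - x₀‖ ≤ d * l := by
  refine (norm_le_of_coord (x - x₀) (a := l / 2) (by positivity) h).trans ?_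
  have : (0:ℝ) ≤ d := by positivity
  nlinarith

lemma closedBall_subset_cube {d : ℕ} (x : EE d) (l : ℝ) : closedBall x (l / 2) ⊆ cube x l := by
  intro y hy i
  have := abs_coord_le (y - x) i
  rw [mem_closedBall, dist_eq_norm] at hy
  simp at this
  linarith

lemma mem_cube_of_norm {d : ℕ} {x y : EE d} {l : ℝ} (h : ‖y - x‖ ≤ l / 2) : y ∈ cube x l := by
  apply closedBall_subset_cube
  rwa [mem_closedBall, dist_eq_norm]

lemma cube_subset_cube {d : ℕ} {x y : EE d} {l m : ℝ} (h : ‖x - y‖ + l / 2 ≤ m / 2) :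
    cube x l ⊆ cube y m := by
  intro z hz i
  have h1 := abs_coord_le (x - y) i
  have h2 := hz i
  simp at h1
  have := abs_add_le (z i - x i) (x i - y i)
  have e : z i - x i + (x i - y i) = z i - y i := by ring
  rw [e] at this
  linarith

lemma cube_mono {d : ℕ} {x : EE d} {l m : ℝ} (h : l ≤ m) : cube x l ⊆ cube x m :=
  cube_subset_cube (by simp; linarith)

lemma isClosed_cube {d : ℕ} (x : EE d) (l : ℝ) : IsClosed (cube x l) := by
  have : cube x l = ⋂ i, {y : EE d | |y i - x i| ≤ l / 2} := by ext; simp [mem_cube]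
  rw [this]
  apply isClosed_iInter
  intro i
  apply isClosed_le <;> fun_prop

lemma measurableSet_cube {d : ℕ} (x : EE d) (l : ℝ) : MeasurableSet (cube x l) :=
  (isClosed_cube x l).measurableSet

lemma isCompact_cube {d : ℕ} (x : EE d) (l : ℝ) (hl : 0 ≤ l) : IsCompact (cube x l) := by
  apply (isCompact_closedBall x (d * l)).of_isClosed_subset (isClosed_cube x l)
  intro y hy
  rw [mem_closedBall, dist_eq_norm]
  exact norm_sub_le_of_mem_cube hl hy

lemma convex_cube {d : ℕ} (x : EE d) (l : ℝ) : Convex ℝ (cube x l) := by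
  intro y hy z hz a b ha hb hab i
  have h1 := hy i
  have h2 := hz i
  have e : (a • y + b • z) i - x i = a * (y i - x i) + b * (z i - x i) := by
    simp
    have : x i = (a + b) * x i := by rw [hab]; ring
    linear_combination (-1 : ℝ) * this
  rw [e]
  rw [abs_le] at *
  constructor <;> nlinarith

lemma volume_cube {d : ℕ} (x : EE d) {l : ℝ} (hl : 0 ≤ l) :
    volume (cube x l) = ENNReal.ofReal (l ^ d) := by
  have h := EuclideanSpace.volume_preserving_symm_measurableEquiv_toLp (Fin d)
  have e : cube x l = (MeasurableEquiv.toLp 2 (Fin d → ℝ)).symm ⁻¹'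
      (Icc (fun i => x i - l / 2) (fun i => x i + l / 2)) := by
    ext y
    simp only [mem_cube, mem_preimage, mem_Icc, Pi.le_def, abs_le]
    rw [← forall_and]
    apply forall_congr'
    intro i
    constructor
    · rintro ⟨h1, h2⟩
      constructor
      · change x i - l / 2 ≤ y i
        linarith
      · change y i ≤ x i + l / 2
        linarith
    · rintro ⟨h1, h2⟩
      change x i - l / 2 ≤ y i at h1
      change y i ≤ x i + l / 2 at h2
      constructor <;> linarith
  rw [e, h.measure_preimage measurableSet_Icc.nullMeasurableSet, Real.volume_Icc_pi]
  have : ∀ i : Fin d, x i + l / 2 - (x i - l / 2) = l := fun i => by ring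
  simp only [this]
  rw [Finset.prod_const, ENNReal.ofReal_pow hl]
  simp

lemma volume_real_cube {d : ℕ} (x : EE d) {l : ℝ} (hl : 0 ≤ l) :
    volume.real (cube x l) = l ^ d := by
  rw [Measure.real, volume_cube x hl, ENNReal.toReal_ofReal (by positivity)]

lemma setIntegral_cube {d : ℕ} (F : EE d → ℝ) (x₀ : EE d) {l : ℝ} (hl : 0 < l) :
    ∫ x in cube x₀ l, F x = l ^ d * ∫ u in cube (0 : EE d) 1, F (x₀ + l • u) := by
  have h1 := Measure.setIntegral_comp_smul_of_pos (volume : Measure (EE d)) (fun x => F (x₀ + x))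
    (cube (0 : EE d) 1) hl
  rw [h1]
  simp only [finrank_euclideanSpace, Fintype.card_fin, smul_eq_mul]
  rw [← mul_assoc, mul_inv_cancel₀ (by positivity), one_mul]
  have h2 := (measurePreserving_add_left (volume : Measure (EE d)) x₀).setIntegral_preimage_emb
    (MeasurableEquiv.addLeft x₀).measurableEmbedding F (cube x₀ l)
  rw [← h2]
  congr 2
  ext u
  simp only [mem_preimage, mem_smul_set_iff_inv_smul_mem₀ hl.ne', mem_cube]
  apply forall_congr'
  intro i
  simp [abs_mul, abs_of_pos hl]
  rw [inv_mul_le_iff₀ hl]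
  ring_nf

/-! ### polynomials -/
open MvPolynomial

def pe {d : ℕ} (p : MvPolynomial (Fin d) ℝ) (x : EE d) : ℝ := MvPolynomial.eval (fun i => x i) p

@[simp] lemma pe_add {d : ℕ} (p q : MvPolynomial (Fin d) ℝ) (x : EE d) :
    pe (p + q) x = pe p x + pe q x := by simp [pe]
@[simp] lemma pe_sub {d : ℕ} (p q : MvPolynomial (Fin d) ℝ) (x : EE d) :
    pe (p - q) x = pe p x - pe q x := by simp [pe]
@[simp] lemma pe_zero {d : ℕ} (x : EE d) : pe (0 : MvPolynomial (Fin d) ℝ) x = 0 := by simp [pe]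
@[simp] lemma pe_C {d : ℕ} (a : ℝ) (x : EE d) : pe (C a : MvPolynomial (Fin d) ℝ) x = a := by
  simp [pe]
@[simp] lemma pe_smul {d : ℕ} (a : ℝ) (p : MvPolynomial (Fin d) ℝ) (x : EE d) :
    pe (a • p) x = a * pe p x := by simp [pe, smul_eval]
lemma pe_sum {d : ℕ} {ι : Type*} (s : Finset ι) (p : ι → MvPolynomial (Fin d) ℝ) (x : EE d) :
    pe (∑ i ∈ s, p i) x = ∑ i ∈ s, pe (p i) x := by simp [pe, map_sum]

lemma contDiff_pe {d : ℕ} (p : MvPolynomial (Fin d) ℝ) : ContDiff ℝ 1 (pe p) := by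
  have : pe p = fun x : EE d => ∑ a ∈ p.support, coeff a p * ∏ i, x i ^ a i := by
    funext x; exact eval_eq' _ _
  rw [this]
  apply ContDiff.sum
  intro a _
  apply contDiff_const.mul
  apply contDiff_prod
  intro i _
  apply ContDiff.pow
  fun_prop

lemma continuous_pe {d : ℕ} (p : MvPolynomial (Fin d) ℝ) : Continuous (pe p) :=
  (contDiff_pe p).continuous

lemma mem_polyLE {d n : ℕ} {P : EE d → ℝ} :
    P ∈ PolyLE d n ↔ ∃ p : MvPolynomial (Fin d) ℝ, p.totalDegree ≤ n ∧ P = pe p := by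
  constructor
  · rintro ⟨p, hp, h⟩; exact ⟨p, hp, funext fun x => (h x).symm⟩
  · rintro ⟨p, hp, rfl⟩; exact ⟨p, hp, fun x => rfl⟩

lemma pe_mem {d n : ℕ} {p : MvPolynomial (Fin d) ℝ} (hp : p.totalDegree ≤ n) :
    pe p ∈ PolyLE d n := mem_polyLE.2 ⟨p, hp, rfl⟩

/-- substitution `u ↦ x₀ + l u` -/
def aff {d : ℕ} (x₀ : EE d) (l : ℝ) : MvPolynomial (Fin d) ℝ →ₐ[ℝ] MvPolynomial (Fin d) ℝ :=
  bind₁ (fun i => C (x₀ i) + C l * X i)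

lemma pe_aff {d : ℕ} (x₀ : EE d) (l : ℝ) (p : MvPolynomial (Fin d) ℝ) (u : EE d) :
    pe (aff x₀ l p) u = pe p (x₀ + l • u) := by
  simp only [pe, aff]
  rw [← MvPolynomial.coe_aeval_eq_eval, ← MvPolynomial.coe_aeval_eq_eval]
  simp only [RingHom.coe_coe]
  rw [aeval_bind₁]
  simp

lemma totalDegree_bind_le {d n : ℕ} (f : Fin d → MvPolynomial (Fin d) ℝ)
    (hf : ∀ i, (f i).totalDegree ≤ 1)
    (p : MvPolynomial (Fin d) ℝ) (hp : p.totalDegree ≤ n) : (bind₁ f p).totalDegree ≤ n := by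
  rw [p.as_sum, map_sum]
  apply totalDegree_finsetSum_le
  intro a ha
  rw [bind₁_monomial]
  refine (totalDegree_mul _ _).trans ?_
  rw [totalDegree_C, zero_add]
  refine (totalDegree_finsetProd _ _).trans ?_
  refine (Finset.sum_le_sum (g := fun i => a i) ?_).trans ((le_totalDegree ha).trans hp)
  intro i _
  refine (totalDegree_pow _ _).trans ?_
  simpa using Nat.mul_le_mul_left (a i) (hf i)

lemma totalDegree_aff {d n : ℕ} (x₀ : EE d) (l : ℝ) {p : MvPolynomial (Fin d) ℝ}
    (hp : p.totalDegree ≤ n) : (aff x₀ l p).totalDegree ≤ n := by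
  apply totalDegree_bind_le _ _ p hp
  intro i
  refine (totalDegree_add _ _).trans ?_
  rw [totalDegree_C]
  simp only [zero_le, sup_of_le_right]
  refine (totalDegree_mul _ _).trans ?_
  simp

lemma pe_ext {d : ℕ} {p q : MvPolynomial (Fin d) ℝ} (h : ∀ x, pe p x = pe q x) : p = q := by
  apply MvPolynomial.funext
  intro x
  exact h (WithLp.toLp 2 x)

lemma coeff_aff_zero {d : ℕ} (l : ℝ) (p : MvPolynomial (Fin d) ℝ) (a : Fin d →₀ ℕ) :
    coeff a (aff 0 l p) = l ^ a.degree * coeff a p := by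
  have key : aff 0 l p = ∑ b ∈ p.support, monomial b (l ^ b.degree * coeff b p) := by
    apply pe_ext
    intro x
    rw [pe_aff, pe_sum]
    simp only [pe, eval_eq', zero_add]
    apply Finset.sum_congr rfl
    intro b hb
    rw [← eval_eq', eval_monomial, Finsupp.prod_fintype _ _ (by simp)]
    simp only [PiLp.smul_apply, smul_eq_mul, mul_pow, Finset.prod_mul_distrib]
    rw [Finset.prod_pow_eq_pow_sum, Finsupp.degree_eq_sum]
    ring
  rw [key, coeff_sum]
  simp only [coeff_monomial]
  rw [Finset.sum_ite_eq']
  split_ifs with h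
  · rfl
  · rw [notMem_support_iff] at h; rw [h, mul_zero]

end ZT


namespace ZT
open MvPolynomial

lemma findim_bound {V : Type*} [AddCommGroup V] [Module ℝ V] [FiniteDimensional ℝ V]
    (N : Seminorm ℝ V) (hN : ∀ v, N v = 0 → v = 0) (φ : V →ₗ[ℝ] ℝ) :
    ∃ C : ℝ, 0 < C ∧ ∀ v, |φ v| ≤ C * N v := by
  let NA : AddGroupNorm V :=
    { toFun := N
      map_zero' := map_zero N
      add_le' := fun x y => map_add_le_add N x y
      neg' := fun x => map_neg_eq_map N x
      eq_zero_of_map_eq_zero' := hN }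
  let _ : NormedAddCommGroup V := NA.toNormedAddCommGroup
  let _ : NormedSpace ℝ V := ⟨fun c x => (map_smul_eq_mul N c x).le⟩
  let ψ : V →L[ℝ] ℝ := LinearMap.toContinuousLinearMap φ
  refine ⟨‖ψ‖ + 1, by positivity, fun v => ?_⟩
  have h := ψ.le_opNorm v
  have h2 : ‖v‖ = N v := rfl
  rw [h2] at h
  have h3 : ‖ψ v‖ = |φ v| := rfl
  rw [h3] at h
  have := apply_nonneg N v
  linarith

lemma integrableOn_pe {d : ℕ} (p : MvPolynomial (Fin d) ℝ) (x : EE d) {l : ℝ} (hl : 0 ≤ l) :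
    IntegrableOn (pe p) (cube x l) :=
  (continuous_pe p).continuousOn.integrableOn_compact (isCompact_cube x l hl)

/-- seminorm on the polynomials of degree at most n. -/
def Nn (d n : ℕ) : Seminorm ℝ (restrictTotalDegree (Fin d) ℝ n) :=
  Seminorm.of (fun p => ∫ x in cube (0 : EE d) 1, |pe p.1 x|)
    (by
      intro p q
      have hp := (integrableOn_pe p.1 (0 : EE d) zero_le_one).abs
      have hq := (integrableOn_pe q.1 (0 : EE d) zero_le_one).abs
      rw [← integral_add hp hq]
      apply integral_mono_of_nonneg
      · exact Eventually.of_forall fun x => abs_nonneg _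
      · exact hp.add hq
      · refine Eventually.of_forall fun x => ?_
        simpa using abs_add_le (pe p.1 x) (pe q.1 x))
    (by
      intro a p
      simp [abs_mul, integral_const_mul])

lemma poly_zero_of_cube {d : ℕ} {p : MvPolynomial (Fin d) ℝ} {x₀ : EE d} {l : ℝ} (hl : 0 < l)
    (h : ∫ x in cube x₀ l, |pe p x| = 0) : p = 0 := by
  have h0 : ∀ᵐ x ∂(volume.restrict (cube x₀ l)), |pe p x| = 0 := by
    rw [integral_eq_zero_iff_of_nonneg] at h
    · exact h
    · intro x; exact abs_nonneg _
    · exact (integrableOn_pe p x₀ hl.le).abs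
  have h1 : ∀ x ∈ ball x₀ (l / 2), pe p x = 0 := by
    have h2 : pe p =ᵐ[volume.restrict (ball x₀ (l / 2))] (fun _ => 0) := by
      have : ball x₀ (l / 2) ⊆ cube x₀ l := ball_subset_closedBall.trans (closedBall_subset_cube _ _)
      have h3 := ae_restrict_of_ae_restrict_of_subset this h0
      filter_upwards [h3] with x hx
      exact abs_eq_zero.1 hx
    have := Measure.eqOn_open_of_ae_eq h2 isOpen_ball (continuous_pe p).continuousOn
      continuousOn_const
    exact this
  apply MvPolynomial.funext_set (fun i => Ioo (x₀ i - l / (4 * (d + 1))) (x₀ i + l / (4 * (d + 1))))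
  · intro i
    apply Set.Ioo_infinite
    have : 0 < l / (4 * (d + 1)) := by positivity
    linarith
  · intro x hx
    rw [map_zero]
    have := h1 (WithLp.toLp 2 x) ?_
    · exact this
    · rw [mem_ball, dist_eq_norm]
      have h5 := norm_le_of_coord (WithLp.toLp 2 x - x₀) (a := l / (4 * (d + 1))) (by positivity) ?_
      · refine h5.trans_lt ?_
        have hd : (0 : ℝ) ≤ d := by positivity
        have : (d : ℝ) * (l / (4 * (d + 1))) = (d / (d + 1)) * l / 4 := by field_simp
        rw [this]
        have : (d : ℝ) / (d + 1) ≤ 1 := by rw [div_le_one (by positivity)]; linarith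
        nlinarith
      · intro i
        have := hx i (mem_univ i)
        rw [mem_Ioo] at this
        rw [abs_le]
        simp
        constructor <;> linarith

lemma sq_degree_finite (d n : ℕ) : {a : Fin d →₀ ℕ | a.degree ≤ n}.Finite :=
  Finsupp.finite_of_degree_le n

def multi (d n : ℕ) : Finset (Fin d →₀ ℕ) := (sq_degree_finite d n).toFinset

lemma mem_multi {d n : ℕ} {a : Fin d →₀ ℕ} : a ∈ multi d n ↔ a.degree ≤ n := by
  simp [multi]

lemma support_subset_multi {d n : ℕ} {p : MvPolynomial (Fin d) ℝ} (hp : p.totalDegree ≤ n) :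
    p.support ⊆ multi d n := by
  intro a ha
  rw [mem_multi]
  refine le_trans ?_ ((le_totalDegree ha).trans hp)
  rfl

lemma coeff_bound_unit (d n : ℕ) : ∃ C : ℝ, 0 < C ∧ ∀ p : MvPolynomial (Fin d) ℝ,
    p.totalDegree ≤ n → ∀ a, |coeff a p| ≤ C * ∫ x in cube (0 : EE d) 1, |pe p x| := by
  have h : ∀ a : Fin d →₀ ℕ, ∃ C : ℝ, 0 < C ∧ ∀ p : restrictTotalDegree (Fin d) ℝ n,
      |coeff a p.1| ≤ C * Nn d n p := by
    intro a
    have := findim_bound (Nn d n) ?_ ((lcoeff ℝ a).comp (Submodule.subtype _))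
    · exact this
    · intro p hp
      have := poly_zero_of_cube one_pos hp
      exact Subtype.ext this
  choose C hC hb using h
  refine ⟨∑ a ∈ multi d n, C a + 1, ?_, ?_⟩
  · have := Finset.sum_nonneg (s := multi d n) (fun a _ => (hC a).le)
    linarith
  intro p hp a
  have hnn : 0 ≤ ∫ x in cube (0 : EE d) 1, |pe p x| := integral_nonneg fun x => abs_nonneg _
  by_cases ha : a ∈ p.support
  · have h1 := hb a ⟨p, (mem_restrictTotalDegree _ _ _).2 hp⟩
    change |coeff a p| ≤ C a * ∫ x in cube (0 : EE d) 1, |pe p x| at h1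
    refine h1.trans (mul_le_mul_of_nonneg_right ?_ hnn)
    have := Finset.single_le_sum (f := C) (fun i _ => (hC i).le) (support_subset_multi hp ha)
    linarith
  · rw [notMem_support_iff] at ha
    rw [ha, abs_zero]
    have := Finset.sum_nonneg (s := multi d n) (fun a _ => (hC a).le)
    positivity

/-- coefficients of the recentred polynomial -/
lemma coeff_bound (d n : ℕ) : ∃ C : ℝ, 0 < C ∧ ∀ p : MvPolynomial (Fin d) ℝ,
    p.totalDegree ≤ n → ∀ (x₀ : EE d) (l : ℝ), 0 < l → ∀ a,
      |coeff a (aff x₀ 1 p)| ≤ C * (l ^ a.degree)⁻¹ * ((l ^ d)⁻¹ * ∫ x in cube x₀ l, |pe p x|) := by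
  obtain ⟨C, hC, h⟩ := coeff_bound_unit d n
  refine ⟨C, hC, fun p hp x₀ l hl a => ?_⟩
  have h1 := h (aff x₀ l p) (totalDegree_aff _ _ hp) a
  have e : aff x₀ l p = aff 0 l (aff x₀ 1 p) := by
    apply pe_ext; intro x; simp [pe_aff]
  have h2 : ∫ u in cube (0 : EE d) 1, |pe (aff x₀ l p) u| = (l ^ d)⁻¹ * ∫ x in cube x₀ l, |pe p x| := by
    rw [setIntegral_cube _ x₀ hl, ← mul_assoc, inv_mul_cancel₀ (by positivity), one_mul]
    simp only [pe_aff]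
  rw [h2] at h1
  rw [e, coeff_aff_zero, abs_mul, abs_of_pos (by positivity)] at h1
  rw [mul_comm C, mul_assoc, ← div_eq_inv_mul, le_div_iff₀ (by positivity), mul_comm]
  exact h1

lemma abs_monomial_le {d : ℕ} (a : Fin d →₀ ℕ) (x : EE d) : |∏ i, x i ^ a i| ≤ ‖x‖ ^ a.degree := by
  rw [Finset.abs_prod, Finsupp.degree_eq_sum, ← Finset.prod_pow_eq_pow_sum]
  apply Finset.prod_le_prod
  · intro i _; positivity
  · intro i _
    rw [abs_pow]
    exact pow_le_pow_left₀ (abs_nonneg _) (abs_coord_le x i) _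

lemma pe_eq_recenter {d : ℕ} (p : MvPolynomial (Fin d) ℝ) (x₀ x : EE d) :
    pe p x = pe (aff x₀ 1 p) (x - x₀) := by
  rw [pe_aff]; simp

lemma pe_abs_le_sum {d n : ℕ} {p : MvPolynomial (Fin d) ℝ} (hp : p.totalDegree ≤ n) (x : EE d) :
    |pe p x| ≤ ∑ a ∈ multi d n, |coeff a p| * ‖x‖ ^ a.degree := by
  have : pe p x = ∑ a ∈ p.support, coeff a p * ∏ i, x i ^ a i := eval_eq' _ _
  rw [this]
  refine (Finset.abs_sum_le_sum_abs _ _).trans ?_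
  refine (Finset.sum_le_sum (g := fun a => |coeff a p| * ‖x‖ ^ a.degree) ?_).trans ?_
  · intro a _
    rw [abs_mul]
    exact mul_le_mul_of_nonneg_left (abs_monomial_le a x) (abs_nonneg _)
  · apply Finset.sum_le_sum_of_subset_of_nonneg (support_subset_multi hp)
    intros; positivity

/-- (P2) growth -/
lemma pe_growth (d n : ℕ) : ∃ C : ℝ, 1 ≤ C ∧ ∀ p : MvPolynomial (Fin d) ℝ,
    p.totalDegree ≤ n → ∀ (x₀ : EE d) (l : ℝ), 0 < l → ∀ x,
      |pe p x| ≤ C * (1 + ‖x - x₀‖ / l) ^ n * ((l ^ d)⁻¹ * ∫ x in cube x₀ l, |pe p x|) := by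
  obtain ⟨C, hC, h⟩ := coeff_bound d n
  refine ⟨C * (multi d n).card + 1, by simp; positivity, fun p hp x₀ l hl x => ?_⟩
  set I := (l ^ d)⁻¹ * ∫ x in cube x₀ l, |pe p x| with hI
  have hI0 : 0 ≤ I := by
    have : 0 ≤ ∫ x in cube x₀ l, |pe p x| := integral_nonneg fun x => abs_nonneg _
    positivity
  rw [pe_eq_recenter p x₀ x]
  refine (pe_abs_le_sum (totalDegree_aff x₀ 1 hp) _).trans ?_
  refine (Finset.sum_le_sum (g := fun a => C * (1 + ‖x - x₀‖ / l) ^ n * I) ?_).trans ?_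
  · intro a ha
    rw [mem_multi] at ha
    refine (mul_le_mul_of_nonneg_right (h p hp x₀ l hl a) (by positivity)).trans ?_
    have : C * (l ^ a.degree)⁻¹ * I * ‖x - x₀‖ ^ a.degree = C * (‖x - x₀‖ / l) ^ a.degree * I := by
      rw [div_pow]; field_simp
    rw [this]
    gcongr
    calc (‖x - x₀‖ / l) ^ a.degree ≤ (1 + ‖x - x₀‖ / l) ^ a.degree := by
          gcongr; linarith
      _ ≤ _ := by
          apply pow_le_pow_right₀ _ ha
          have : 0 ≤ ‖x - x₀‖ / l := by positivity
          linarith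
  · rw [Finset.sum_const, nsmul_eq_mul]
    have : 0 ≤ (1 + ‖x - x₀‖ / l) ^ n * I := by positivity
    nlinarith

/-- (P3) Lipschitz bound -/
lemma pe_lip (d n : ℕ) : ∃ C : ℝ, 0 < C ∧ ∀ p : MvPolynomial (Fin d) ℝ,
    p.totalDegree ≤ n → ∀ (x₀ : EE d) (l : ℝ), 0 < l → ∀ x ∈ cube x₀ l, ∀ y ∈ cube x₀ l,
      |pe p x - pe p y| ≤ C * (‖x - y‖ / l) * ((l ^ d)⁻¹ * ∫ x in cube x₀ l, |pe p x|) := by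
  obtain ⟨C, hC, h⟩ := coeff_bound_unit d n
  have hL : ∀ a : Fin d →₀ ℕ, ∃ L : NNReal, LipschitzOnWith L (pe (monomial a (1 : ℝ)))
      (cube (0 : EE d) 1) := fun a =>
    (contDiff_pe _).contDiffOn.exists_lipschitzOnWith (by simp) (convex_cube _ _)
      (isCompact_cube _ _ zero_le_one)
  choose L hL using hL
  refine ⟨C * ∑ a ∈ multi d n, (L a : ℝ) + 1, by positivity, fun p hp x₀ l hl x hx y hy => ?_⟩
  have h1 := h (aff x₀ l p) (totalDegree_aff _ _ hp)
  have h2 : ∫ u in cube (0 : EE d) 1, |pe (aff x₀ l p) u| = (l ^ d)⁻¹ * ∫ x in cube x₀ l, |pe p x| := by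
    rw [setIntegral_cube _ x₀ hl, ← mul_assoc, inv_mul_cancel₀ (by positivity), one_mul]
    simp only [pe_aff]
  rw [h2] at h1
  set I := (l ^ d)⁻¹ * ∫ x in cube x₀ l, |pe p x| with hI
  have hI0 : 0 ≤ I := by
    have : 0 ≤ ∫ x in cube x₀ l, |pe p x| := integral_nonneg fun x => abs_nonneg _
    positivity
  have hr : ∀ z, pe p z = pe (aff x₀ l p) (l⁻¹ • (z - x₀)) := by
    intro z; rw [pe_aff, smul_smul, mul_inv_cancel₀ hl.ne']; simp
  have hmem : ∀ z ∈ cube x₀ l, l⁻¹ • (z - x₀) ∈ cube (0 : EE d) 1 := by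
    intro z hz i
    have := hz i
    simp [abs_mul, abs_of_pos hl]
    rw [inv_mul_le_iff₀ hl]
    linarith
  have hs : ∀ z : EE d, pe (aff x₀ l p) z =
      ∑ a ∈ multi d n, coeff a (aff x₀ l p) * pe (monomial a (1:ℝ)) z := by
    intro z
    conv_lhs => rw [(aff x₀ l p).as_sum]
    rw [pe_sum]
    rw [← Finset.sum_subset (support_subset_multi (totalDegree_aff x₀ l hp))]
    · apply Finset.sum_congr rfl
      intro a _
      rw [← pe_smul]
      congr 1
      simp [smul_monomial]
    · intro a _ ha
      rw [notMem_support_iff] at ha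
      simp [ha]
  rw [hr x, hr y, hs, hs, ← Finset.sum_sub_distrib]
  refine (Finset.abs_sum_le_sum_abs _ _).trans ?_
  refine (Finset.sum_le_sum (g := fun a => C * I * (‖x - y‖ / l) * L a) ?_).trans ?_
  · intro a _
    rw [← mul_sub, abs_mul]
    have h3 := (hL a).dist_le_mul _ (hmem x hx) _ (hmem y hy)
    rw [Real.dist_eq, dist_eq_norm, ← smul_sub, norm_smul] at h3
    have e : x - x₀ - (y - x₀) = x - y := by abel
    rw [e, norm_inv, Real.norm_of_nonneg hl.le] at h3
    calc _ ≤ (C * I) * (L a * (l⁻¹ * ‖x - y‖)) :=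
          mul_le_mul (h1 a) h3 (abs_nonneg _) (by positivity)
      _ = _ := by rw [div_eq_inv_mul]; ring
  · rw [← Finset.mul_sum]
    have : 0 ≤ ‖x - y‖ / l * I := by positivity
    nlinarith

/-- top and low parts at `x₀` -/
def top {d : ℕ} (n : ℕ) (x₀ : EE d) (p : MvPolynomial (Fin d) ℝ) : MvPolynomial (Fin d) ℝ :=
  homogeneousComponent n (aff x₀ 1 p)

def low {d : ℕ} (n : ℕ) (x₀ : EE d) (p : MvPolynomial (Fin d) ℝ) : MvPolynomial (Fin d) ℝ :=
  aff (-x₀) 1 (aff x₀ 1 p - top n x₀ p)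

lemma top_hom {d : ℕ} (n : ℕ) (x₀ : EE d) (p : MvPolynomial (Fin d) ℝ) :
    (top n x₀ p).IsHomogeneous n := homogeneousComponent_isHomogeneous _ _

lemma top_add {d : ℕ} (n : ℕ) (x₀ : EE d) (p q : MvPolynomial (Fin d) ℝ) :
    top n x₀ (p + q) = top n x₀ p + top n x₀ q := by simp [top]

lemma low_add {d : ℕ} (n : ℕ) (x₀ : EE d) (p q : MvPolynomial (Fin d) ℝ) :
    low n x₀ (p + q) = low n x₀ p + low n x₀ q := by
  simp only [low, top_add, map_add, map_sub]; abel

lemma pe_split {d : ℕ} (n : ℕ) (x₀ : EE d) (p : MvPolynomial (Fin d) ℝ) (x : EE d) :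
    pe p x = pe (top n x₀ p) (x - x₀) + pe (low n x₀ p) x := by
  rw [low, pe_aff, pe_sub, one_smul, pe_eq_recenter p x₀ x]
  have : -x₀ + x = x - x₀ := by abel
  rw [this]; ring

lemma low_deg {d : ℕ} {n : ℕ} (x₀ : EE d) {p : MvPolynomial (Fin d) ℝ} (hp : p.totalDegree ≤ n) :
    (low n x₀ p).totalDegree ≤ n := by
  apply totalDegree_aff
  refine (totalDegree_sub _ _).trans ?_
  exact max_le (totalDegree_aff _ _ hp) (top_hom n x₀ p).totalDegree_le

/-- (P4) -/
lemma top_low_bound (d n : ℕ) (hn : 0 < n) : ∃ C : ℝ, 0 < C ∧ ∀ p : MvPolynomial (Fin d) ℝ,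
    p.totalDegree ≤ n → ∀ (x₀ : EE d) (l : ℝ), 0 < l → l ≤ 1 → ∀ x,
      |pe (top n x₀ p) (x - x₀)| ≤ C * (1 + ‖x - x₀‖) ^ n * (l ^ n)⁻¹ *
        ((l ^ d)⁻¹ * ∫ x in cube x₀ l, |pe p x|) ∧ 
      |pe (low n x₀ p) x| ≤ C * (1 + ‖x - x₀‖) ^ n * (l ^ (n - 1))⁻¹ *
        ((l ^ d)⁻¹ * ∫ x in cube x₀ l, |pe p x|) := by
  obtain ⟨C, hC, h⟩ := coeff_bound d n
  refine ⟨C * (multi d n).card + 1, by positivity, fun p hp x₀ l hl hl1 x => ?_⟩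
  set I := (l ^ d)⁻¹ * ∫ x in cube x₀ l, |pe p x| with hI
  have hI0 : 0 ≤ I := by
    have : 0 ≤ ∫ x in cube x₀ l, |pe p x| := integral_nonneg fun x => abs_nonneg _
    positivity
  have gen : ∀ (q : MvPolynomial (Fin d) ℝ) (m : ℕ), q.totalDegree ≤ n →
      (∀ a, a.degree ≤ n → |coeff a q| ≤ C * (l ^ m)⁻¹ * I) → 
      |pe q (x - x₀)| ≤ (C * (multi d n).card + 1) * (1 + ‖x - x₀‖) ^ n * (l ^ m)⁻¹ * I := by
    intro q m hq hqa
    refine (pe_abs_le_sum hq _).trans ?_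
    refine (Finset.sum_le_sum (g := fun a => C * (l ^ m)⁻¹ * I * (1 + ‖x - x₀‖) ^ n) ?_).trans ?_
    · intro a ha
      rw [mem_multi] at ha
      apply mul_le_mul (hqa a ha) _ (by positivity) (by positivity)
      calc ‖x - x₀‖ ^ a.degree ≤ (1 + ‖x - x₀‖) ^ a.degree := by gcongr; linarith
        _ ≤ _ := by
          apply pow_le_pow_right₀ _ ha
          have : 0 ≤ ‖x - x₀‖ := by positivity
          linarith
    · rw [Finset.sum_const, nsmul_eq_mul]
      have : 0 ≤ (l ^ m)⁻¹ * I * (1 + ‖x - x₀‖) ^ n := by positivity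
      nlinarith
  constructor
  · apply gen _ _ (top_hom n x₀ p).totalDegree_le
    intro a ha
    rw [top, coeff_homogeneousComponent]
    split_ifs with h1
    · have := h p hp x₀ l hl a
      rwa [h1] at this
    · rw [abs_zero]; positivity
  · have e : pe (low n x₀ p) x = pe (aff x₀ 1 p - top n x₀ p) (x - x₀) := by
      rw [low, pe_aff, one_smul]
      congr 1; abel
    rw [e]
    apply gen
    · refine (totalDegree_sub _ _).trans ?_
      exact max_le (totalDegree_aff _ _ hp) (top_hom n x₀ p).totalDegree_le
    intro a ha
    have e2 : coeff a (top n x₀ p) = if a.degree = n then coeff a (aff x₀ 1 p) else 0 :=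
      coeff_homogeneousComponent _ _ _
    rw [coeff_sub, e2]
    by_cases h1 : a.degree = n
    · rw [if_pos h1, sub_self, abs_zero]
      exact mul_nonneg (mul_nonneg hC.le (inv_nonneg.2 (pow_nonneg hl.le _))) hI0
    · rw [if_neg h1, sub_zero]
      refine (h p hp x₀ l hl a).trans ?_
      have h2 : a.degree ≤ n - 1 := Nat.le_sub_one_of_lt (lt_of_le_of_ne ha h1)
      have h3 : (l ^ a.degree)⁻¹ ≤ (l ^ (n - 1))⁻¹ :=
        inv_anti₀ (by positivity) (pow_le_pow_of_le_one hl.le hl1 h2)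
      exact mul_le_mul_of_nonneg_right (mul_le_mul_of_nonneg_left h3 hC.le) hI0

end ZT


namespace ZT
open MvPolynomial

structure MD (ω : ℝ → ℝ) (n : ℕ) (q r C : ℝ) : Prop where
  n_pos : 0 < n
  hq : (n : ℝ) < q
  hq1 : q < n + 1
  hr : (n : ℝ) - 1 < r
  hr1 : r < n
  hC : 1 ≤ C
  pos : ∀ t, 0 < t → 0 < ω t
  mono : ∀ s t, 0 < s → s ≤ t → ω s ≤ ω t
  up : ∀ s t, 1 ≤ s → 0 < t → ω (s * t) ≤ C * s ^ q * ω t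
  down : ∀ s t, 0 < s → s ≤ 1 → 0 < t → ω (s * t) ≤ C * s ^ r * ω t
  cont : ContinuousOn ω (Ici 0)

lemma MD.r_pos {ω : ℝ → ℝ} {n : ℕ} {q r C : ℝ} (h : MD ω n q r C) : 0 < r := by
  have : (1 : ℝ) ≤ n := by exact_mod_cast h.n_pos
  have := h.hr
  linarith

lemma MD.q_pos {ω : ℝ → ℝ} {n : ℕ} {q r C : ℝ} (h : MD ω n q r C) : 0 < q := by
  have : (1 : ℝ) ≤ n := by exact_mod_cast h.n_pos
  have := h.hq
  linarith

lemma exists_MD {ω : ℝ → ℝ} {n : ℕ} (h : IsModulusOfOrder ω n) (h0 : ∃ t, 0 < t ∧ ω t ≠ 0) :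
    ∃ q r C, MD ω n q r C := by
  obtain ⟨t₀, ht₀, hne⟩ := h0
  obtain ⟨⟨q, hq, hq1, C1, hC1, h1⟩, ⟨r, hr, hr1, C2, hC2, h2⟩⟩ := h.conds
  have mono : ∀ s t, 0 < s → s ≤ t → ω s ≤ ω t := fun s t hs hst =>
    h.monotoneOn (mem_Ici.2 hs.le) (mem_Ici.2 (hs.le.trans hst)) hst
  have pos : ∀ t, 0 < t → 0 < ω t := by
    intro t ht
    rcases (h.nonneg t ht.le).lt_or_eq with h3 | h3
    · exact h3
    · exfalso
      have hp : 0 < ω t₀ := lt_of_le_of_ne (h.nonneg _ ht₀.le) (Ne.symm hne)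
      rcases le_or_gt t₀ t with h4 | h4
      · have := mono _ _ ht₀ h4
        linarith
      · have := h1 (t₀ / t) t ((one_lt_div ht).2 h4) ht
        rw [div_mul_cancel₀ _ ht.ne', ← h3, mul_zero] at this
        linarith
  refine ⟨(max q (n + 1/2)), r, max 1 (max C1 C2), h.npos, ?_, ?_, hr, hr1, le_max_left _ _, pos, mono,
    ?_, ?_, h.continuousOn⟩
  · have := le_max_right q (n + 1/2); linarith
  · apply max_lt hq1; linarith
  · intro s t hs ht
    have hp := pos t ht
    rcases hs.lt_or_eq with hs | hs
    · refine (h1 s t hs ht).trans ?_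
      gcongr
      · exact (le_max_left _ _).trans (le_max_right _ _)
      · exact le_max_left _ _
    · rw [← hs, one_mul, Real.one_rpow, mul_one]
      exact le_mul_of_one_le_left hp.le (le_max_left _ _)
  · intro s t hs hs1 ht
    have hp := pos t ht
    rcases hs1.lt_or_eq with h3 | h3
    · refine (h2 s t hs h3 ht).trans ?_
      gcongr
      exact (le_max_right _ _).trans (le_max_right _ _)
    · rw [h3, one_mul, Real.one_rpow, mul_one]
      exact le_mul_of_one_le_left hp.le (le_max_left _ _)

/-- `p` approximates `f` on the cube. -/
def Ap {d : ℕ} (ω : ℝ → ℝ) (n : ℕ) (B : ℝ) (f : EE d → ℝ) (p : MvPolynomial (Fin d) ℝ)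
    (x : EE d) (l : ℝ) : Prop :=
  p.totalDegree ≤ n ∧ IntegrableOn f (cube x l) ∧
    ∫ y in cube x l, |f y - pe p y| ≤ B * ω l * l ^ d

lemma compare (d n : ℕ) : ∃ C : ℝ, 1 ≤ C ∧ ∀ (f : EE d → ℝ) (p₁ p₂ : MvPolynomial (Fin d) ℝ)
    (x x₁ x₂ : EE d) (l l₁ l₂ a₁ a₂ : ℝ), 0 < l → 0 < l₁ → 0 < l₂ →
    p₁.totalDegree ≤ n → p₂.totalDegree ≤ n →
    IntegrableOn f (cube x₁ l₁) → IntegrableOn f (cube x₂ l₂) →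
    cube x l ⊆ cube x₁ l₁ → cube x l ⊆ cube x₂ l₂ →
    ∫ y in cube x₁ l₁, |f y - pe p₁ y| ≤ a₁ * l ^ d →
    ∫ y in cube x₂ l₂, |f y - pe p₂ y| ≤ a₂ * l ^ d →
    (l ^ d)⁻¹ * ∫ y in cube x l, |pe (p₁ - p₂) y| ≤ a₁ + a₂ ∧
    ∀ y, |pe p₁ y - pe p₂ y| ≤ C * (1 + ‖y - x‖ / l) ^ n * (a₁ + a₂) := by
  obtain ⟨C, hC, h⟩ := pe_growth d n
  refine ⟨C, hC, fun f p₁ p₂ x x₁ x₂ l l₁ l₂ a₁ a₂ hl hl₁ hl₂ hp₁ hp₂ hf₁ hf₂ hs₁ hs₂ h₁ h₂ => ?_⟩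
  have key : (l ^ d)⁻¹ * ∫ y in cube x l, |pe (p₁ - p₂) y| ≤ a₁ + a₂ := by
    rw [inv_mul_le_iff₀ (by positivity)]
    have i₁ : IntegrableOn (fun y => |f y - pe p₁ y|) (cube x₁ l₁) :=
      (hf₁.sub (integrableOn_pe p₁ x₁ hl₁.le)).abs
    have i₂ : IntegrableOn (fun y => |f y - pe p₂ y|) (cube x₂ l₂) :=
      (hf₂.sub (integrableOn_pe p₂ x₂ hl₂.le)).abs
    have m₁ : ∫ y in cube x l, |f y - pe p₁ y| ≤ ∫ y in cube x₁ l₁, |f y - pe p₁ y| :=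
      setIntegral_mono_set i₁ (Eventually.of_forall fun _ => abs_nonneg _) hs₁.eventuallyLE
    have m₂ : ∫ y in cube x l, |f y - pe p₂ y| ≤ ∫ y in cube x₂ l₂, |f y - pe p₂ y| :=
      setIntegral_mono_set i₂ (Eventually.of_forall fun _ => abs_nonneg _) hs₂.eventuallyLE
    have : ∫ y in cube x l, |pe (p₁ - p₂) y| ≤
        ∫ y in cube x l, (|f y - pe p₁ y| + |f y - pe p₂ y|) := by
      apply integral_mono_of_nonneg (Eventually.of_forall fun _ => abs_nonneg _)
        ((i₁.mono_set hs₁).add (i₂.mono_set hs₂))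
      refine Eventually.of_forall fun y => ?_
      simp only [pe_sub]
      change |pe p₁ y - pe p₂ y| ≤ |f y - pe p₁ y| + |f y - pe p₂ y|
      rw [abs_sub_comm (f y) (pe p₁ y)]
      refine le_trans (le_of_eq ?_) (abs_add_le _ _)
      congr 1; ring
    rw [integral_add (i₁.mono_set hs₁) (i₂.mono_set hs₂)] at this
    linarith
  refine ⟨key, fun y => ?_⟩
  have hd : (p₁ - p₂).totalDegree ≤ n := (totalDegree_sub _ _).trans (max_le hp₁ hp₂)
  have h3 := h (p₁ - p₂) hd x l hl y
  rw [pe_sub] at h3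
  refine h3.trans ?_
  gcongr

def th (M : ℝ) : ℝ := 1 - 1 / (8 * (M + 1))

lemma th_facts {M : ℝ} (hM : 0 ≤ M) : 7 / 8 ≤ th M ∧ th M < 1 ∧ (1 - th M) * M ≤ 1 / 8 := by
  have h1 : 1 / (8 * (M + 1)) ≤ 1 / 8 := by
    apply one_div_le_one_div_of_le <;> linarith
  have h2 : 0 < 1 / (8 * (M + 1)) := by positivity
  refine ⟨by unfold th; linarith, by unfold th; linarith, ?_⟩
  unfold th
  have : (1 - (1 - 1 / (8 * (M + 1)))) * M = (M / (M + 1)) / 8 := by field_simp; ring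
  rw [this]
  have : M / (M + 1) ≤ 1 := by rw [div_le_one (by positivity)]; linarith
  linarith

lemma chain_step (d n : ℕ) {M : ℝ} (hM : 0 ≤ M) : ∃ C : ℝ, 1 ≤ C ∧ ∀ (ω : ℝ → ℝ) (q r Cω : ℝ),
    MD ω n q r Cω → ∀ (f : EE d → ℝ) (B : ℝ) (x₀ z : EE d) (l : ℝ) (p₁ p₂ : MvPolynomial (Fin d) ℝ),
    0 ≤ B → 0 < l → ‖z - x₀‖ ≤ M * l → Ap ω n B f p₁ z l →
    Ap ω n B f p₂ (x₀ + th M • (z - x₀)) (th M * l) →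
    (∀ y, |pe p₁ y - pe p₂ y| ≤ C * B * ω l * (1 + ‖y - x₀‖ / l) ^ n) := by
  obtain ⟨C, hC, h⟩ := compare d n
  obtain ⟨h1, h2, h3⟩ := th_facts hM
  refine ⟨C * (2 * (1 + M)) ^ n * 2 ^ (d + 1), ?_, ?_⟩
  · have e1 : (1:ℝ) ≤ (2 * (1 + M)) ^ n := one_le_pow₀ (by linarith)
    have e2 : (1:ℝ) ≤ 2 ^ (d + 1) := one_le_pow₀ (by norm_num)
    exact one_le_mul_of_one_le_of_one_le (one_le_mul_of_one_le_of_one_le hC e1) e2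
  intro ω q r Cω hω f B x₀ z l p₁ p₂ hB hl hz hp₁ hp₂ y
  have hth : 0 < th M := by linarith
  have hw := hω.pos l hl
  have hw2 := hω.pos (th M * l) (by positivity)
  have hw3 : ω (th M * l) ≤ ω l := hω.mono _ _ (by positivity) (by nlinarith)
  have h4 := (h f p₁ p₂ (x₀ + th M • (z - x₀)) z (x₀ + th M • (z - x₀)) (l / 2) l (th M * l)
    (2 ^ d * (B * ω l)) (2 ^ d * (B * ω l)) (by positivity) hl (by positivity) hp₁.1 hp₂.1 hp₁.2.1 hp₂.2.1
    ?_ ?_ ?_ ?_).2 y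
  · refine h4.trans ?_
    have e : ‖y - (x₀ + th M • (z - x₀))‖ ≤ ‖y - x₀‖ + M * l := by
      have : y - (x₀ + th M • (z - x₀)) = (y - x₀) - th M • (z - x₀) := by abel
      rw [this]
      refine (norm_sub_le _ _).trans ?_
      rw [norm_smul, Real.norm_of_nonneg hth.le]
      have : th M * ‖z - x₀‖ ≤ 1 * ‖z - x₀‖ := mul_le_mul_of_nonneg_right h2.le (norm_nonneg _)
      linarith
    have e2 : 1 + ‖y - (x₀ + th M • (z - x₀))‖ / (l / 2) ≤ (2 * (1 + M)) * (1 + ‖y - x₀‖ / l) := by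
      have : ‖y - (x₀ + th M • (z - x₀))‖ / (l / 2) ≤ (‖y - x₀‖ + M * l) / (l / 2) := by gcongr
      have e3 : (‖y - x₀‖ + M * l) / (l / 2) = 2 * (‖y - x₀‖ / l) + 2 * M := by field_simp
      have : 0 ≤ ‖y - x₀‖ / l := by positivity
      nlinarith
    calc C * (1 + ‖y - (x₀ + th M • (z - x₀))‖ / (l / 2)) ^ n * (2 ^ d * (B * ω l) + 2 ^ d * (B * ω l))
        ≤ C * ((2 * (1 + M)) * (1 + ‖y - x₀‖ / l)) ^ n * (2 ^ d * (B * ω l) + 2 ^ d * (B * ω l)) := by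
          gcongr
      _ = _ := by rw [mul_pow]; ring
  · apply cube_subset_cube
    have : x₀ + th M • (z - x₀) - z = (th M - 1) • (z - x₀) := by
      rw [sub_smul, one_smul]; abel
    rw [this, norm_smul, Real.norm_eq_abs, abs_sub_comm, abs_of_nonneg (by linarith)]
    have : (1 - th M) * ‖z - x₀‖ ≤ (1 - th M) * (M * l) :=
      mul_le_mul_of_nonneg_left hz (by linarith)
    nlinarith
  · apply cube_mono
    nlinarith
  · refine hp₁.2.2.trans (le_of_eq ?_)
    rw [div_pow]; field_simp
  · refine hp₂.2.2.trans ?_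
    have : 2 ^ d * (B * ω l) * (l / 2) ^ d = B * ω l * l ^ d := by rw [div_pow]; field_simp
    rw [this]
    gcongr
    nlinarith

/-- Lebesgue points -/
def LebPt {d : ℕ} (f : EE d → ℝ) (x : EE d) : Prop :=
  Tendsto (fun R : ℝ => (R ^ d)⁻¹ * ∫ y in closedBall x R, |f y - f x|) (𝓝[>] 0) (𝓝 0) ∧
    ∀ᶠ R in 𝓝[>] (0 : ℝ), IntegrableOn f (closedBall x R)

/-- carrot lemma -/
lemma carrot (d n : ℕ) {M : ℝ} (hM : 0 ≤ M) {ω : ℝ → ℝ} {q r Cω : ℝ} (hω : MD ω n q r Cω) :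
    ∃ C : ℝ, 1 ≤ C ∧ ∀ (f : EE d → ℝ) (B : ℝ) (x₀ z : EE d) (l : ℝ),
    0 ≤ B → 0 < l → ‖z - x₀‖ ≤ M * l → LebPt f x₀ →
    (∀ t : ℝ, 0 < t → t ≤ 1 → ∃ p, Ap ω n B f p (x₀ + t • (z - x₀)) (t * l)) →
    ∀ p, Ap ω n B f p z l → |f x₀ - pe p x₀| ≤ C * B * ω l := by
  obtain ⟨C, hC, hstep⟩ := chain_step d n hM
  obtain ⟨Cg, hCg, hg⟩ := pe_growth d n
  obtain ⟨h1, h2, h3⟩ := th_facts hM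
  have hth : 0 < th M := by linarith
  have hthr : th M ^ r < 1 := Real.rpow_lt_one hth.le h2 hω.r_pos
  have hthr0 : 0 < th M ^ r := Real.rpow_pos_of_pos hth r
  refine ⟨C * Cω * (1 - th M ^ r)⁻¹, ?_, ?_⟩
  · have : 1 ≤ (1 - th M ^ r)⁻¹ := (one_le_inv₀ (by linarith)).2 (by linarith)
    exact one_le_mul_of_one_le_of_one_le (one_le_mul_of_one_le_of_one_le hC hω.hC) this
  intro f B x₀ z l hB hl hz hleb hex p hp
  have hwl := hω.pos l hl
  -- choose the chain
  have hch : ∀ k : ℕ, ∃ pk, Ap ω n B f pk (x₀ + th M ^ k • (z - x₀)) (th M ^ k * l) ∧ (k = 0 → pk = p) := by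
    intro k
    rcases Nat.eq_zero_or_pos k with rfl | hk
    · refine ⟨p, ?_, fun _ => rfl⟩
      simpa using hp
    · obtain ⟨pk, hpk⟩ := hex (th M ^ k) (by positivity) (pow_le_one₀ hth.le h2.le)
      exact ⟨pk, hpk, fun h => absurd h hk.ne'⟩
  choose P hP hP0 using hch
  have hP0 : P 0 = p := hP0 0 rfl
  have hlk : ∀ k : ℕ, 0 < th M ^ k * l := fun k => by positivity
  have hωk : ∀ k : ℕ, ω (th M ^ k * l) ≤ Cω * (th M ^ r) ^ k * ω l := by
    intro k
    have := hω.down (th M ^ k) l (by positivity) (pow_le_one₀ hth.le h2.le) hl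
    have e : (th M ^ k) ^ r = (th M ^ r) ^ k := by
      rw [← Real.rpow_natCast (th M) k, ← Real.rpow_natCast (th M ^ r) k, ← Real.rpow_mul hth.le,
        ← Real.rpow_mul hth.le, mul_comm]
    rwa [e] at this
  have hdiff : ∀ k : ℕ, |pe (P k) x₀ - pe (P (k + 1)) x₀| ≤ C * B * Cω * ω l * (th M ^ r) ^ k := by
    intro k
    have := hstep ω q r Cω hω f B x₀ (x₀ + th M ^ k • (z - x₀)) (th M ^ k * l) (P k) (P (k + 1)) hB
      (hlk k) ?_ (hP k) ?_ x₀
    · refine this.trans ?_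
      simp only [sub_self, norm_zero, zero_div, add_zero, one_pow, mul_one]
      calc C * B * ω (th M ^ k * l) ≤ C * B * (Cω * (th M ^ r) ^ k * ω l) := by
            gcongr; exact hωk k
        _ = _ := by ring
    · rw [add_sub_cancel_left, norm_smul, norm_pow, Real.norm_of_nonneg hth.le]
      calc th M ^ k * ‖z - x₀‖ ≤ th M ^ k * (M * l) := by gcongr
        _ = _ := by ring
    · have := hP (k + 1)
      convert this using 1
      · rw [add_sub_cancel_left, smul_smul, pow_succ']
      · ring
  have hsum : ∀ k : ℕ, |pe p x₀ - pe (P k) x₀| ≤ C * B * Cω * ω l * (1 - th M ^ r)⁻¹ := by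
    intro k
    have e : pe p x₀ - pe (P k) x₀ = ∑ i ∈ Finset.range k, (pe (P i) x₀ - pe (P (i + 1)) x₀) := by
      rw [Finset.sum_range_sub', hP0]
    rw [e]
    refine (Finset.abs_sum_le_sum_abs _ _).trans ?_
    refine (Finset.sum_le_sum fun i _ => hdiff i).trans ?_
    rw [← Finset.mul_sum]
    have hc : 0 ≤ Cω := by linarith [hω.hC]
    gcongr
    have := Summable.sum_le_tsum (Finset.range k) (fun i _ => by positivity)
      (summable_geometric_of_lt_one hthr0.le hthr)
    rwa [tsum_geometric_of_lt_one hthr0.le hthr] at this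
  -- limit
  set K : ℝ := M + d + 1 with hK
  have hK0 : 0 < K := by positivity
  have htend : Tendsto (fun k : ℕ => th M ^ k * l) atTop (𝓝[>] 0) := by
    rw [tendsto_nhdsWithin_iff]
    refine ⟨?_, Eventually.of_forall fun k => hlk k⟩
    have := (tendsto_pow_atTop_nhds_zero_of_lt_one hth.le h2).mul_const l
    simpa using this
  have htendK : Tendsto (fun k : ℕ => K * (th M ^ k * l)) atTop (𝓝[>] 0) := by
    rw [tendsto_nhdsWithin_iff] at htend ⊢
    refine ⟨?_, Eventually.of_forall fun k => mul_pos hK0 (hlk k)⟩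
    have := htend.1.const_mul K
    simpa using this
  have hA := hleb.1.comp htendK
  have hI := htendK.eventually hleb.2
  have hlim : Tendsto (fun k : ℕ => pe (P k) x₀) atTop (𝓝 (f x₀)) := by
    rw [tendsto_iff_norm_sub_tendsto_zero]
    have hbound : ∀ᶠ k : ℕ in atTop, ‖pe (P k) x₀ - f x₀‖ ≤ Cg * (1 + M) ^ n * 
        (B * (Cω * (th M ^ r) ^ k * ω l) + K ^ d * 
          (((K * (th M ^ k * l)) ^ d)⁻¹ * ∫ y in closedBall x₀ (K * (th M ^ k * l)), |f y - f x₀|)) := by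
      filter_upwards [hI] with k hk
      set lk := th M ^ k * l with hlk'
      set zk := x₀ + th M ^ k • (z - x₀) with hzk
      have hlkp : 0 < lk := hlk k
      have hzx : ‖zk - x₀‖ ≤ M * lk := by
        rw [hzk, add_sub_cancel_left, norm_smul, norm_pow, Real.norm_of_nonneg hth.le]
        calc th M ^ k * ‖z - x₀‖ ≤ th M ^ k * (M * l) := by gcongr
          _ = _ := by rw [hlk']; ring
      have hd : (P k - MvPolynomial.C (f x₀)).totalDegree ≤ n :=
        (totalDegree_sub _ _).trans (max_le (hP k).1 (by simp))
      have h5 := hg _ hd zk lk hlkp x₀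
      simp only [pe_sub, pe_C] at h5
      rw [Real.norm_eq_abs]
      refine h5.trans ?_
      have hsub : cube zk lk ⊆ closedBall x₀ (K * lk) := by
        intro y hy
        rw [mem_closedBall, dist_eq_norm]
        have e1 := norm_sub_le_of_mem_cube hlkp.le hy
        have : y - x₀ = (y - zk) + (zk - x₀) := by abel
        rw [this]
        refine (norm_add_le _ _).trans ?_
        rw [hK]
        nlinarith
      have i1 : IntegrableOn (fun y => |f y - pe (P k) y|) (cube zk lk) :=
        ((hP k).2.1.sub (integrableOn_pe (P k) zk hlkp.le)).abs
      have i2 : IntegrableOn (fun y => |f y - f x₀|) (closedBall x₀ (K * lk)) :=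
        (hk.sub (integrableOn_const measure_closedBall_lt_top.ne)).abs
      have h6 : ∫ y in cube zk lk, |pe (P k) y - f x₀| ≤ B * ω lk * lk ^ d + 
          ∫ y in closedBall x₀ (K * lk), |f y - f x₀| := by
        calc ∫ y in cube zk lk, |pe (P k) y - f x₀| 
            ≤ ∫ y in cube zk lk, (|f y - pe (P k) y| + |f y - f x₀|) := by
              apply integral_mono_of_nonneg (Eventually.of_forall fun _ => abs_nonneg _)
                (i1.add (i2.mono_set hsub))
              refine Eventually.of_forall fun y => ?_
              change |pe (P k) y - f x₀| ≤ |f y - pe (P k) y| + |f y - f x₀|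
              rw [abs_sub_comm (f y) (pe (P k) y)]
              refine le_trans (le_of_eq ?_) (abs_add_le _ _)
              congr 1; ring
          _ = (∫ y in cube zk lk, |f y - pe (P k) y|) + ∫ y in cube zk lk, |f y - f x₀| :=
              integral_add i1 (i2.mono_set hsub)
          _ ≤ _ := by
              apply add_le_add (hP k).2.2
              exact setIntegral_mono_set i2 (Eventually.of_forall fun _ => abs_nonneg _)
                hsub.eventuallyLE
      have h7 : 1 + ‖x₀ - zk‖ / lk ≤ 1 + M := by
        rw [norm_sub_rev]
        have : ‖zk - x₀‖ / lk ≤ M := by rwa [div_le_iff₀ hlkp]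
        linarith
      gcongr
      calc (lk ^ d)⁻¹ * ∫ y in cube zk lk, |pe (P k) y - f x₀| 
          ≤ (lk ^ d)⁻¹ * (B * ω lk * lk ^ d + ∫ y in closedBall x₀ (K * lk), |f y - f x₀|) := by
            gcongr
        _ = B * ω lk + K ^ d * (((K * lk) ^ d)⁻¹ * ∫ y in closedBall x₀ (K * lk), |f y - f x₀|) := by
            have n1 : lk ^ d ≠ 0 := by positivity
            have n2 : K ^ d ≠ 0 := by positivity
            rw [mul_pow K lk, mul_inv (K ^ d), mul_add, ← mul_assoc (K ^ d), ← mul_assoc (K ^ d),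
              mul_inv_cancel₀ n2, one_mul, mul_comm (B * ω lk) (lk ^ d), ← mul_assoc,
              inv_mul_cancel₀ n1, one_mul]
        _ ≤ _ := by gcongr; exact hωk k
    refine squeeze_zero' (Eventually.of_forall fun _ => norm_nonneg _) hbound ?_
    have t1 := tendsto_pow_atTop_nhds_zero_of_lt_one hthr0.le hthr
    have t2 := ((((t1.const_mul Cω).mul_const (ω l)).const_mul B).add (hA.const_mul (K ^ d))).const_mul
      (Cg * (1 + M) ^ n)
    simpa using t2
  have h8 : Tendsto (fun k : ℕ => |pe p x₀ - pe (P k) x₀|) atTop (𝓝 |pe p x₀ - f x₀|) :=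
    (tendsto_const_nhds.sub hlim).abs
  have h9 := le_of_tendsto h8 (Eventually.of_forall hsum)
  rw [abs_sub_comm]
  refine h9.trans (le_of_eq ?_)
  ring

end ZT


namespace ZT
open MvPolynomial

/-- interior corkscrew-chain geometry -/
def Geo {d : ℕ} (D : Set (EE d)) (c r0 M : ℝ) : Prop :=
  ∀ x ∈ D, ∀ x0 ∈ D, ∀ t : ℝ, 0 < t → ‖x - x0‖ ≤ t → t ≤ r0 →
    ∃ z : EE d, ‖z - x‖ ≤ M * t ∧ ‖z - x0‖ ≤ M * t ∧ ∀ s : ℝ, 0 < s → s ≤ 1 →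
      cube (x + s • (z - x)) (s * (c * t)) ⊆ D ∧ cube (x0 + s • (z - x0)) (s * (c * t)) ⊆ D

set_option maxHeartbeats 2000000 in
lemma exists_geo {d : ℕ} {D : Set (EE d)} (hD : IsLipschitzDomain D) :
    ∃ c r0 M : ℝ, 0 < c ∧ c ≤ 1 ∧ 0 < r0 ∧ r0 ≤ 1 ∧ 1 ≤ M ∧ Geo D c r0 M := by
  obtain ⟨hop, -, -, δ, R, hδ, hR, hch⟩ := hD
  have hd : (0:ℝ) ≤ d := Nat.cast_nonneg d
  set H : ℝ := 2 * (1 + δ) with hH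
  have hH0 : 0 < H := by positivity
  set c : ℝ := 1 / (d + 1) with hc
  have hc0 : 0 < c := by positivity
  have hdc : d * c ≤ 1 := by
    rw [hc, mul_one_div, div_le_one (by positivity)]; linarith
  refine ⟨c, min 1 (R / (2 * (H + 6))), H + 1, hc0, ?_, by positivity, min_le_left _ _,
    by linarith, ?_⟩
  · rw [hc, div_le_one (by positivity)]; linarith
  intro x hx x0 hx0 t ht hxt ht0
  have ht1 : t ≤ 1 := ht0.trans (min_le_left _ _)
  have ht2 : 2 * (H + 6) * t ≤ R := by
    have := ht0.trans (min_le_right _ _)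
    rw [le_div_iff₀ (by positivity)] at this
    linarith
  by_cases hfr : ∃ a ∈ frontier D, ‖a - x0‖ < 3 * t
  · obtain ⟨a, ha, hax⟩ := hfr
    obtain ⟨g, j, A, hga, hA, hAj, hgD⟩ := hch a ha
    set G := g.toRealAffineIsometryEquiv with hG
    have hGg : ∀ x, G x = g x := fun x => by simp [hG]
    set e : EE d := EuclideanSpace.single j (1:ℝ) with he
    have hen : ‖e‖ = 1 := by simp [he]
    set Z : EE d := g x0 + (H * t) • e with hZ
    have hgn : ∀ u v, ‖g u - g v‖ = ‖u - v‖ := fun u v => by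
      rw [← dist_eq_norm, ← dist_eq_norm, g.isometry.dist_eq]
    have hzx0 : ‖g.symm Z - x0‖ = H * t := by
      rw [← hgn, g.apply_symm_apply, hZ, add_sub_cancel_left, norm_smul, hen, mul_one,
        Real.norm_of_nonneg (by positivity)]
    have key : ∀ x ∈ D, ‖x - x0‖ ≤ t → ∀ s : ℝ, 0 < s → s ≤ 1 →
        cube (x + s • (g.symm Z - x)) (s * (c * t)) ⊆ D := by
      intro x hx hxt s hs hs1 w hw
      have hw1 := norm_sub_le_of_mem_cube (by positivity) hw
      have hlin : g (x + s • (g.symm Z - x)) = g x + s • (Z - g x) := by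
        rw [← hGg, ← hGg x]
        have e1 : x + s • (g.symm Z - x) = AffineMap.lineMap x (g.symm Z) s := by
          rw [AffineMap.lineMap_apply]; simp [add_comm]
        rw [e1]
        have := (G.toAffineEquiv.toAffineMap).apply_lineMap x (g.symm Z) s
        have e2 : G (g.symm Z) = Z := by rw [hGg, g.apply_symm_apply]
        change G (AffineMap.lineMap x (g.symm Z) s) = AffineMap.lineMap (G x) (G (g.symm Z)) s at this
        rw [this, e2, AffineMap.lineMap_apply]
        simp [add_comm]
      set v := g w - (g x + s • (Z - g x)) with hv
      have hvn : ‖v‖ ≤ s * t := by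
        rw [hv, ← hlin, hgn]
        refine hw1.trans ?_
        have : d * (s * (c * t)) = (d * c) * (s * t) := by ring
        rw [this]
        have : 0 ≤ s * t := by positivity
        nlinarith
      have hgw : g w = g x + (s • (g x0 - g x) + v) + (s * (H * t)) • e := by
        rw [hv, hZ]
        simp only [smul_sub, smul_add, smul_smul]
        abel
      have hgx : ‖g x - g x0‖ ≤ t := by rw [hgn]; exact hxt
      have hgx' : ‖g x0 - g x‖ ≤ t := by rw [norm_sub_rev]; exact hgx
      have hgx0 : ‖g x0‖ ≤ 3 * t := by
        have : ‖g x0 - g a‖ = ‖x0 - a‖ := hgn _ _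
        rw [hga, sub_zero, norm_sub_rev] at this
        rw [this]; exact hax.le
      have hgxn : ‖g x‖ ≤ 4 * t := by
        have : g x = (g x - g x0) + g x0 := by abel
        rw [this]
        exact (norm_add_le _ _).trans (by linarith)
      have hsum : ‖s • (g x0 - g x) + v‖ ≤ 2 * (s * t) := by
        refine (norm_add_le _ _).trans ?_
        rw [norm_smul, Real.norm_of_nonneg hs.le]
        nlinarith
      have hst : s * t ≤ t := by nlinarith
      have hcw : g w ∈ cube (0 : EE d) R := by
        apply mem_cube_of_norm
        rw [sub_zero, hgw]
        refine (norm_add_le _ _).trans ?_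
        rw [norm_smul, hen, mul_one, Real.norm_of_nonneg (by positivity)]
        have := norm_add_le (g x) (s • (g x0 - g x) + v)
        have : s * (H * t) ≤ H * t := by
          have : 0 ≤ H * t := by positivity
          nlinarith
        linarith
      have hcx : g x ∈ cube (0 : EE d) R := by
        apply mem_cube_of_norm
        rw [sub_zero]
        nlinarith
      have hAx : A (g x) < g x j := by
        have : g x ∈ (g '' D) ∩ cube 0 R := ⟨mem_image_of_mem _ hx, hcx⟩
        rw [hgD] at this
        exact this.2
      have hAw : A (g w) < g w j := by
        have e1 : A (g w) = A (g x + (s • (g x0 - g x) + v)) := by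
          apply hAj
          intro i hi
          rw [hgw]
          simp [he, hi]
        have e2 : A (g x + (s • (g x0 - g x) + v)) ≤ A (g x) + δ * (2 * (s * t)) := by
          have := hA.dist_le_mul (g x + (s • (g x0 - g x) + v)) (g x)
          rw [dist_eq_norm, dist_eq_norm, add_sub_cancel_left, Real.coe_toNNReal _ hδ.le,
            Real.norm_eq_abs] at this
          have := (le_abs_self _).trans this
          nlinarith
        have e3 : g w j = g x j + (s • (g x0 - g x) + v) j + s * (H * t) := by
          rw [hgw]; simp [he]
        have e4 := abs_coord_le (s • (g x0 - g x) + v) j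
        have e5 := neg_abs_le ((s • (g x0 - g x) + v) j)
        rw [e1, e3]
        have : s * (H * t) = 2 * (s * t) + δ * (2 * (s * t)) := by rw [hH]; ring
        linarith
      have : g w ∈ (g '' D) ∩ cube 0 R := by rw [hgD]; exact ⟨hcw, hAw⟩
      obtain ⟨w', hw', hww⟩ := this.1
      rwa [← g.injective hww]
    refine ⟨g.symm Z, ?_, ?_, fun s hs hs1 => ⟨key x hx hxt s hs hs1, key x0 hx0 (by simpa using ht.le) s hs hs1⟩⟩
    · have : g.symm Z - x = (g.symm Z - x0) - (x - x0) := by abel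
      rw [this]
      refine (norm_sub_le _ _).trans ?_
      rw [hzx0]; linarith
    · rw [hzx0]; linarith
  · push Not at hfr
    have hball : ball x0 (3 * t) ⊆ D := by
      by_contra hnot
      have hpre : IsPreconnected (ball x0 (3 * t)) := (convex_ball x0 (3 * t)).isPreconnected
      obtain ⟨w, hw, hwD⟩ := not_subset.1 hnot
      have hnf : ∀ y ∈ ball x0 (3 * t), y ∉ D → y ∈ (closure D)ᶜ := by
        intro y hy hyD hyc
        have hyf : y ∈ frontier D := by
          rw [hop.frontier_eq]; exact ⟨hyc, hyD⟩
        have := hfr y hyf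
        rw [mem_ball, dist_eq_norm] at hy
        linarith
      obtain ⟨y, -, hy1, hy2⟩ := hpre D (closure D)ᶜ hop isClosed_closure.isOpen_compl
        (fun y hy => by
          by_cases hyD : y ∈ D
          · exact Or.inl hyD
          · exact Or.inr (hnf y hy hyD))
        ⟨x0, mem_ball_self (by positivity), hx0⟩ ⟨w, hw, hnf w hw hwD⟩
      exact hy2 (subset_closure hy1)
    have key : ∀ x, ‖x - x0‖ ≤ t → ∀ s : ℝ, 0 < s → s ≤ 1 →
        cube (x + s • (x0 - x)) (s * (c * t)) ⊆ D := by
      intro x hxt s hs hs1 w hw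
      apply hball
      have hw1 := norm_sub_le_of_mem_cube (by positivity) hw
      rw [mem_ball, dist_eq_norm]
      have : w - x0 = (w - (x + s • (x0 - x))) + (1 - s) • (x - x0) := by
        simp only [smul_sub, sub_smul, one_smul]; abel
      rw [this]
      refine (norm_add_le _ _).trans_lt ?_
      rw [norm_smul, Real.norm_of_nonneg (by linarith)]
      have e1 : d * (s * (c * t)) = (d * c) * (s * t) := by ring
      have e2 : 0 ≤ s * t := by positivity
      have e3 : (1 - s) * ‖x - x0‖ ≤ 1 * t := by gcongr; linarith
      nlinarith
    refine ⟨x0, ?_, ?_, fun s hs hs1 => ⟨key x hxt s hs hs1, key x0 (by simpa using ht.le) s hs hs1⟩⟩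
    · rw [norm_sub_rev]; nlinarith
    · simp; positivity

end ZT


namespace ZT
open MvPolynomial

lemma ae_lebPt_of_integrableOn {d : ℕ} {U : Set (EE d)} (hU : IsOpen U) {f : EE d → ℝ}
    (hf : IntegrableOn f U) : ∀ᵐ x, x ∈ U → LebPt f x := by
  have hF : Integrable (U.indicator f) := (integrable_indicator_iff hU.measurableSet).2 hf
  filter_upwards [(Besicovitch.vitaliFamily (volume : Measure (EE d))).ae_tendsto_average_norm_sub
    hF.locallyIntegrable] with x hx hxU
  have h1 := hx.comp (Besicovitch.tendsto_filterAt (volume : Measure (EE d)) x)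
  have hev : ∀ᶠ R in 𝓝[>] (0:ℝ), closedBall x R ⊆ U := by
    obtain ⟨ε, hε, hb⟩ := Metric.isOpen_iff.1 hU x hxU
    have : Ioo (0:ℝ) ε ∈ 𝓝[>] (0:ℝ) := Ioo_mem_nhdsGT hε
    filter_upwards [this] with R hR
    exact (closedBall_subset_ball hR.2).trans hb
  refine ⟨?_, ?_⟩
  · set v := (volume : Measure (EE d)).real (ball 0 1) with hv
    have h2 := h1.const_mul v
    rw [mul_zero] at h2
    refine h2.congr' ?_
    filter_upwards [hev, self_mem_nhdsWithin] with R hR hR0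
    have hR0 : 0 < R := hR0
    have hvp : 0 < v := by
      rw [hv, measureReal_def]
      exact ENNReal.toReal_pos (measure_ball_pos _ _ one_pos).ne' measure_ball_lt_top.ne
    simp only [Function.comp]
    rw [setAverage_eq, smul_eq_mul]
    have e1 : (volume : Measure (EE d)).real (closedBall x R) = R ^ d * v := by
      rw [hv, measureReal_def, Measure.addHaar_closedBall _ _ hR0.le, ENNReal.toReal_mul,
        ENNReal.toReal_ofReal (by positivity), finrank_euclideanSpace_fin, measureReal_def]
    rw [e1, mul_inv]
    have e2 : ∫ y in closedBall x R, ‖U.indicator f y - U.indicator f x‖ =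
        ∫ y in closedBall x R, |f y - f x| := by
      apply setIntegral_congr_fun measurableSet_closedBall
      intro y hy
      simp [indicator_of_mem (hR hy), indicator_of_mem hxU]
    rw [e2]
    field_simp
  · filter_upwards [hev] with R hR
    exact hf.mono_set hR

lemma ae_lebPt {d : ℕ} {D : Set (EE d)} (hD : IsOpen D) {f : EE d → ℝ}
    (hf : LocallyIntegrableOn f D) : ∀ᵐ x, x ∈ D → LebPt f x := by
  obtain ⟨u, hu, hDu, hi⟩ := hf.exists_nat_integrableOn
  have : ∀ k, ∀ᵐ x, x ∈ u k ∩ D → LebPt f x := fun k =>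
    ae_lebPt_of_integrableOn ((hu k).inter hD) (hi k)
  filter_upwards [ae_all_iff.2 this] with x hx hxD
  obtain ⟨k, hk⟩ := mem_iUnion.1 (hDu hxD)
  exact hx k ⟨hk, hxD⟩

end ZT


namespace ZT
open MvPolynomial

structure Ctx {d : ℕ} (ω : ℝ → ℝ) (n : ℕ) (q r Cω : ℝ) (D : Set (EE d)) (c r0 M Δ : ℝ) : Prop where
  md : MD ω n q r Cω
  op : IsOpen D
  hΔ : 1 ≤ Δ
  dia : ∀ x ∈ D, ∀ y ∈ D, ‖x - y‖ ≤ Δ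
  hc : 0 < c
  hc1 : c ≤ 1
  hr0 : 0 < r0
  hr01 : r0 ≤ 1
  hM : 1 ≤ M
  geo : Geo D c r0 M

structure Fn {d : ℕ} (ω : ℝ → ℝ) (n : ℕ) (D : Set (EE d)) (f : EE d → ℝ) (N : ℝ) : Prop where
  hN : 0 ≤ N
  int : IntegrableOn f D
  l1 : ∫ x in D, |f x| ≤ N
  ap : ∀ x l, 0 < l → cube x l ⊆ D → ∃ p, Ap ω n N f p x l

variable {d n : ℕ} {ω : ℝ → ℝ} {q r Cω c r0 M Δ : ℝ} {D : Set (EE d)}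

/-- the ratio `η = 1/(2 * M / c + 1)` -/
def et (M c : ℝ) : ℝ := 1 / (2 * (M / c) + 1)

lemma et_facts (h : Ctx ω n q r Cω D c r0 M Δ) : 0 < et M c ∧ et M c ≤ 1 ∧
    et M c * (2 * (M / c) + 1) = 1 := by
  have h1 := h.hc
  have h2 := h.hM
  have h3 : 0 < M / c := by positivity
  refine ⟨by unfold et; positivity, ?_, ?_⟩
  · unfold et; rw [div_le_one (by positivity)]; linarith
  · unfold et; field_simp

lemma MD.scale (h : MD ω n q r Cω) {a L : ℝ} (ha : 0 < a) (ha1 : a ≤ 1) (hL : 0 < L) :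
    ω L ≤ Cω * (a⁻¹) ^ q * ω (a * L) := by
  have := h.up a⁻¹ (a * L) ((one_le_inv₀ ha).2 ha1) (by positivity)
  rwa [← mul_assoc, inv_mul_cancel₀ ha.ne', one_mul] at this

lemma avg_pe_le {f : EE d → ℝ} {N : ℝ} (hf : Fn ω n D f N) {p : MvPolynomial (Fin d) ℝ} {z : EE d}
    {l : ℝ} (hl : 0 < l) (hs : cube z l ⊆ D) (hp : Ap ω n N f p z l) :
    (l ^ d)⁻¹ * ∫ y in cube z l, |pe p y| ≤ N * (ω l + (l ^ d)⁻¹) := by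
  have i1 : IntegrableOn (fun y => |f y - pe p y|) (cube z l) :=
    (hp.2.1.sub (integrableOn_pe p z hl.le)).abs
  have i2 : IntegrableOn (fun y => |f y|) D := hf.int.abs
  have i3 := i2.mono_set hs
  have : ∫ y in cube z l, |pe p y| ≤ ∫ y in cube z l, (|f y - pe p y| + |f y|) := by
    apply integral_mono_of_nonneg (Eventually.of_forall fun _ => abs_nonneg _) (i1.add i3)
    refine Eventually.of_forall fun y => ?_
    change |pe p y| ≤ |f y - pe p y| + |f y|
    have := abs_sub_abs_le_abs_sub (pe p y) (f y)
    rw [abs_sub_comm] at this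
    linarith
  rw [integral_add i1 i3] at this
  have h2 : ∫ y in cube z l, |f y| ≤ ∫ y in D, |f y| :=
    setIntegral_mono_set i2 (Eventually.of_forall fun _ => abs_nonneg _) hs.eventuallyLE
  have h3 := hp.2.2
  have h4 := hf.l1
  calc (l ^ d)⁻¹ * ∫ y in cube z l, |pe p y| ≤ (l ^ d)⁻¹ * (N * ω l * l ^ d + N) := by
        gcongr; linarith
    _ = N * (ω l + (l ^ d)⁻¹) := by
        have : l ^ d ≠ 0 := by positivity
        field_simp

lemma cube_one {D : Set (EE d)} {x z : EE d} {l : ℝ} (h : ∀ s : ℝ, 0 < s → s ≤ 1 →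
    cube (x + s • (z - x)) (s * l) ⊆ D) : cube z l ⊆ D := by
  have := h 1 one_pos le_rfl
  simpa using this

/-- pointwise bound of `f` and of the polynomial in the big cube -/
lemma f_bdd (h : Ctx ω n q r Cω D c r0 M Δ) : ∃ C : ℝ, 1 ≤ C ∧ ∀ f N, Fn ω n D f N →
    ∀ x ∈ D, LebPt f x → |f x| ≤ C * N := by
  have hc := h.hc
  have hr0 := h.hr0
  have hM := h.hM
  have hM' : 0 ≤ M / c := by positivity
  obtain ⟨C, hC, hcar⟩ := carrot d n hM' h.md
  obtain ⟨Cg, hCg, hg⟩ := pe_growth d n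
  set l := c * r0 with hl
  have hl0 : 0 < l := by positivity
  have hw := h.md.pos l hl0
  refine ⟨C * ω l + Cg * (1 + M / c) ^ n * (ω l + (l ^ d)⁻¹) + 1, ?_, ?_⟩
  · have : 0 ≤ C * ω l + Cg * (1 + M / c) ^ n * (ω l + (l ^ d)⁻¹) := by positivity
    linarith
  intro f N hf x hx hleb
  obtain ⟨z, hz1, -, hz⟩ := h.geo x hx x hx r0 hr0 (by simpa using hr0.le) le_rfl
  have hz' := fun s hs hs1 => (hz s hs hs1).1
  have hzD := cube_one hz'
  obtain ⟨p, hp⟩ := hf.ap z l hl0 hzD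
  have hzx : ‖z - x‖ ≤ M / c * l := by
    rw [hl]; refine hz1.trans (le_of_eq ?_); field_simp
  have h1 := hcar f N x z l hf.hN hl0 hzx hleb
    (fun t ht ht1 => hf.ap _ _ (by positivity) (hz' t ht ht1)) p hp
  have h2 := hg p hp.1 z l hl0 x
  have h3 := avg_pe_le hf hl0 hzD hp
  have h4 : 1 + ‖x - z‖ / l ≤ 1 + M / c := by
    rw [norm_sub_rev]
    have : ‖z - x‖ / l ≤ M / c := by rwa [div_le_iff₀ hl0]
    linarith
  have h5 : |pe p x| ≤ Cg * (1 + M / c) ^ n * (N * (ω l + (l ^ d)⁻¹)) := by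
    refine h2.trans ?_
    gcongr
  have h6 : |f x| ≤ |f x - pe p x| + |pe p x| := by
    have := abs_sub_abs_le_abs_sub (f x) (pe p x); linarith
  have := hf.hN
  nlinarith

set_option maxHeartbeats 1000000 in
lemma chain_exists (h : Ctx ω n q r Cω D c r0 M Δ) : ∃ C : ℝ, 1 ≤ C ∧ ∀ f N, Fn ω n D f N →
    ∀ (x0 : EE d) (L : ℝ) (p : MvPolynomial (Fin d) ℝ), 0 < L → cube x0 L ⊆ D → 
    Ap ω n N f p x0 L → ∀ x ∈ D, ∀ t, ‖x - x0‖ ≤ t → et M c * L ≤ c * t → t ≤ r0 →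
    ∃ (z : EE d) (m : ℕ) (P : ℕ → MvPolynomial (Fin d) ℝ),
      ‖z - x‖ ≤ M * t ∧ ‖z - x0‖ ≤ M * t ∧ 
      (∀ s : ℝ, 0 < s → s ≤ 1 → cube (x + s • (z - x)) (s * (c * t)) ⊆ D) ∧
      Ap ω n N f (P 0) z (c * t) ∧ (∀ k, (P k).totalDegree ≤ n) ∧
      (∀ k < m, ∀ y, |pe (P k) y - pe (P (k + 1)) y| ≤ 
        C * N * ω (th (M / c) ^ k * (c * t)) * (1 + ‖y - x0‖ / (th (M / c) ^ k * (c * t))) ^ n) ∧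
      (∀ y, |pe (P m) y - pe p y| ≤ C * N * ω L * (1 + ‖y - x0‖ / L) ^ n) ∧
      th (M / c) * (et M c * L) ≤ th (M / c) ^ m * (c * t) ∧
      th (M / c) ^ m * (c * t) ≤ et M c * L := by
  have hc := h.hc
  have hr0 := h.hr0
  have hM := h.hM
  have hM' : 0 ≤ M / c := by positivity
  obtain ⟨C1, hC1, hstep⟩ := chain_step d n hM'
  obtain ⟨C2, hC2, hcomp⟩ := compare d n
  obtain ⟨h1, h2, h3⟩ := th_facts hM'
  obtain ⟨he0, he1, he2⟩ := et_facts h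
  have hth : 0 < th (M / c) := by linarith
  set θ := th (M / c) with hθ
  set η := et M c with hη
  set M' := M / c with hMd
  have hθη : 0 < θ * η := by positivity
  set B : ℝ := (((θ * η)⁻¹) ^ d + 1) with hB
  set C3 : ℝ := C2 * ((1 + M') * (θ * η)⁻¹) ^ n * B with hC3
  refine ⟨max C1 C3, hC1.trans (le_max_left _ _), ?_⟩
  intro f N hf x0 L p hL hLD hp x hx t hxt hLt htr
  have hN := hf.hN
  have hct : 0 < c * t := lt_of_lt_of_le (by positivity) hLt
  have ht : 0 < t := by
    by_contra hcon
    push Not at hcon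
    nlinarith
  have hx0 : x0 ∈ D := hLD (mem_cube_self x0 hL.le)
  obtain ⟨z, hz1, hz2, hz⟩ := h.geo x hx x0 hx0 t ht hxt htr
  have hch : ∀ k : ℕ, ∃ pk, Ap ω n N f pk (x0 + θ ^ k • (z - x0)) (θ ^ k * (c * t)) := fun k =>
    hf.ap _ _ (by positivity) (hz (θ ^ k) (by positivity) (pow_le_one₀ hth.le h2.le)).2
  choose P hP using hch
  obtain ⟨m', hm1, hm2⟩ := exists_nat_pow_near_of_lt_one (x := η * L / (c * t)) (y := θ)
    (by positivity) ((div_le_one hct).2 hLt) hth h2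
  rw [lt_div_iff₀ hct] at hm1
  rw [div_le_iff₀ hct] at hm2
  have hm3 : θ * (η * L) ≤ θ ^ (m' + 1) * (c * t) := by
    rw [pow_succ']; nlinarith
  have hzk : ∀ k : ℕ, ‖θ ^ k • (z - x0)‖ ≤ M' * (θ ^ k * (c * t)) := by
    intro k
    rw [norm_smul, norm_pow, Real.norm_of_nonneg hth.le]
    calc θ ^ k * ‖z - x0‖ ≤ θ ^ k * (M * t) := by gcongr
      _ = _ := by rw [hMd]; field_simp
  refine ⟨z, m' + 1, P, hz1, hz2, fun s hs hs1 => (hz s hs hs1).1, ?_, fun k => (hP k).1, ?_, ?_, 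
    hm3, hm1.le⟩
  · simpa using hP 0
  · intro k _ y
    have hlk : 0 < θ ^ k * (c * t) := by positivity
    have hwk := h.md.pos _ hlk
    have := hstep ω q r Cω h.md f N x0 (x0 + θ ^ k • (z - x0)) (θ ^ k * (c * t)) (P k) (P (k + 1)) hN
      hlk ?_ (hP k) ?_ y
    · refine this.trans ?_
      gcongr
      exact le_max_left _ _
    · rw [add_sub_cancel_left]; exact hzk k
    · have := hP (k + 1)
      convert this using 1
      · rw [add_sub_cancel_left, smul_smul, pow_succ']
      · ring
  · intro y
    set m := m' + 1
    set lm := θ ^ m * (c * t) with hlm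
    have hlm0 : 0 < lm := by positivity
    have hw := h.md.pos L hL
    have hlmL : lm ≤ L := by nlinarith
    have hwm : ω lm ≤ ω L := h.md.mono _ _ hlm0 hlmL
    have hwm0 := h.md.pos _ hlm0
    have hr : L ≤ (θ * η)⁻¹ * lm := by
      rw [inv_mul_eq_div, le_div_iff₀ hθη]; nlinarith
    have := (hcomp f (P m) p (x0 + θ ^ m • (z - x0)) (x0 + θ ^ m • (z - x0)) x0 lm lm L (N * ω L) 
      (N * ω L * ((θ * η)⁻¹) ^ d) hlm0 hlm0 hL (hP m).1 hp.1 (hP m).2.1 hp.2.1 subset_rfl ?_ ?_ ?_).2 y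
    · refine this.trans ?_
      have e1 : ‖y - (x0 + θ ^ m • (z - x0))‖ ≤ ‖y - x0‖ + M' * lm := by
        rw [← sub_sub]
        refine (norm_sub_le _ _).trans ?_
        gcongr
        exact hzk m
      have e2 : 1 + ‖y - (x0 + θ ^ m • (z - x0))‖ / lm ≤ ((1 + M') * (θ * η)⁻¹) * (1 + ‖y - x0‖ / L) := by
        have a1 : ‖y - (x0 + θ ^ m • (z - x0))‖ / lm ≤ ‖y - x0‖ / lm + M' := by
          rw [div_add' _ _ _ hlm0.ne']; gcongr
        have a2 : ‖y - x0‖ / lm ≤ (θ * η)⁻¹ * (‖y - x0‖ / L) := by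
          rw [div_le_iff₀ hlm0]
          have : (θ * η)⁻¹ * (‖y - x0‖ / L) * lm = (‖y - x0‖ / L) * ((θ * η)⁻¹ * lm) := by ring
          rw [this]
          calc ‖y - x0‖ = (‖y - x0‖ / L) * L := by field_simp
            _ ≤ _ := by gcongr
        have a3 : 1 ≤ (θ * η)⁻¹ := (one_le_inv₀ hθη).2 (by nlinarith)
        have a4 : 0 ≤ (θ * η)⁻¹ * (‖y - x0‖ / L) := by positivity
        have a5 : M' * 1 ≤ M' * ((θ * η)⁻¹ + (θ * η)⁻¹ * (‖y - x0‖ / L)) := by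
          apply mul_le_mul_of_nonneg_left _ hM'
          linarith
        have a6 : ((1 + M') * (θ * η)⁻¹) * (1 + ‖y - x0‖ / L) = (θ * η)⁻¹ + (θ * η)⁻¹ * (‖y - x0‖ / L) +
          M' * ((θ * η)⁻¹ + (θ * η)⁻¹ * (‖y - x0‖ / L)) := by ring
        rw [a6]
        linarith
      calc C2 * (1 + ‖y - (x0 + θ ^ m • (z - x0))‖ / lm) ^ n * (N * ω L + N * ω L * ((θ * η)⁻¹) ^ d)
          ≤ C2 * (((1 + M') * (θ * η)⁻¹) * (1 + ‖y - x0‖ / L)) ^ n *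
              (N * ω L + N * ω L * ((θ * η)⁻¹) ^ d) := by gcongr
        _ = C3 * N * ω L * (1 + ‖y - x0‖ / L) ^ n := by rw [hC3, hB, mul_pow _ (1 + ‖y - x0‖ / L)]; ring
        _ ≤ _ := by gcongr; exact le_max_right _ _
    · apply cube_subset_cube
      rw [add_sub_cancel_left]
      have := hzk m
      have e : lm * (2 * M' + 1) ≤ L := by
        calc lm * (2 * M' + 1) ≤ (η * L) * (2 * M' + 1) := by gcongr
          _ = L := by rw [mul_right_comm, he2, one_mul]
      linarith
    · refine (hP m).2.2.trans ?_
      gcongr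
    · refine hp.2.2.trans ?_
      calc N * ω L * L ^ d ≤ N * ω L * ((θ * η)⁻¹ * lm) ^ d := by gcongr
        _ = _ := by rw [mul_pow]; ring

end ZT


namespace ZT
open MvPolynomial
variable {d n : ℕ} {ω : ℝ → ℝ} {q r Cω c r0 M Δ : ℝ} {D : Set (EE d)}

lemma MD.up_base (h : MD ω n q r Cω) {a L l : ℝ} (ha : 0 < a) (ha1 : a ≤ 1) (hL : 0 < L)
    (hl : a * L ≤ l) : ω l ≤ Cω * (l / (a * L)) ^ q * ω L := by
  have haL : 0 < a * L := by positivity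
  have h1 := h.up (l / (a * L)) (a * L) ((one_le_div haL).2 hl) haL
  rw [div_mul_cancel₀ _ haL.ne'] at h1
  have h2 : ω (a * L) ≤ ω L := h.mono _ _ haL (by nlinarith)
  have h3 : 0 ≤ Cω := by linarith [h.hC]
  have h4 : 0 ≤ l / (a * L) := by have := haL.le.trans hl; positivity
  refine h1.trans ?_
  gcongr

lemma geom_sum_le {b : ℝ} (hb : 0 ≤ b) (hb1 : b < 1) (m : ℕ) :
    ∑ k ∈ Finset.range m, b ^ k ≤ (1 - b)⁻¹ := by
  have := Summable.sum_le_tsum (Finset.range m) (fun i _ => pow_nonneg hb i)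
    (summable_geometric_of_lt_one hb hb1)
  rwa [tsum_geometric_of_lt_one hb hb1] at this

lemma pow_rpow_comm {θ s : ℝ} (hθ : 0 ≤ θ) (k : ℕ) : (θ ^ k) ^ s = (θ ^ s) ^ k := by
  rw [← Real.rpow_natCast θ k, ← Real.rpow_natCast (θ ^ s) k, ← Real.rpow_mul hθ,
    ← Real.rpow_mul hθ, mul_comm]

lemma chain_sum (h : Ctx ω n q r Cω D c r0 M Δ) {C : ℝ} (hC : 1 ≤ C) : ∃ C' : ℝ, 1 ≤ C' ∧
    ∀ (N L t : ℝ) (x0 x : EE d) (m : ℕ) (P : ℕ → MvPolynomial (Fin d) ℝ)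
      (p : MvPolynomial (Fin d) ℝ), 0 ≤ N → 0 < L → 0 < t → 
      th (M / c) * (et M c * L) ≤ th (M / c) ^ m * (c * t) →
      (∀ k < m, ∀ y, |pe (P k) y - pe (P (k + 1)) y| ≤ 
        C * N * ω (th (M / c) ^ k * (c * t)) * (1 + ‖y - x0‖ / (th (M / c) ^ k * (c * t))) ^ n) →
      (∀ y, |pe (P m) y - pe p y| ≤ C * N * ω L * (1 + ‖y - x0‖ / L) ^ n) →
      ‖x - x0‖ ≤ Δ / r0 * t → c * t ≤ (1 + ‖x - x0‖ / L) * L →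
      |pe (P 0) x - pe p x| ≤ C' * N * ω L * (1 + ‖x - x0‖ / L) ^ q := by
  have hc := h.hc
  have hr0 := h.hr0
  have hM := h.hM
  have hΔ := h.hΔ
  have hM' : 0 ≤ M / c := by positivity
  obtain ⟨h1, h2, h3⟩ := th_facts hM'
  obtain ⟨he0, he1, he2⟩ := et_facts h
  have hth : 0 < th (M / c) := by linarith
  set θ := th (M / c) with hθ
  set η := et M c with hη
  have hθη : 0 < θ * η := by positivity
  have hθη1 : θ * η ≤ 1 := by nlinarith
  have hCω : 0 ≤ Cω := by linarith [h.md.hC]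
  have hb : θ ^ (q - n) < 1 := Real.rpow_lt_one hth.le h2 (by linarith [h.md.hq])
  have hb0 : 0 < θ ^ (q - n) := Real.rpow_pos_of_pos hth _
  set E := Cω * ((θ * η)⁻¹) ^ q * (((1 + Δ / r0) * c⁻¹) ^ n) with hE
  have hE0 : 0 ≤ E := by positivity
  refine ⟨C * E * (1 - θ ^ (q - n))⁻¹ + C, ?_, ?_⟩
  · have : 0 ≤ C * E * (1 - θ ^ (q - n))⁻¹ := by
      have : 0 ≤ (1 - θ ^ (q - n))⁻¹ := inv_nonneg.2 (by linarith)
      positivity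
    linarith
  intro N L t x0 x m P p hN hL ht hm hk hPm hxt htL
  have hw := h.md.pos L hL
  set X := 1 + ‖x - x0‖ / L with hX
  have hX1 : 1 ≤ X := by
    have : 0 ≤ ‖x - x0‖ / L := by positivity
    rw [hX]; linarith
  have hX0 : 0 < X := by linarith
  have hterm : ∀ k < m, |pe (P k) x - pe (P (k + 1)) x| ≤ C * N * ω L * X ^ q * E * (θ ^ (q - n)) ^ k := by
    intro k hkm
    refine (hk k hkm x).trans ?_
    have hθk : 0 < θ ^ k := by positivity
    have hθk1 : θ ^ k ≤ 1 := pow_le_one₀ hth.le h2.le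
    set lk := θ ^ k * (c * t) with hlk
    have hlk0 : 0 < lk := by positivity
    have hle : θ * η * L ≤ lk := by
      rw [mul_assoc]
      refine hm.trans ?_
      rw [hlk]
      exact mul_le_mul_of_nonneg_right (pow_le_pow_of_le_one hth.le h2.le hkm.le) (by positivity)
    have a1 := h.md.up_base hθη hθη1 hL hle
    have a2 : lk / (θ * η * L) ≤ (θ ^ k) * (θ * η)⁻¹ * X := by
      rw [div_le_iff₀ (by positivity)]
      have : θ ^ k * (θ * η)⁻¹ * X * (θ * η * L) = θ ^ k * (X * L) := by field_simp
      rw [this, hlk]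
      gcongr
    have a3 : (lk / (θ * η * L)) ^ q ≤ (θ ^ k) ^ q * ((θ * η)⁻¹) ^ q * X ^ q := by
      rw [← Real.mul_rpow (by positivity) (by positivity), ← Real.mul_rpow (by positivity) (by positivity)]
      exact Real.rpow_le_rpow (by positivity) a2 h.md.q_pos.le
    have a4 : 1 + ‖x - x0‖ / lk ≤ ((1 + Δ / r0) * c⁻¹) * (θ ^ k)⁻¹ := by
      have : ((1 + Δ / r0) * c⁻¹) * (θ ^ k)⁻¹ = (t + Δ / r0 * t) / lk := by
        rw [hlk]; field_simp
      rw [this, le_div_iff₀ hlk0, add_mul, one_mul, div_mul_cancel₀ _ hlk0.ne']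
      have : lk ≤ t := by
        rw [hlk]
        have := h.hc1
        calc θ ^ k * (c * t) ≤ 1 * (1 * t) := by gcongr
          _ = t := by ring
      linarith
    have a5 : (θ ^ k) ^ q * ((θ ^ k)⁻¹) ^ n = (θ ^ (q - n)) ^ k := by
      rw [← pow_rpow_comm hth.le, Real.rpow_sub hθk, Real.rpow_natCast, inv_pow]
      rfl
    have hwk := h.md.pos lk hlk0
    calc C * N * ω lk * (1 + ‖x - x0‖ / lk) ^ n 
        ≤ C * N * (Cω * ((θ ^ k) ^ q * ((θ * η)⁻¹) ^ q * X ^ q) * ω L) * 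
          (((1 + Δ / r0) * c⁻¹) * (θ ^ k)⁻¹) ^ n := by
          gcongr
          exact a1.trans (by gcongr)
      _ = C * N * ω L * X ^ q * E * ((θ ^ k) ^ q * ((θ ^ k)⁻¹) ^ n) := by
          rw [mul_pow _ ((θ ^ k)⁻¹), hE]; ring
      _ = _ := by rw [a5]
  have e : pe (P 0) x - pe (P m) x = ∑ i ∈ Finset.range m, (pe (P i) x - pe (P (i + 1)) x) := by
    rw [Finset.sum_range_sub']
  have hs : |pe (P 0) x - pe (P m) x| ≤ C * N * ω L * X ^ q * E * (1 - θ ^ (q - n))⁻¹ := by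
    rw [e]
    refine (Finset.abs_sum_le_sum_abs _ _).trans ?_
    refine (Finset.sum_le_sum fun i hi => hterm i (Finset.mem_range.1 hi)).trans ?_
    rw [← Finset.mul_sum]
    gcongr
    exact geom_sum_le hb0.le hb m
  have hl : |pe (P m) x - pe p x| ≤ C * N * ω L * X ^ q := by
    refine (hPm x).trans ?_
    gcongr
    rw [← Real.rpow_natCast]
    exact Real.rpow_le_rpow_of_exponent_le hX1 h.md.hq.le
  have e2 : pe (P 0) x - pe p x = (pe (P 0) x - pe (P m) x) + (pe (P m) x - pe p x) := by ring
  rw [e2]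
  refine (abs_add_le _ _).trans ?_
  calc _ ≤ C * N * ω L * X ^ q * E * (1 - θ ^ (q - n))⁻¹ + C * N * ω L * X ^ q := add_le_add hs hl
    _ = _ := by ring

set_option maxHeartbeats 1000000 in
/-- growth (a) -/
lemma growth_a (h : Ctx ω n q r Cω D c r0 M Δ) : ∃ C : ℝ, 1 ≤ C ∧ ∀ f N, Fn ω n D f N →
    ∀ (x0 : EE d) (L : ℝ) (p : MvPolynomial (Fin d) ℝ), 0 < L → L ≤ c * r0 → cube x0 L ⊆ D → 
    Ap ω n N f p x0 L → ∀ x ∈ D, LebPt f x → 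
    |f x - pe p x| ≤ C * N * ω L * (1 + ‖x - x0‖ / L) ^ q := by
  have hc := h.hc
  have hc1 := h.hc1
  have hr0 := h.hr0
  have hr01 := h.hr01
  have hM := h.hM
  have hΔ := h.hΔ
  have hM' : 0 ≤ M / c := by positivity
  have hCω : 0 ≤ Cω := by linarith [h.md.hC]
  have hq0 := h.md.q_pos
  obtain ⟨h1, h2, h3⟩ := th_facts hM'
  have hth : 0 < th (M / c) := by linarith
  obtain ⟨he0, he1, he2⟩ := et_facts h
  obtain ⟨C1, hC1, hchain⟩ := chain_exists h
  obtain ⟨C2, hC2, hsum⟩ := chain_sum h hC1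
  obtain ⟨C3, hC3, hcar⟩ := carrot d n hM' h.md
  obtain ⟨C4, hC4, hfb⟩ := f_bdd h
  obtain ⟨C5, hC5, hgr⟩ := pe_growth d n
  set l0 := c * r0 with hl0
  have hl0p : 0 < l0 := by positivity
  have hw0 := h.md.pos l0 hl0p
  set a := et M c
  set G := C4 + C5 * (1 + (Δ + M * r0) / l0) ^ n * (ω l0 + (l0 ^ d)⁻¹) with hG
  have hG0 : 0 ≤ G := by positivity
  set K1 := C3 * (Cω * (a⁻¹) ^ q) with hK1
  set K2 := G * (Cω * (ω l0)⁻¹) with hK2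
  have hK10 : 0 ≤ K1 := by positivity
  have hK20 : 0 ≤ K2 := by positivity
  refine ⟨K1 + K2 + C2, by linarith, ?_⟩
  intro f N hf x0 L p hL hLl hLD hp x hx hleb
  have hN := hf.hN
  have hw := h.md.pos L hL
  have hx0 : x0 ∈ D := hLD (mem_cube_self x0 hL.le)
  have hLX : (1 + ‖x - x0‖ / L) * L = L + ‖x - x0‖ := by field_simp
  set X := 1 + ‖x - x0‖ / L with hX
  have hX1 : 1 ≤ X := by
    have : 0 ≤ ‖x - x0‖ / L := by positivity
    rw [hX]; linarith
  have hX0 : 0 < X := by linarith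
  have haL : a * L ≤ L := by nlinarith
  have hF : 0 ≤ N * ω L * X ^ q := by positivity
  by_cases hnear : ‖x - x0‖ ≤ r0
  · set t := max ‖x - x0‖ (a * L / c) with ht
    have hat : a * L ≤ c * t := by
      have : a * L / c ≤ t := le_max_right _ _
      rw [div_le_iff₀ hc] at this
      linarith
    have ht0 : 0 < t := lt_of_lt_of_le (by positivity) (le_max_right _ _)
    have htr : t ≤ r0 := by
      apply max_le hnear
      rw [div_le_iff₀ hc]
      rw [hl0] at hLl
      linarith
    have hct : c * t ≤ X * L := by
      rw [hLX, ht, mul_max_of_nonneg _ _ hc.le]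
      apply max_le
      · have : c * ‖x - x0‖ ≤ 1 * ‖x - x0‖ := by gcongr
        linarith
      · rw [mul_div_cancel₀ _ hc.ne']
        have := norm_nonneg (x - x0)
        linarith
    obtain ⟨z, m, P, hz1, hz2, hzc, hP0, hPd, hk, hPm, hm1, hm2⟩ := hchain f N hf x0 L p hL hLD hp x hx t
      (le_max_left _ _) hat htr
    have s1 := hsum N L t x0 x m P p hN hL ht0 hm1 hk hPm (by
      have : 1 ≤ Δ / r0 := by rw [one_le_div hr0]; linarith
      have := le_max_left ‖x - x0‖ (a * L / c)
      rw [← ht] at this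
      nlinarith) hct
    have hct0 : 0 < c * t := by positivity
    have s2 := hcar f N x z (c * t) hN hct0 (hz1.trans (le_of_eq (by field_simp))) hleb
      (fun s hs hs1 => hf.ap _ _ (by positivity) (hzc s hs hs1)) (P 0) hP0
    have s3 : ω (c * t) ≤ Cω * (a⁻¹) ^ q * X ^ q * ω L := by
      refine (h.md.up_base he0 he1 hL hat).trans ?_
      have : c * t / (a * L) ≤ a⁻¹ * X := by
        rw [div_le_iff₀ (by positivity)]
        have : a⁻¹ * X * (a * L) = X * L := by field_simp
        rw [this]; exact hct
      have h5 : (c * t / (a * L)) ^ q ≤ (a⁻¹) ^ q * X ^ q := by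
        rw [← Real.mul_rpow (by positivity) (by positivity)]
        exact Real.rpow_le_rpow (by positivity) this hq0.le
      calc Cω * (c * t / (a * L)) ^ q * ω L ≤ Cω * ((a⁻¹) ^ q * X ^ q) * ω L := by gcongr
        _ = _ := by ring
    have s4 : |f x - pe (P 0) x| ≤ K1 * (N * ω L * X ^ q) := by
      refine s2.trans ?_
      calc C3 * N * ω (c * t) ≤ C3 * N * (Cω * (a⁻¹) ^ q * X ^ q * ω L) := by gcongr
        _ = _ := by rw [hK1]; ring
    have e : f x - pe p x = (f x - pe (P 0) x) + (pe (P 0) x - pe p x) := by ring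
    rw [e]
    refine (abs_add_le _ _).trans ?_
    calc _ ≤ K1 * (N * ω L * X ^ q) + C2 * N * ω L * X ^ q := add_le_add s4 s1
      _ = (K1 + 0 + C2) * N * ω L * X ^ q := by ring
      _ ≤ _ := by gcongr
  · push Not at hnear
    have hxx := h.dia x hx x0 hx0
    obtain ⟨z, m, P, hz1, hz2, hzc, hP0, hPd, hk, hPm, hm1, hm2⟩ := hchain f N hf x0 L p hL hLD hp x0 hx0 r0
      (by simpa using hr0.le) (haL.trans hLl) le_rfl
    have s1 := hsum N L r0 x0 x m P p hN hL hr0 hm1 hk hPm (by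
      rw [div_mul_cancel₀ _ hr0.ne']; exact hxx) (by
      rw [hLX]; nlinarith)
    have s2 := hfb f N hf x hx hleb
    have s3 := hgr (P 0) (hPd 0) z l0 hl0p x
    have s4 := avg_pe_le hf hl0p (cube_one hzc) hP0
    have s5 : |pe (P 0) x| ≤ C5 * (1 + (Δ + M * r0) / l0) ^ n * (N * (ω l0 + (l0 ^ d)⁻¹)) := by
      refine s3.trans ?_
      have : ‖x - z‖ ≤ Δ + M * r0 := by
        have : x - z = (x - x0) - (z - x0) := by abel
        rw [this]
        exact (norm_sub_le _ _).trans (add_le_add hxx hz2)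
      gcongr
    have s6 : 1 ≤ (Cω * (ω l0)⁻¹) * (ω L * X ^ q) := by
      have := h.md.up_base one_pos le_rfl hL (by linarith : 1 * L ≤ l0)
      rw [one_mul] at this
      have h5 : (l0 / L) ^ q ≤ X ^ q := by
        apply Real.rpow_le_rpow (by positivity) _ hq0.le
        rw [div_le_iff₀ hL, hLX, hl0]
        nlinarith
      have h6 : ω l0 ≤ Cω * X ^ q * ω L := this.trans (by gcongr)
      calc 1 = (ω l0)⁻¹ * ω l0 := by field_simp
        _ ≤ (ω l0)⁻¹ * (Cω * X ^ q * ω L) := by gcongr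
        _ = _ := by ring
    have s7 : |f x| + |pe (P 0) x| ≤ K2 * (N * ω L * X ^ q) := by
      calc _ ≤ C4 * N + C5 * (1 + (Δ + M * r0) / l0) ^ n * (N * (ω l0 + (l0 ^ d)⁻¹)) := add_le_add s2 s5
        _ = G * N * 1 := by rw [hG]; ring
        _ ≤ G * N * ((Cω * (ω l0)⁻¹) * (ω L * X ^ q)) := by gcongr
        _ = _ := by rw [hK2]; ring
    have e : f x - pe p x = (f x - pe (P 0) x) + (pe (P 0) x - pe p x) := by ring
    rw [e]
    refine (abs_add_le _ _).trans ?_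
    have s8 : |f x - pe (P 0) x| ≤ K2 * (N * ω L * X ^ q) := by
      refine le_trans ?_ s7
      rw [sub_eq_add_neg]
      refine (abs_add_le _ _).trans ?_
      rw [abs_neg]
    calc _ ≤ K2 * (N * ω L * X ^ q) + C2 * N * ω L * X ^ q := add_le_add s8 s1
      _ = (0 + K2 + C2) * N * ω L * X ^ q := by ring
      _ ≤ _ := by gcongr

end ZT


namespace ZT
open MvPolynomial
variable {d n : ℕ} {ω : ℝ → ℝ} {q r Cω c r0 M Δ : ℝ} {D : Set (EE d)}

lemma top_sub (n : ℕ) (x₀ : EE d) (p q : MvPolynomial (Fin d) ℝ) :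
    top n x₀ (p - q) = top n x₀ p - top n x₀ q := by simp [top]

lemma low_sub (n : ℕ) (x₀ : EE d) (p q : MvPolynomial (Fin d) ℝ) :
    low n x₀ (p - q) = low n x₀ p - low n x₀ q := by
  simp only [low, top_sub, map_sub]; abel

lemma top_low_of_growth (d n : ℕ) (hn : 0 < n) {Δ : ℝ} (hΔ : 1 ≤ Δ) : ∃ C : ℝ, 0 < C ∧
    ∀ p : MvPolynomial (Fin d) ℝ, p.totalDegree ≤ n → ∀ (x₀ : EE d) (l a : ℝ), 0 < l → l ≤ 1 →
    (∀ y, |pe p y| ≤ a * (1 + ‖y - x₀‖ / l) ^ n) → ∀ x, ‖x - x₀‖ ≤ Δ →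
      |pe (top n x₀ p) (x - x₀)| ≤ C * ((l ^ n)⁻¹ * a) ∧
      |pe (low n x₀ p) x| ≤ C * ((l ^ (n - 1))⁻¹ * a) := by
  obtain ⟨C, hC, h⟩ := top_low_bound d n hn
  refine ⟨C * (1 + Δ) ^ n * (1 + d) ^ n, by positivity, fun p hp x₀ l a hl hl1 hy x hx => ?_⟩
  have ha : 0 ≤ a := by
    have := hy x₀
    simp at this
    exact (abs_nonneg _).trans this
  have havg : (l ^ d)⁻¹ * ∫ x in cube x₀ l, |pe p x| ≤ a * (1 + d) ^ n := by
    rw [inv_mul_le_iff₀ (by positivity)]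
    have h1 : ∫ x in cube x₀ l, |pe p x| ≤ ∫ x in cube x₀ l, a * (1 + d) ^ n := by
      apply setIntegral_mono_on (integrableOn_pe p x₀ hl.le).abs
        (integrableOn_const (isCompact_cube _ _ hl.le).measure_lt_top.ne) (measurableSet_cube _ _)
      intro y hyc
      refine (hy y).trans ?_
      have : ‖y - x₀‖ / l ≤ d := by
        rw [div_le_iff₀ hl]; exact norm_sub_le_of_mem_cube hl.le hyc
      gcongr
    rw [setIntegral_const, volume_real_cube _ hl.le, smul_eq_mul] at h1
    exact h1
  obtain ⟨h1, h2⟩ := h p hp x₀ l hl hl1 x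
  have h0 : 0 ≤ (l ^ d)⁻¹ * ∫ x in cube x₀ l, |pe p x| :=
    mul_nonneg (by positivity) (integral_nonneg fun _ => abs_nonneg _)
  constructor
  · refine h1.trans ?_
    calc _ ≤ C * (1 + Δ) ^ n * (l ^ n)⁻¹ * (a * (1 + d) ^ n) := by gcongr
      _ = _ := by ring
  · refine h2.trans ?_
    calc _ ≤ C * (1 + Δ) ^ n * (l ^ (n - 1))⁻¹ * (a * (1 + d) ^ n) := by gcongr
      _ = _ := by ring

lemma xi_int (h : MD ω n q r Cω) {ρ b : ℝ} (hρ : 0 < ρ) :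
    IntegrableOn (fun t => ω t / t ^ (n + 1)) (Ioc ρ b) := by
  apply IntegrableOn.mono_set _ Ioc_subset_Icc_self
  apply ContinuousOn.integrableOn_compact isCompact_Icc
  apply ContinuousOn.div
  · exact h.cont.mono fun t ht => mem_Ici.2 (hρ.le.trans ht.1)
  · fun_prop
  · intro t ht
    have : 0 < t := hρ.trans_le ht.1
    positivity

lemma xi_nonneg_on (h : MD ω n q r Cω) {ρ b : ℝ} (hρ : 0 < ρ) :
    0 ≤ᵐ[volume.restrict (Ioc ρ b)] (fun t => ω t / t ^ (n + 1)) := by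
  filter_upwards [ae_restrict_mem measurableSet_Ioc] with t ht
  have h0 : 0 < t := hρ.trans ht.1
  have := h.pos t h0
  change 0 ≤ ω t / t ^ (n + 1)
  positivity

lemma xi_lower (h : MD ω n q r Cω) {θ l : ℝ} (hθ : 0 < θ) (hθ1 : θ < 1) (hl : 0 < l) :
    ω l * (l ^ n)⁻¹ ≤ Cω * (θ⁻¹) ^ q * (1 - θ)⁻¹ * ∫ t in Ioc (θ * l) l, ω t / t ^ (n + 1) := by
  have h1 := h.scale hθ hθ1.le hl
  have hθl : 0 < θ * l := by positivity
  have hw := h.pos _ hθl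
  have hCω : 0 ≤ Cω := by linarith [h.hC]
  have h2 : ω (θ * l) * (l ^ n)⁻¹ * (1 - θ) ≤ ∫ t in Ioc (θ * l) l, ω t / t ^ (n + 1) := by
    have : ∫ t in Ioc (θ * l) l, ω (θ * l) / l ^ (n + 1) ≤ ∫ t in Ioc (θ * l) l, ω t / t ^ (n + 1) := by
      apply setIntegral_mono_on (integrableOn_const measure_Ioc_lt_top.ne) (xi_int h hθl) measurableSet_Ioc
      intro t ht
      have ht0 : 0 < t := hθl.trans ht.1
      have := h.mono _ _ hθl ht.1.le
      have h3 := ht.2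
      have hwt := (h.pos t ht0).le
      gcongr
    rw [setIntegral_const, smul_eq_mul, Real.volume_real_Ioc_of_le (by nlinarith)] at this
    refine le_trans (le_of_eq ?_) this
    rw [pow_succ]
    field_simp
  have hθ2 : 0 < 1 - θ := by linarith
  calc ω l * (l ^ n)⁻¹ ≤ (Cω * (θ⁻¹) ^ q * ω (θ * l)) * (l ^ n)⁻¹ := by gcongr
    _ = Cω * (θ⁻¹) ^ q * (1 - θ)⁻¹ * (ω (θ * l) * (l ^ n)⁻¹ * (1 - θ)) := by field_simp
    _ ≤ _ := by gcongr

lemma xi_sum (h : MD ω n q r Cω) {θ l : ℝ} (hθ : 0 < θ) (hθ1 : θ < 1) (hl : 0 < l) (m : ℕ) :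
    ∑ k ∈ Finset.range m, ω (θ ^ k * l) * ((θ ^ k * l) ^ n)⁻¹ ≤ 
      Cω * (θ⁻¹) ^ q * (1 - θ)⁻¹ * ∫ t in Ioc (θ ^ m * l) l, ω t / t ^ (n + 1) := by
  induction m with
  | zero => simp
  | succ m ih =>
    rw [Finset.sum_range_succ]
    have h1 := xi_lower h hθ hθ1 (by positivity : 0 < θ ^ m * l)
    have e : θ * (θ ^ m * l) = θ ^ (m + 1) * l := by rw [pow_succ']; ring
    rw [e] at h1
    have hm1 : θ ^ m * l ≤ l := by
      have := pow_le_one₀ (n := m) hθ.le hθ1.le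
      nlinarith
    have hm2 : θ ^ (m + 1) * l ≤ θ ^ m * l := by
      rw [← e]
      have : 0 < θ ^ m * l := by positivity
      nlinarith
    have h2 : ∫ t in Ioc (θ ^ (m + 1) * l) l, ω t / t ^ (n + 1) = 
        (∫ t in Ioc (θ ^ (m + 1) * l) (θ ^ m * l), ω t / t ^ (n + 1)) + 
        ∫ t in Ioc (θ ^ m * l) l, ω t / t ^ (n + 1) := by
      rw [← setIntegral_union _ measurableSet_Ioc (xi_int h (by positivity)) (xi_int h (by positivity)),
        Ioc_union_Ioc_eq_Ioc hm2 hm1]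
      exact Ioc_disjoint_Ioc_of_le le_rfl
    rw [h2, mul_add]
    linarith

lemma xi_sum_le (h : MD ω n q r Cω) {θ l ρ : ℝ} (hθ : 0 < θ) (hθ1 : θ < 1) (hl : 0 < l) (hl1 : l ≤ 1)
    (m : ℕ) (hρ : 0 < ρ) (hρm : ρ ≤ θ ^ m * l) :
    ∑ k ∈ Finset.range m, ω (θ ^ k * l) * ((θ ^ k * l) ^ n)⁻¹ ≤ 
      Cω * (θ⁻¹) ^ q * (1 - θ)⁻¹ * xi ω n ρ := by
  refine (xi_sum h hθ hθ1 hl m).trans ?_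
  have hCω : 0 ≤ Cω := by linarith [h.hC]
  have hθ2 : 0 < 1 - θ := by linarith
  apply mul_le_mul_of_nonneg_left _ (by positivity)
  apply setIntegral_mono_set (xi_int h hρ) (xi_nonneg_on h hρ)
  exact (Ioc_subset_Ioc hρm hl1).eventuallyLE

lemma low_sum_le (h : MD ω n q r Cω) {θ l : ℝ} (hθ : 0 < θ) (hθ1 : θ < 1) (hl : 0 < l) (m : ℕ) :
    ∑ k ∈ Finset.range m, ω (θ ^ k * l) * ((θ ^ k * l) ^ (n - 1))⁻¹ ≤ 
      Cω * ω l * (l ^ (n - 1))⁻¹ * (1 - θ ^ (r - (n - 1 : ℝ)))⁻¹ := by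
  have hCω : 0 ≤ Cω := by linarith [h.hC]
  have hw := h.pos l hl
  have hb : θ ^ (r - (n - 1 : ℝ)) < 1 := Real.rpow_lt_one hθ.le hθ1 (by linarith [h.hr])
  have hb0 : 0 < θ ^ (r - (n - 1 : ℝ)) := Real.rpow_pos_of_pos hθ _
  calc ∑ k ∈ Finset.range m, ω (θ ^ k * l) * ((θ ^ k * l) ^ (n - 1))⁻¹ 
      ≤ ∑ k ∈ Finset.range m, Cω * ω l * (l ^ (n - 1))⁻¹ * (θ ^ (r - (n - 1 : ℝ))) ^ k := by
        apply Finset.sum_le_sum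
        intro k _
        have hθk : 0 < θ ^ k := by positivity
        have h1 := h.down (θ ^ k) l hθk (pow_le_one₀ hθ.le hθ1.le) hl
        have h2 : (θ ^ k) ^ r * ((θ ^ k) ^ (n - 1))⁻¹ = (θ ^ (r - (n - 1 : ℝ))) ^ k := by
          rw [← pow_rpow_comm hθ.le, Real.rpow_sub hθk]
          have : ((n : ℝ) - 1) = ((n - 1 : ℕ) : ℝ) := by
            rw [Nat.cast_sub h.n_pos]; simp
          rw [this, Real.rpow_natCast]; rfl
        calc ω (θ ^ k * l) * ((θ ^ k * l) ^ (n - 1))⁻¹ 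
            ≤ (Cω * (θ ^ k) ^ r * ω l) * ((θ ^ k * l) ^ (n - 1))⁻¹ := by gcongr
          _ = Cω * ω l * (l ^ (n - 1))⁻¹ * ((θ ^ k) ^ r * ((θ ^ k) ^ (n - 1))⁻¹) := by
              rw [mul_pow, mul_inv]; ring
          _ = _ := by rw [h2]
    _ ≤ _ := by
        rw [← Finset.mul_sum]
        gcongr
        exact geom_sum_le hb0.le hb m

lemma tele_abs (φ : MvPolynomial (Fin d) ℝ → ℝ) (hφ : ∀ a b, φ (a - b) = φ a - φ b)
    (P : ℕ → MvPolynomial (Fin d) ℝ) (p : MvPolynomial (Fin d) ℝ) (m : ℕ) :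
    |φ p| ≤ |φ (P 0)| + ∑ k ∈ Finset.range m, |φ (P k - P (k + 1))| + |φ (P m - p)| := by
  have e : ∑ k ∈ Finset.range m, φ (P k - P (k + 1)) = φ (P 0) - φ (P m) := by
    simp only [hφ]
    rw [Finset.sum_range_sub']
  have e2 : φ p = φ (P 0) - (∑ k ∈ Finset.range m, φ (P k - P (k + 1))) - φ (P m - p) := by
    rw [e, hφ]; ring
  rw [e2]
  have h1 := Finset.abs_sum_le_sum_abs (fun k => φ (P k - P (k + 1))) (Finset.range m)
  have h2 := abs_sub (φ (P 0) - (∑ k ∈ Finset.range m, φ (P k - P (k + 1)))) (φ (P m - p))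
  have h3 := abs_sub (φ (P 0)) (∑ k ∈ Finset.range m, φ (P k - P (k + 1)))
  linarith

set_option maxHeartbeats 2000000 in
/-- growth (b), (c) -/
lemma growth_bc (h : Ctx ω n q r Cω D c r0 M Δ) : ∃ C κ : ℝ, 1 ≤ C ∧ 0 < κ ∧ ∀ f N, Fn ω n D f N →
    ∀ (x0 : EE d) (L ρ : ℝ) (p : MvPolynomial (Fin d) ℝ), 0 < L → L ≤ c * r0 → cube x0 L ⊆ D → 
    Ap ω n N f p x0 L → 0 < ρ → ρ ≤ κ * L → ∀ x ∈ D, 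
    |pe (top n x0 p) (x - x0)| ≤ C * N * max 1 (xi ω n ρ) ∧ |pe (low n x0 p) x| ≤ C * N := by
  have hc := h.hc
  have hc1 := h.hc1
  have hr0 := h.hr0
  have hr01 := h.hr01
  have hM := h.hM
  have hΔ := h.hΔ
  have hM' : 0 ≤ M / c := by positivity
  have hCω : 0 ≤ Cω := by linarith [h.md.hC]
  have hq0 := h.md.q_pos
  obtain ⟨h1, h2, h3⟩ := th_facts hM'
  have hth : 0 < th (M / c) := by linarith
  obtain ⟨he0, he1, he2⟩ := et_facts h
  obtain ⟨C1, hC1, hchain⟩ := chain_exists h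
  obtain ⟨C5, hC5, hgr⟩ := pe_growth d n
  obtain ⟨C6, hC6, htl⟩ := top_low_of_growth d n h.md.n_pos hΔ
  set l0 := c * r0 with hl0
  have hl0p : 0 < l0 := by positivity
  have hl01 : l0 ≤ 1 := by rw [hl0]; nlinarith
  have hw0 := h.md.pos l0 hl0p
  set θ := th (M / c)
  set η := et M c
  have hθη : 0 < θ * η := by positivity
  have hθη1 : θ * η ≤ 1 := by nlinarith
  set a0 := C5 * (1 + M / c) ^ n * (ω l0 + (l0 ^ d)⁻¹) with ha0
  set Kx := Cω * (θ⁻¹) ^ q * (1 - θ)⁻¹ with hKx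
  have hθ2 : 0 < 1 - θ := by linarith
  set Ke := Cω * ((θ * η)⁻¹) ^ q with hKe
  set T := C6 * ((l0 ^ n)⁻¹ * a0) + C6 * C1 * Kx + C6 * C1 * Ke * Kx with hT
  have hbb : θ ^ (r - (n - 1 : ℝ)) < 1 := Real.rpow_lt_one hth.le h2 (by linarith [h.md.hr])
  have hb2 : 0 < 1 - θ ^ (r - (n - 1 : ℝ)) := by linarith
  set Sl := C6 * ((l0 ^ (n - 1))⁻¹ * a0) + 
    C6 * C1 * (Cω * ω l0 * (l0 ^ (n - 1))⁻¹ * (1 - θ ^ (r - (n - 1 : ℝ)))⁻¹) +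
    C6 * C1 * (Cω * ω l0 * (l0 ^ (n - 1))⁻¹) with hSl
  have hT0 : 0 ≤ T := by positivity
  have hSl0 : 0 ≤ Sl := by positivity
  refine ⟨T + Sl + 1, θ * (θ * η), by linarith, by positivity, ?_⟩
  intro f N hf x0 L ρ p hL hLl hLD hp hρ hρL x hx
  have hN := hf.hN
  have hw := h.md.pos L hL
  have hx0 : x0 ∈ D := hLD (mem_cube_self x0 hL.le)
  have haL : η * L ≤ L := by nlinarith
  have hxx := h.dia x hx x0 hx0
  obtain ⟨z, m, P, hz1, hz2, hzc, hP0, hPd, hk, hPm, hm1, hm2⟩ := hchain f N hf x0 L p hL hLD hp x0 hx0 r0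
      (by simpa using hr0.le) (haL.trans hLl) le_rfl
  rw [← hl0] at hP0 hm1 hm2
  have hL1 : L ≤ 1 := hLl.trans hl01
  set lm := θ ^ m * l0 with hlm
  have hlm0 : 0 < lm := by positivity
  have B0 : ∀ y, |pe (P 0) y| ≤ (a0 * N) * (1 + ‖y - x0‖ / l0) ^ n := by
    intro y
    refine (hgr (P 0) (hPd 0) z l0 hl0p y).trans ?_
    have s4 := avg_pe_le hf hl0p (cube_one hzc) hP0
    have e1 : 1 + ‖y - z‖ / l0 ≤ (1 + M / c) * (1 + ‖y - x0‖ / l0) := by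
      have : ‖y - z‖ ≤ ‖y - x0‖ + M * r0 := by
        have : y - z = (y - x0) - (z - x0) := by abel
        rw [this]
        exact (norm_sub_le _ _).trans (by linarith)
      have e3 : ‖y - z‖ / l0 ≤ ‖y - x0‖ / l0 + M / c := by
        rw [div_le_iff₀ hl0p, add_mul, div_mul_cancel₀ _ hl0p.ne']
        have : M / c * l0 = M * r0 := by rw [hl0]; field_simp
        linarith
      have : 0 ≤ ‖y - x0‖ / l0 := by positivity
      nlinarith
    calc _ ≤ C5 * ((1 + M / c) * (1 + ‖y - x0‖ / l0)) ^ n * (N * (ω l0 + (l0 ^ d)⁻¹)) := by gcongr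
      _ = _ := by rw [ha0, mul_pow]; ring
  have t0 := htl (P 0) (hPd 0) x0 l0 (a0 * N) hl0p hl01 B0 x hxx
  have tk : ∀ k < m, |pe (top n x0 (P k - P (k + 1))) (x - x0)| ≤ 
      C6 * (((θ ^ k * l0) ^ n)⁻¹ * (C1 * N * ω (θ ^ k * l0))) ∧
      |pe (low n x0 (P k - P (k + 1))) x| ≤ 
      C6 * (((θ ^ k * l0) ^ (n - 1))⁻¹ * (C1 * N * ω (θ ^ k * l0))) := by
    intro k hkm
    refine htl _ ((totalDegree_sub _ _).trans (max_le (hPd k) (hPd (k + 1)))) x0 (θ ^ k * l0) _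
      (by positivity) ?_ ?_ x hxx
    · have := pow_le_one₀ (n := k) hth.le h2.le
      nlinarith
    · intro y
      rw [pe_sub]
      exact hk k hkm y
  have te : |pe (top n x0 (P m - p)) (x - x0)| ≤ C6 * ((L ^ n)⁻¹ * (C1 * N * ω L)) ∧
      |pe (low n x0 (P m - p)) x| ≤ C6 * ((L ^ (n - 1))⁻¹ * (C1 * N * ω L)) := by
    refine htl _ ((totalDegree_sub _ _).trans (max_le (hPd m) hp.1)) x0 L _ hL hL1 ?_ x hxx
    intro y
    rw [pe_sub]
    exact hPm y
  constructor
  · have hsum := xi_sum_le h.md hth h2 hl0p hl01 (m + 1) hρ (by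
      rw [pow_succ']
      refine hρL.trans ?_
      calc θ * (θ * η) * L = θ * (θ * (η * L)) := by ring
        _ ≤ θ * lm := by gcongr
        _ = _ := by rw [hlm]; ring)
    rw [Finset.sum_range_succ, ← hlm, ← hKx] at hsum
    have hsn : 0 ≤ ∑ k ∈ Finset.range m, ω (θ ^ k * l0) * ((θ ^ k * l0) ^ n)⁻¹ := by
      apply Finset.sum_nonneg
      intro k _
      have := h.md.pos (θ ^ k * l0) (by positivity)
      positivity
    have hwm := h.md.pos lm hlm0
    have hen : 0 ≤ ω lm * (lm ^ n)⁻¹ := by positivity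
    have hend : ω L * (L ^ n)⁻¹ ≤ Ke * (ω lm * (lm ^ n)⁻¹) := by
      have g1 := h.md.scale hθη hθη1 hL
      have g2 : ω (θ * η * L) ≤ ω lm := h.md.mono _ _ (by positivity) (by rw [mul_assoc]; exact hm1)
      have g3 : lm ≤ L := hm2.trans haL
      calc ω L * (L ^ n)⁻¹ ≤ (Ke * ω lm) * (lm ^ n)⁻¹ := by
            have : ω L ≤ Ke * ω lm := g1.trans (by rw [hKe]; gcongr)
            gcongr
        _ = _ := by ring
    have hX := le_max_right 1 (xi ω n ρ)
    have hX1 := le_max_left 1 (xi ω n ρ)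
    set Xm := max 1 (xi ω n ρ)
    have hKe0 : 0 ≤ Ke := by positivity
    have hKx0 : 0 ≤ Kx := by positivity
    have hKX : Kx * xi ω n ρ ≤ Kx * Xm := by gcongr
    have key := tele_abs (fun p => pe (top n x0 p) (x - x0)) (fun a b => by rw [top_sub, pe_sub]) P p m
    refine key.trans ?_
    have u1 : |pe (top n x0 (P 0)) (x - x0)| ≤ C6 * ((l0 ^ n)⁻¹ * a0) * N * Xm := by
      refine t0.1.trans ?_
      calc C6 * ((l0 ^ n)⁻¹ * (a0 * N)) = C6 * ((l0 ^ n)⁻¹ * a0) * N * 1 := by ring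
        _ ≤ _ := by gcongr
    have u2 : ∑ k ∈ Finset.range m, |pe (top n x0 (P k - P (k + 1))) (x - x0)| ≤ C6 * C1 * Kx * N * Xm := by
      calc _ ≤ ∑ k ∈ Finset.range m, C6 * C1 * N * (ω (θ ^ k * l0) * ((θ ^ k * l0) ^ n)⁻¹) := by
            apply Finset.sum_le_sum
            intro k hk'
            refine (tk k (Finset.mem_range.1 hk')).1.trans (le_of_eq ?_)
            ring
        _ = C6 * C1 * N * ∑ k ∈ Finset.range m, (ω (θ ^ k * l0) * ((θ ^ k * l0) ^ n)⁻¹) := by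
            rw [Finset.mul_sum]
        _ ≤ C6 * C1 * N * (Kx * Xm) := by gcongr; linarith
        _ = _ := by ring
    have u3 : |pe (top n x0 (P m - p)) (x - x0)| ≤ C6 * C1 * Ke * Kx * N * Xm := by
      refine te.1.trans ?_
      calc C6 * ((L ^ n)⁻¹ * (C1 * N * ω L)) = C6 * C1 * N * (ω L * (L ^ n)⁻¹) := by ring
        _ ≤ C6 * C1 * N * (Ke * (Kx * Xm)) := by
          apply mul_le_mul_of_nonneg_left _ (by positivity)
          exact hend.trans (mul_le_mul_of_nonneg_left (by linarith) hKe0)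
        _ = _ := by ring
    calc _ ≤ C6 * ((l0 ^ n)⁻¹ * a0) * N * Xm + C6 * C1 * Kx * N * Xm + C6 * C1 * Ke * Kx * N * Xm :=
          add_le_add (add_le_add u1 u2) u3
      _ = T * N * Xm := by rw [hT]; ring
      _ ≤ _ := by gcongr; linarith
  · have key := tele_abs (fun p => pe (low n x0 p) x) (fun a b => by rw [low_sub, pe_sub]) P p m
    refine key.trans ?_
    have hsum := low_sum_le h.md hth h2 hl0p m
    have u1 : |pe (low n x0 (P 0)) x| ≤ C6 * ((l0 ^ (n - 1))⁻¹ * a0) * N := by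
      refine t0.2.trans (le_of_eq ?_); ring
    have u2 : ∑ k ∈ Finset.range m, |pe (low n x0 (P k - P (k + 1))) x| ≤ 
        C6 * C1 * (Cω * ω l0 * (l0 ^ (n - 1))⁻¹ * (1 - θ ^ (r - (n - 1 : ℝ)))⁻¹) * N := by
      calc _ ≤ ∑ k ∈ Finset.range m, C6 * C1 * N * (ω (θ ^ k * l0) * ((θ ^ k * l0) ^ (n - 1))⁻¹) := by
            apply Finset.sum_le_sum
            intro k hk'
            refine (tk k (Finset.mem_range.1 hk')).2.trans (le_of_eq ?_)
            ring
        _ = C6 * C1 * N * ∑ k ∈ Finset.range m, (ω (θ ^ k * l0) * ((θ ^ k * l0) ^ (n - 1))⁻¹) := by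
            rw [Finset.mul_sum]
        _ ≤ C6 * C1 * N * (Cω * ω l0 * (l0 ^ (n - 1))⁻¹ * (1 - θ ^ (r - (n - 1 : ℝ)))⁻¹) := by gcongr
        _ = _ := by ring
    have hend : ω L * (L ^ (n - 1))⁻¹ ≤ Cω * ω l0 * (l0 ^ (n - 1))⁻¹ := by
      have g1 := h.md.down (L / l0) l0 (by positivity) ((div_le_one hl0p).2 hLl) hl0p
      rw [div_mul_cancel₀ _ hl0p.ne'] at g1
      have g2 : (L / l0) ^ r ≤ (L / l0) ^ (n - 1) := by
        rw [← Real.rpow_natCast]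
        apply Real.rpow_le_rpow_of_exponent_ge (by positivity) ((div_le_one hl0p).2 hLl)
        rw [Nat.cast_sub h.md.n_pos]
        simpa using h.md.hr.le
      calc ω L * (L ^ (n - 1))⁻¹ ≤ (Cω * (L / l0) ^ (n - 1) * ω l0) * (L ^ (n - 1))⁻¹ := by
            gcongr
            exact g1.trans (by gcongr)
        _ = _ := by rw [div_pow]; field_simp
    have u3 : |pe (low n x0 (P m - p)) x| ≤ C6 * C1 * (Cω * ω l0 * (l0 ^ (n - 1))⁻¹) * N := by
      refine te.2.trans ?_
      calc C6 * ((L ^ (n - 1))⁻¹ * (C1 * N * ω L)) = C6 * C1 * N * (ω L * (L ^ (n - 1))⁻¹) := by ring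
        _ ≤ C6 * C1 * N * (Cω * ω l0 * (l0 ^ (n - 1))⁻¹) := by gcongr
        _ = _ := by ring
    calc _ ≤ _ := add_le_add (add_le_add u1 u2) u3
      _ = Sl * N := by rw [hSl]; ring
      _ ≤ _ := by gcongr; linarith

end ZT

namespace ZT
open MvPolynomial
variable {d n : ℕ} {ω : ℝ → ℝ} {q r Cω c r0 M Δ : ℝ} {D : Set (EE d)}

lemma cube_star {x z : EE d} {l t : ℝ} (hx : x ∈ cube z l) (ht : 0 < t) (ht1 : t ≤ 1) :
    cube (x + t • (z - x)) (t * l) ⊆ cube z l := by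
  intro u hu i
  have h1 := hx i
  have h2 := hu i
  simp only [PiLp.add_apply, PiLp.smul_apply, PiLp.sub_apply, smul_eq_mul] at h2
  rw [abs_le] at *
  constructor <;> nlinarith

/-- pointwise bound of `f - p` on a cube -/
lemma near_best_pt (h : Ctx ω n q r Cω D c r0 M Δ) : ∃ C : ℝ, 1 ≤ C ∧ ∀ f N, Fn ω n D f N →
    ∀ (y : EE d) (s : ℝ) (p : MvPolynomial (Fin d) ℝ), 0 < s → cube y s ⊆ D →
    Ap ω n N f p y s → ∀ x ∈ cube y s, LebPt f x → |f x - pe p x| ≤ C * N * ω s := by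
  obtain ⟨C, hC, H⟩ := carrot d n (M := d) (by positivity) h.md
  refine ⟨C, hC, fun f N hf y s p hs hsub hp x hx hL => ?_⟩
  refine H f N x y s hf.hN hs ?_ hL ?_ p hp
  · rw [norm_sub_rev]; exact norm_sub_le_of_mem_cube hs.le hx
  · intro t ht ht1
    exact hf.ap _ _ (by positivity) ((cube_star hx ht ht1).trans hsub)

lemma avg_le_of_ae {F : EE d → ℝ} {y : EE d} {s a : ℝ} (hs : 0 < s) (ha : 0 ≤ a)
    (h : ∀ᵐ x, x ∈ cube y s → |F x| ≤ a) :
    (s ^ d)⁻¹ * ∫ x in cube y s, |F x| ≤ a := by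
  have h1 : ∫ x in cube y s, |F x| ≤ a * s ^ d := by
    by_cases hi : IntegrableOn (fun x => |F x|) (cube y s)
    · calc ∫ x in cube y s, |F x| ≤ ∫ x in cube y s, a := by
            apply setIntegral_mono_on_ae hi ?_ (measurableSet_cube y s) h
            exact integrableOn_const (by rw [volume_cube _ hs.le]; exact ENNReal.ofReal_ne_top)
        _ = a * s ^ d := by
            rw [setIntegral_const, volume_real_cube _ hs.le, smul_eq_mul, mul_comm]
    · rw [integral_undef hi]; positivity
  rw [inv_mul_le_iff₀ (by positivity), mul_comm]
  exact h1

set_option maxHeartbeats 1000000 in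
lemma holder_near (h : Ctx ω n q r Cω D c r0 M Δ) : ∃ C β : ℝ, 1 ≤ C ∧ 0 < β ∧ β ≤ 1 ∧
    ∀ f N, Fn ω n D f N →
    ∀ (x0 : EE d) (L : ℝ) (p : MvPolynomial (Fin d) ℝ), 0 < L → L ≤ c * r0 → cube x0 L ⊆ D → 
    Ap ω n N f p x0 L → ∀ x y, ‖y - x0‖ ≤ L / 4 → ‖x - y‖ ≤ L / 4 → LebPt f x → LebPt f y →
    |(f x - pe p x) - (f y - pe p y)| ≤ C * N * ω L * (‖x - y‖ / L) ^ β := by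
  obtain ⟨C1, hC1, H1⟩ := near_best_pt h
  obtain ⟨C2, hC2, H2⟩ := pe_lip d n
  obtain ⟨C3, hC3, H3⟩ := growth_a h
  have hCω := h.md.hC
  have hrp := h.md.r_pos
  set β := min r 1 / 2 with hβ
  have hβ0 : 0 < β := by
    have := lt_min hrp zero_lt_one
    positivity
  have hβ1 : β ≤ 1 / 2 := by
    have := min_le_right r 1
    linarith
  have hβr : β ≤ r / 2 := by
    have := min_le_left r 1
    linarith
  have hq1 := h.md.q_pos
  set E : ℝ := C3 * (1 + d) ^ q with hE
  have hE0 : 0 ≤ E := by positivity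
  refine ⟨2 * C1 * Cω + C2 * (C1 * Cω + E), β, ?_, hβ0, by linarith, ?_⟩
  · have : 1 ≤ C1 * Cω := one_le_mul_of_one_le_of_one_le hC1 hCω
    have : 0 ≤ C2 * (C1 * Cω + E) := by positivity
    linarith
  intro f N hf x0 L p hL hLr hsub hp x y hy hxy hx hyL
  have hN := hf.hN
  have hwL := h.md.pos L hL
  rcases eq_or_ne x y with rfl | hne
  · simp
    positivity
  set τ := ‖x - y‖ with hτ
  have hτ0 : 0 < τ := norm_pos_iff.2 (sub_ne_zero.2 hne)
  set s := Real.sqrt (τ * L) with hs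
  have hs0 : 0 < s := Real.sqrt_pos.2 (by positivity)
  have hss : s * s = τ * L := Real.mul_self_sqrt (by positivity)
  have hsL : s ≤ L / 2 := by
    by_contra hh
    push Not at hh
    nlinarith
  have hτs : τ ≤ s / 2 := by
    by_contra hh
    push Not at hh
    nlinarith
  have hcub : cube y s ⊆ cube x0 L := cube_subset_cube (by linarith)
  obtain ⟨P, hP⟩ := hf.ap y s hs0 (hcub.trans hsub)
  have a1 := H1 f N hf y s P hs0 (hcub.trans hsub) hP x (mem_cube_of_norm (by linarith)) hx
  have a2 := H1 f N hf y s P hs0 (hcub.trans hsub) hP y (mem_cube_self y hs0.le) hyL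
  have hdeg : (P - p).totalDegree ≤ n := (totalDegree_sub _ _).trans (max_le hP.1 hp.1)
  have a3 := H2 (P - p) hdeg y s hs0 x (mem_cube_of_norm (by linarith)) y (mem_cube_self y hs0.le)
  have hae := ae_lebPt h.op hf.int.locallyIntegrableOn
  have hws := h.md.pos s hs0
  have a4 : (s ^ d)⁻¹ * ∫ u in cube y s, |pe (P - p) u| ≤ C1 * N * ω s + E * N * ω L := by
    apply avg_le_of_ae hs0 (by positivity)
    filter_upwards [hae] with u hu huc
    have huD := hsub (hcub huc)
    have b1 := H1 f N hf y s P hs0 (hcub.trans hsub) hP u huc (hu huD)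
    have b2 := H3 f N hf x0 L p hL hLr hsub hp u huD (hu huD)
    have b3 : (1 + ‖u - x0‖ / L) ^ q ≤ (1 + (d : ℝ)) ^ q := by
      apply Real.rpow_le_rpow (by positivity) _ hq1.le
      have := norm_sub_le_of_mem_cube hL.le (hcub huc)
      have : ‖u - x0‖ / L ≤ d := by rwa [div_le_iff₀ hL]
      linarith
    have b4 : C3 * N * ω L * (1 + ‖u - x0‖ / L) ^ q ≤ C3 * N * ω L * (1 + (d : ℝ)) ^ q := by gcongr
    have b5 : |pe (P - p) u| ≤ |f u - pe P u| + |f u - pe p u| := by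
      rw [pe_sub]
      calc |pe P u - pe p u| = |(f u - pe p u) - (f u - pe P u)| := by ring_nf
        _ ≤ _ := by rw [add_comm]; exact abs_sub _ _
    calc |pe (P - p) u| ≤ C1 * N * ω s + C3 * N * ω L * (1 + (d : ℝ)) ^ q := by linarith
      _ = _ := by rw [hE]; ring
  set ρ := τ / L with hρ
  have hρ0 : 0 < ρ := by positivity
  have hρ1 : ρ ≤ 1 := by rw [hρ, div_le_one hL]; linarith
  have hsL2 : s / L = ρ ^ (1 / 2 : ℝ) := by
    rw [← Real.sqrt_eq_rpow, eq_comm, Real.sqrt_eq_iff_mul_self_eq (by positivity) (by positivity)]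
    rw [hρ]
    field_simp
    nlinarith
  have hτs2 : τ / s = ρ ^ (1 / 2 : ℝ) := by
    rw [← hsL2]
    field_simp
    nlinarith
  have hhalf : ρ ^ (1 / 2 : ℝ) ≤ ρ ^ β := Real.rpow_le_rpow_of_exponent_ge hρ0 hρ1 hβ1
  have hws2 : ω s ≤ Cω * ω L * ρ ^ β := by
    have e1 := h.md.down (s / L) L (by positivity) (by rw [div_le_one hL]; linarith) hL
    rw [div_mul_cancel₀ _ hL.ne', hsL2, ← Real.rpow_mul hρ0.le] at e1
    have e2 : ρ ^ (1 / 2 * r) ≤ ρ ^ β := Real.rpow_le_rpow_of_exponent_ge hρ0 hρ1 (by linarith)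
    calc ω s ≤ Cω * ρ ^ (1 / 2 * r) * ω L := e1
      _ ≤ Cω * ρ ^ β * ω L := by gcongr
      _ = _ := by ring
  have hws3 : ω s ≤ Cω * ω L := by
    refine hws2.trans ?_
    have : ρ ^ β ≤ 1 := Real.rpow_le_one hρ0.le hρ1 hβ0.le
    exact mul_le_of_le_one_right (by positivity) this
  have hρβ : 0 ≤ ρ ^ β := by positivity
  have a5 : |pe (P - p) x - pe (P - p) y| ≤ C2 * ρ ^ β * ((C1 * Cω + E) * N * ω L) := by
    refine a3.trans ?_
    rw [hτs2]
    have : C1 * N * ω s + E * N * ω L ≤ (C1 * Cω + E) * N * ω L := by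
      have : C1 * N * ω s ≤ C1 * N * (Cω * ω L) := by gcongr
      linarith
    have := a4.trans this
    gcongr
  have a6 : C1 * N * ω s ≤ C1 * N * (Cω * ω L * ρ ^ β) := by gcongr
  rw [pe_sub, pe_sub] at a5
  have e : (f x - pe p x) - (f y - pe p y) = (f x - pe P x) - (f y - pe P y) + ((pe P x - pe p x) - (pe P y - pe p y)) := by ring
  rw [e]
  calc _ ≤ |f x - pe P x| + |f y - pe P y| + |(pe P x - pe p x) - (pe P y - pe p y)| :=
        (abs_add_le _ _).trans (add_le_add (abs_sub _ _) le_rfl)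
    _ ≤ 2 * (C1 * N * (Cω * ω L * ρ ^ β)) + C2 * ρ ^ β * ((C1 * Cω + E) * N * ω L) := by linarith
    _ = _ := by ring
end ZT

namespace ZT
open MvPolynomial
variable {d n : ℕ} {ω : ℝ → ℝ} {q r Cω c r0 M Δ : ℝ} {D : Set (EE d)}

def vd (d : ℕ) : ℝ := d * volume.real (ball (0 : EE d) 1)

lemma vd_nonneg (d : ℕ) : 0 ≤ vd d := by unfold vd; positivity

lemma rad_gen (hd : 0 < d) (e : ℝ) {S : Set ℝ} (hS : MeasurableSet S) (hS0 : S ⊆ Ioi 0)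
    (hi : IntegrableOn (fun y : ℝ => y ^ (e - 1)) S) :
    IntegrableOn (fun x : EE d => ‖x‖ ^ (e - d)) {x | ‖x‖ ∈ S} ∧
    ∫ x in {x : EE d | ‖x‖ ∈ S}, ‖x‖ ^ (e - d) = vd d * ∫ y in S, y ^ (e - 1) := by
  haveI : Nontrivial (EE d) := by
    haveI : Nonempty (Fin d) := ⟨⟨0, hd⟩⟩
    infer_instance
  have hm : MeasurableSet {x : EE d | ‖x‖ ∈ S} := measurable_norm hS
  set F : ℝ → ℝ := S.indicator (fun y => y ^ (e - d)) with hF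
  have e1 : ({x : EE d | ‖x‖ ∈ S}).indicator (fun x : EE d => ‖x‖ ^ (e - d)) = fun x => F ‖x‖ := by
    ext x
    simp [hF, Set.indicator]
  have e2 : EqOn (fun y : ℝ => y ^ (Module.finrank ℝ (EE d) - 1) • F y) (S.indicator fun y => y ^ (e - 1)) (Ioi 0) := by
    intro y hy
    have hy0 : (0:ℝ) < y := hy
    by_cases hyS : y ∈ S
    · simp only [hF, indicator_of_mem hyS, finrank_euclideanSpace, Fintype.card_fin, smul_eq_mul]
      rw [← Real.rpow_natCast, ← Real.rpow_add hy0, Nat.cast_sub hd]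
      congr 1
      push_cast
      ring
    · simp [hF, indicator_of_notMem hyS]
  constructor
  · rw [← integrable_indicator_iff hm, e1, integrable_fun_norm_addHaar,
      integrableOn_congr_fun e2 measurableSet_Ioi]
    exact ((integrable_indicator_iff hS).2 hi).integrableOn
  · rw [← integral_indicator hm, e1, integral_fun_norm_addHaar, setIntegral_congr_fun measurableSet_Ioi e2,
      setIntegral_indicator hS, inter_eq_right.2 hS0]
    simp [vd, mul_assoc]

lemma rad_in (hd : 0 < d) {β s : ℝ} (hβ : 0 < β) (hs : 0 < s) :
    IntegrableOn (fun x : EE d => ‖x‖ ^ (β - d)) (closedBall 0 s) ∧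
    ∫ x in closedBall (0 : EE d) s, ‖x‖ ^ (β - d) = vd d * (s ^ β / β) := by
  haveI : Nontrivial (EE d) := by
    haveI : Nonempty (Fin d) := ⟨⟨0, hd⟩⟩
    infer_instance
  have h0 := intervalIntegral.intervalIntegrable_rpow' (a := 0) (b := s) (r := β - 1) (by linarith)
  rw [intervalIntegrable_iff_integrableOn_Ioc_of_le hs.le] at h0
  have h1 := rad_gen hd β (S := Ioc 0 s) measurableSet_Ioc (fun x hx => hx.1) h0
  have e : {x : EE d | ‖x‖ ∈ Ioc 0 s} = closedBall 0 s \ {0} := by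
    ext x; simp [and_comm]
  have e2 : (closedBall 0 s \ {0} : Set (EE d)) =ᵐ[volume] closedBall 0 s :=
    sdiff_null_ae_eq_self (measure_singleton _)
  rw [e, integrableOn_congr_set_ae e2, setIntegral_congr_set e2] at h1
  refine ⟨h1.1, h1.2.trans ?_⟩
  rw [← intervalIntegral.integral_of_le hs.le, integral_rpow (Or.inl (by linarith))]
  simp [Real.zero_rpow hβ.ne']

lemma rad_out (hd : 0 < d) {γ s : ℝ} (hγ : 0 < γ) (hs : 0 < s) :
    IntegrableOn (fun x : EE d => ‖x‖ ^ (-γ - d)) (closedBall 0 s)ᶜ ∧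
    ∫ x in (closedBall (0 : EE d) s)ᶜ, ‖x‖ ^ (-γ - d) = vd d * (s ^ (-γ) / γ) := by
  have h0 := integrableOn_Ioi_rpow_of_lt (a := -γ - 1) (by linarith) hs
  have h1 := rad_gen hd (-γ) (S := Ioi s) measurableSet_Ioi (fun x hx => hs.trans hx) h0
  have e : {x : EE d | ‖x‖ ∈ Ioi s} = (closedBall 0 s)ᶜ := by
    ext x; simp
  rw [e] at h1
  refine ⟨h1.1, h1.2.trans ?_⟩
  rw [integral_Ioi_rpow_of_lt (by linarith) hs]
  simp [neg_div_neg_eq]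

structure Ker (d : ℕ) (K : EE d → ℝ) (CK : ℝ) : Prop where
  meas : Measurable K
  hC : 1 ≤ CK
  bd : ∀ x, |K x| ≤ CK * ‖x‖ ^ (-(d : ℝ))
  ann : ∀ ε s, 0 < ε → ε < s → ∫ x in closedBall 0 s \ closedBall 0 ε, K x = 0

lemma om_bdd (hd : 0 < d) {k : ℕ∞} {Ω : EE d → ℝ} (hΩ : IsCZDensity d k Ω) :
    ∃ C, 1 ≤ C ∧ ∀ x, x ≠ 0 → |Ω x| ≤ C := by
  have h1 : ContinuousOn Ω (sphere 0 1) := hΩ.smooth.continuousOn.mono (by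
    intro x hx
    have : ‖x‖ = 1 := by simpa using hx
    intro h0
    simp [h0] at this)
  obtain ⟨C, hC⟩ := (isCompact_sphere (0 : EE d) 1).exists_bound_of_continuousOn h1
  refine ⟨max C 1, le_max_right _ _, fun x hx => ?_⟩
  have hx0 : 0 < ‖x‖ := norm_pos_iff.2 hx
  rw [← hΩ.homog ‖x‖⁻¹ (by positivity) x]
  exact (hC _ (by simp [norm_smul, hx0.ne'])).trans (le_max_left _ _)

lemma ann_zero (hd : 0 < d) {k : ℕ∞} {Ω : EE d → ℝ} (hΩ : IsCZDensity d k Ω) (ε s : ℝ) (hε : 0 < ε) :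
    ∫ x in closedBall (0 : EE d) s \ closedBall 0 ε, Ω x / ‖x‖ ^ d = 0 := by
  have hm : MeasurableSet (closedBall (0 : EE d) s \ closedBall 0 ε) :=
    measurableSet_closedBall.diff measurableSet_closedBall
  haveI : Nontrivial (EE d) := by
    haveI : Nonempty (Fin d) := ⟨⟨0, hd⟩⟩
    infer_instance
  set G : EE d → ℝ := fun x => Ω (‖x‖⁻¹ • x) * (Ioc ε s).indicator (fun t => 1 / t ^ d) ‖x‖ with hG
  have e1 : ∀ x ∈ ({0}ᶜ : Set (EE d)), (closedBall (0 : EE d) s \ closedBall 0 ε).indicator (fun x => Ω x / ‖x‖ ^ d) x = G x := by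
    intro x hx
    have hx0 : 0 < ‖x‖ := norm_pos_iff.2 hx
    simp only [hG, hΩ.homog ‖x‖⁻¹ (by positivity) x]
    by_cases h : ‖x‖ ∈ Ioc ε s
    · rw [indicator_of_mem h, indicator_of_mem (by simpa [and_comm] using h)]
      ring
    · rw [indicator_of_notMem h, indicator_of_notMem (by simpa [and_comm] using h), mul_zero]
  rw [← integral_indicator hm, ← restrict_compl_singleton (μ := volume) (0 : EE d),
    setIntegral_congr_fun (measurableSet_singleton _).compl e1,
    ← integral_subtype_comap (measurableSet_singleton _).compl G]
  have e2 := (volume : Measure (EE d)).measurePreserving_homeomorphUnitSphereProd.integral_comp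
    (Homeomorph.measurableEmbedding _) (fun y : sphere (0 : EE d) 1 × Ioi (0 : ℝ) => 
      Ω y.1 * (Ioc ε s).indicator (fun t => 1 / t ^ d) (y.2 : ℝ))
  have e3 := integral_prod_mul (μ := (volume : Measure (EE d)).toSphere)
    (ν := Measure.volumeIoiPow (Module.finrank ℝ (EE d) - 1)) (fun y : sphere (0 : EE d) 1 => Ω y)
    (fun y : Ioi (0 : ℝ) => (Ioc ε s).indicator (fun t => 1 / t ^ d) (y : ℝ))
  rw [hΩ.meanZero, zero_mul] at e3
  have e2 := e2.trans e3
  rw [← e2]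
  congr 1
  ext x
  simp [hG]

lemma exists_ker (hd : 0 < d) {k : ℕ∞} {Ω K : EE d → ℝ} (hΩ : IsCZDensity d k Ω)
    (hK : K = fun x => Ω x / ‖x‖ ^ d) : ∃ CK, Ker d K CK := by
  obtain ⟨C, hC, hb⟩ := om_bdd hd hΩ
  refine ⟨C, ?_, hC, ?_, ?_⟩
  · have : ContinuousOn K {0}ᶜ := by
      rw [hK]
      apply ContinuousOn.div hΩ.smooth.continuousOn (by fun_prop)
      intro x hx
      have : 0 < ‖x‖ := norm_pos_iff.2 hx
      positivity
    exact measurable_of_continuousOn_compl_singleton 0 this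
  · intro x
    rw [hK, Real.rpow_neg (norm_nonneg _), Real.rpow_natCast]
    rcases eq_or_ne x 0 with rfl | hx
    · simp [hd.ne']
    · simp only [abs_div, abs_pow, abs_norm]
      rw [div_eq_mul_inv]
      gcongr
      exact hb x hx
  · intro ε s hε hs
    rw [hK]
    exact ann_zero hd hΩ ε s hε
end ZT

namespace ZT
open MvPolynomial
variable {d n : ℕ} {ω : ℝ → ℝ} {q r Cω c r0 M Δ : ℝ} {D : Set (EE d)} {K : EE d → ℝ} {CK : ℝ}

def trunc (D : Set (EE d)) (K f : EE d → ℝ) (ε : ℝ) (y : EE d) : ℝ :=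
  ∫ x in {x ∈ D | ε < dist y x}, f x * K (y - x)

def VV (D : Set (EE d)) (K : EE d → ℝ) (s : ℝ) (h : EE d → ℝ) (y : EE d) : ℝ :=
  (∫ x in D \ closedBall y s, h x * K (y - x)) + ∫ x in closedBall y s, (h x - h y) * K (y - x)

lemma pre_ball (y : EE d) (s : ℝ) : (fun x => y - x) ⁻¹' (closedBall (0 : EE d) s) = closedBall y s := by
  ext x
  simp [mem_closedBall, dist_eq_norm, norm_sub_rev]

lemma integrableOn_sub_left {F : EE d → ℝ} (y : EE d) (S : Set (EE d)) :
    IntegrableOn (fun x => F (y - x)) ((fun x => y - x) ⁻¹' S) ↔ IntegrableOn F S :=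
  (Measure.measurePreserving_sub_left volume y).integrableOn_comp_preimage
    (measurableEmbedding_subLeft y)

lemma setIntegral_sub_left (F : EE d → ℝ) (y : EE d) (S : Set (EE d)) :
    ∫ x in (fun x => y - x) ⁻¹' S, F (y - x) = ∫ x in S, F x :=
  (Measure.measurePreserving_sub_left volume y).setIntegral_preimage_emb
    (measurableEmbedding_subLeft y) F S

lemma rad_in' (hd : 0 < d) {β s : ℝ} (hβ : 0 < β) (hs : 0 < s) (y : EE d) :
    IntegrableOn (fun x : EE d => ‖y - x‖ ^ (β - d)) (closedBall y s) ∧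
    ∫ x in closedBall y s, ‖y - x‖ ^ (β - d) = vd d * (s ^ β / β) := by
  have h := rad_in hd hβ hs
  rw [← pre_ball, setIntegral_sub_left (fun x => ‖x‖ ^ (β - d)),
    integrableOn_sub_left (F := fun x => ‖x‖ ^ (β - d))]
  exact h

lemma rad_out' (hd : 0 < d) {γ s : ℝ} (hγ : 0 < γ) (hs : 0 < s) (y : EE d) :
    IntegrableOn (fun x : EE d => ‖y - x‖ ^ (-γ - d)) (closedBall y s)ᶜ ∧
    ∫ x in (closedBall y s)ᶜ, ‖y - x‖ ^ (-γ - d) = vd d * (s ^ (-γ) / γ) := by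
  have h := rad_out hd hγ hs
  rw [← pre_ball, ← preimage_compl, setIntegral_sub_left (fun x => ‖x‖ ^ (-γ - d)),
    integrableOn_sub_left (F := fun x => ‖x‖ ^ (-γ - d))]
  exact h

lemma Ker.bd_far (hK : Ker d K CK) {x : EE d} {ε : ℝ} (hε : 0 < ε) (h : ε ≤ ‖x‖) :
    |K x| ≤ CK * ε ^ (-(d : ℝ)) := by
  refine (hK.bd x).trans ?_
  have := hK.hC
  apply mul_le_mul_of_nonneg_left _ (by linarith)
  exact Real.rpow_le_rpow_of_nonpos hε h (by simp)

lemma int_away (hK : Ker d K CK) {f : EE d → ℝ} {S : Set (EE d)} (hS : MeasurableSet S)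
    (hf : IntegrableOn f S) {y : EE d} {ε : ℝ} (hε : 0 < ε) (h : ∀ x ∈ S, ε ≤ ‖y - x‖) :
    IntegrableOn (fun x => f x * K (y - x)) S := by
  refine Integrable.mul_bdd (c := CK * ε ^ (-(d : ℝ))) hf ?_ ?_
  · exact (hK.meas.comp (measurable_const.sub measurable_id)).aestronglyMeasurable
  · filter_upwards [ae_restrict_mem hS] with x hx
    exact hK.bd_far hε (h x hx)

lemma ann_sub (hK : Ker d K CK) (y : EE d) {ε s : ℝ} (hε : 0 < ε) (hs : ε < s) :
    ∫ x in closedBall y s \ closedBall y ε, K (y - x) = 0 := by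
  rw [← pre_ball y s, ← pre_ball y ε, ← preimage_sdiff, setIntegral_sub_left]
  exact hK.ann ε s hε hs

lemma hol_int (hd : 0 < d) (hK : Ker d K CK) {F : EE d → ℝ} {y : EE d} {s a β : ℝ}
    (hs : 0 < s) (ha : 0 ≤ a) (hβ : 0 < β)
    (hFm : AEStronglyMeasurable F (volume.restrict (closedBall y s)))
    (hF : ∀ᵐ x, x ∈ closedBall y s → |F x| ≤ a * ‖y - x‖ ^ β) :
    IntegrableOn (fun x => F x * K (y - x)) (closedBall y s) ∧
    |∫ x in closedBall y s, F x * K (y - x)| ≤ a * CK * (vd d * (s ^ β / β)) := by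
  obtain ⟨h1, h2⟩ := rad_in' hd hβ hs y
  have hC := hK.hC
  have hb : ∀ᵐ x ∂(volume.restrict (closedBall y s)), ‖F x * K (y - x)‖ ≤ a * CK * ‖y - x‖ ^ (β - d) := by
    rw [ae_restrict_iff' measurableSet_closedBall]
    have hne : ∀ᵐ x : EE d, x ≠ y := by
      haveI : Nontrivial (EE d) := by
        haveI : Nonempty (Fin d) := ⟨⟨0, hd⟩⟩
        infer_instance
      exact Measure.ae_ne volume y
    filter_upwards [hF, hne] with x hx hxy hxs
    have h0 : 0 < ‖y - x‖ := norm_pos_iff.2 (sub_ne_zero.2 hxy.symm)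
    rw [norm_mul, Real.norm_eq_abs, Real.norm_eq_abs]
    calc |F x| * |K (y - x)| ≤ (a * ‖y - x‖ ^ β) * (CK * ‖y - x‖ ^ (-(d : ℝ))) := by
          gcongr
          · exact hx hxs
          · exact hK.bd _
      _ = a * CK * ‖y - x‖ ^ (β - d) := by
          rw [sub_eq_add_neg β, Real.rpow_add h0]; ring
  have hi : IntegrableOn (fun x => a * CK * ‖y - x‖ ^ (β - d)) (closedBall y s) := h1.const_mul _
  refine ⟨Integrable.mono' hi (hFm.mul ?_) hb, ?_⟩
  · exact (hK.meas.comp (measurable_const.sub measurable_id)).aestronglyMeasurable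
  · rw [← Real.norm_eq_abs]
    refine (norm_integral_le_of_norm_le hi hb).trans (le_of_eq ?_)
    rw [integral_const_mul, h2]

lemma pv (hd : 0 < d) (hK : Ker d K CK) (hop : IsOpen D) {h : EE d → ℝ} (hh : IntegrableOn h D)
    {y : EE d} {s a β : ℝ} (hs : 0 < s) (hsub : closedBall y s ⊆ D) (ha : 0 ≤ a) (hβ : 0 < β)
    (hF : ∀ᵐ x, x ∈ closedBall y s → |h x - h y| ≤ a * ‖y - x‖ ^ β) :
    Tendsto (fun ε => trunc D K h ε y) (𝓝[>] 0) (𝓝 (VV D K s h y)) := by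
  have hFm : AEStronglyMeasurable (fun x => h x - h y) (volume.restrict (closedBall y s)) :=
    (hh.mono_set hsub).aestronglyMeasurable.sub aestronglyMeasurable_const
  obtain ⟨hi, -⟩ := hol_int hd hK hs ha hβ hFm hF
  have hlim : Tendsto (fun ε => ∫ x in closedBall y s, (closedBall y ε)ᶜ.indicator
      (fun x => (h x - h y) * K (y - x)) x) (𝓝[>] (0 : ℝ))
      (𝓝 (∫ x in closedBall y s, (h x - h y) * K (y - x))) := by
    apply tendsto_integral_filter_of_dominated_convergence _ _ _ hi.norm
    · haveI : Nontrivial (EE d) := by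
        haveI : Nonempty (Fin d) := ⟨⟨0, hd⟩⟩
        infer_instance
      filter_upwards [ae_restrict_of_ae (Measure.ae_ne volume y)] with x hx
      apply tendsto_const_nhds.congr'
      have h0 : 0 < dist x y := dist_pos.2 hx
      filter_upwards [Ioo_mem_nhdsGT h0] with ε hε
      rw [indicator_of_mem]
      simp only [mem_compl_iff, mem_closedBall, not_le]
      exact hε.2
    · exact Eventually.of_forall fun ε => hi.aestronglyMeasurable.indicator measurableSet_closedBall.compl
    · exact Eventually.of_forall fun ε => Eventually.of_forall fun x => norm_indicator_le_norm_self _ _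
  have := hlim.const_add (∫ x in D \ closedBall y s, h x * K (y - x))
  refine this.congr' ?_
  filter_upwards [Ioo_mem_nhdsGT hs] with ε hε
  have hε0 := hε.1
  have hεs := hε.2
  have hset : {x ∈ D | ε < dist y x} = (D \ closedBall y s) ∪ (closedBall y s \ closedBall y ε) := by
    ext x
    simp only [mem_setOf_eq, mem_union, Set.mem_sdiff, mem_closedBall, not_le, dist_comm y x]
    constructor
    · rintro ⟨h1, h2⟩
      rcases lt_or_ge s (dist x y) with h3 | h3
      · exact Or.inl ⟨h1, h3⟩
      · exact Or.inr ⟨h3, h2⟩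
    · rintro (⟨h1, h2⟩ | ⟨h1, h2⟩)
      · exact ⟨h1, hεs.trans h2⟩
      · exact ⟨hsub (mem_closedBall.2 h1), h2⟩
  have hm1 : MeasurableSet (D \ closedBall y s) := hop.measurableSet.diff measurableSet_closedBall
  have hm2 : MeasurableSet (closedBall y s \ closedBall y ε) := 
    measurableSet_closedBall.diff measurableSet_closedBall
  have hfar : ∀ x ∈ closedBall y s \ closedBall y ε, ε ≤ ‖y - x‖ := by
    intro x hx
    have := hx.2
    rw [mem_closedBall, not_le, dist_eq_norm, norm_sub_rev] at this
    exact this.le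
  have hi2 : IntegrableOn (fun x => h x * K (y - x)) (closedBall y s \ closedBall y ε) :=
    int_away hK hm2 (hh.mono_set (sdiff_subset.trans hsub)) hε0 hfar
  have hi3 : IntegrableOn (fun x => h y * K (y - x)) (closedBall y s \ closedBall y ε) := by
    refine int_away hK (f := fun _ => h y) hm2 (integrableOn_const ?_) hε0 hfar
    exact ((measure_mono sdiff_subset).trans_lt measure_closedBall_lt_top).ne
  unfold trunc
  rw [hset, setIntegral_union _ hm2 _ hi2]
  · congr 1
    rw [setIntegral_indicator measurableSet_closedBall.compl, ← Set.sdiff_eq]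
    have e : ∫ x in closedBall y s \ closedBall y ε, (h x - h y) * K (y - x) = 
        (∫ x in closedBall y s \ closedBall y ε, h x * K (y - x)) - ∫ x in closedBall y s \ closedBall y ε, h y * K (y - x) := by
      rw [← integral_sub hi2 hi3]
      congr 1
      ext x
      ring
    rw [e, integral_const_mul, ann_sub hK y hε0 hεs, mul_zero, sub_zero]
  · rw [Set.disjoint_left]
    intro x hx hx2
    exact hx.2 hx2.1
  · apply int_away hK hm1 (hh.mono_set sdiff_subset) hs
    intro x hx
    have := hx.2
    rw [mem_closedBall, not_le, dist_eq_norm, norm_sub_rev] at this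
    exact this.le

/-- linearity of truncated integrals -/
lemma trunc_add (hK : Ker d K CK) (hop : IsOpen D) {f g : EE d → ℝ} (hf : IntegrableOn f D)
    (hg : IntegrableOn g D) {ε : ℝ} (hε : 0 < ε) (y : EE d) :
    trunc D K (fun x => f x + g x) ε y = trunc D K f ε y + trunc D K g ε y := by
  have hm : MeasurableSet {x ∈ D | ε < dist y x} :=
    hop.measurableSet.inter (isOpen_lt continuous_const (continuous_const.dist continuous_id)).measurableSet
  have hfar : ∀ x ∈ {x ∈ D | ε < dist y x}, ε ≤ ‖y - x‖ := by
    intro x hx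
    have := hx.2
    rw [dist_eq_norm] at this
    exact this.le
  unfold trunc
  rw [← integral_add]
  · congr 1
    ext x
    ring
  · exact int_away hK hm (hf.mono_set (sep_subset _ _)) hε hfar
  · exact int_away hK hm (hg.mono_set (sep_subset _ _)) hε hfar

lemma trunc_smul (a : ℝ) (f : EE d → ℝ) (ε : ℝ) (y : EE d) :
    trunc D K (fun x => a * f x) ε y = a * trunc D K f ε y := by
  unfold trunc
  rw [← integral_const_mul]
  congr 1
  ext x
  ring

lemma integrableOn_pe_D (hb : Bornology.IsBounded D) (p : MvPolynomial (Fin d) ℝ) :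
    IntegrableOn (pe p) D := by
  obtain ⟨R, hR⟩ := hb.subset_closedBall 0
  refine IntegrableOn.mono_set ?_ hR
  exact (continuous_pe p).continuousOn.integrableOn_compact (isCompact_closedBall _ _)

lemma poly_T (hd : 0 < d) (hK : Ker d K CK) (hop : IsOpen D) (hb : Bornology.IsBounded D)
    (p : MvPolynomial (Fin d) ℝ) :
    ∃ g : EE d → ℝ, (∀ y, y ∉ D → g y = 0) ∧ ∀ y ∈ D, 
      Tendsto (fun ε => trunc D K (pe p) ε y) (𝓝[>] 0) (𝓝 (g y)) := by
  have : ∀ y, ∃ v : ℝ, (y ∉ D → v = 0) ∧ (y ∈ D → Tendsto (fun ε => trunc D K (pe p) ε y) (𝓝[>] 0) (𝓝 v)) := by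
    intro y
    by_cases hy : y ∈ D
    · obtain ⟨s, hs, hsub⟩ := Metric.nhds_basis_closedBall.mem_iff.1 (hop.mem_nhds hy)
      obtain ⟨Λ, hΛ⟩ := (contDiff_pe p).contDiffOn.exists_lipschitzOnWith (n := 1) (by simp) (convex_closedBall y s)
        (isCompact_closedBall y s)
      refine ⟨VV D K s (pe p) y, fun h => absurd hy h, fun _ => ?_⟩
      refine pv hd hK hop (integrableOn_pe_D hb p) (a := Λ) (β := 1) hs hsub (by positivity) one_pos ?_
      refine Eventually.of_forall fun x hx => ?_
      have := hΛ.dist_le_mul x hx y (mem_closedBall_self hs.le)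
      rw [Real.rpow_one]
      rwa [Real.dist_eq, dist_eq_norm, norm_sub_rev] at this
    · exact ⟨0, fun _ => rfl, fun h => absurd h hy⟩
  choose g hg using this
  exact ⟨g, fun y => (hg y).1, fun y => (hg y).2⟩

end ZT

namespace ZT
open MvPolynomial
variable {d n : ℕ} {ω : ℝ → ℝ} {q r Cω c r0 M Δ : ℝ} {D : Set (EE d)} {K : EE d → ℝ} {CK : ℝ}

lemma K_contDiffAt {Ω K : EE d → ℝ} (hΩ : IsCZDensity d ((n : ℕ∞) + 1) Ω)
    (hK : K = fun x => Ω x / ‖x‖ ^ d) {x : EE d} (hx : x ≠ 0) :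
    ContDiffAt ℝ ((n : WithTop ℕ∞) + 1) K x := by
  rw [hK]
  have h1 : ContDiffAt ℝ ((n : WithTop ℕ∞) + 1) Ω x :=
    hΩ.smooth.contDiffAt (isOpen_ne.mem_nhds hx)
  refine h1.div ?_ ?_
  · exact (contDiffAt_norm ℝ hx).pow d
  · have : 0 < ‖x‖ := norm_pos_iff.2 hx
    positivity

lemma multilin_expand (k : ℕ) (F : ContinuousMultilinearMap ℝ (fun _ : Fin k => EE d) ℝ) (v : EE d) :
    F (fun _ => v) = ∑ i : Fin k → Fin d, F (fun j => EuclideanSpace.single (i j) (1 : ℝ)) *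
      pe (∏ j, X (i j)) v := by
  have hv : v = ∑ i, v i • EuclideanSpace.single i (1 : ℝ) := by
    have := (EuclideanSpace.basisFun (Fin d) ℝ).sum_repr v
    simpa using this.symm
  conv_lhs => rw [hv]
  have h2 := F.map_sum (fun (_ : Fin k) (i : Fin d) => v i • EuclideanSpace.single i (1 : ℝ))
  rw [h2]
  refine Finset.sum_congr rfl fun i _ => ?_
  rw [F.map_smul_univ (fun j => v (i j)) (fun j => EuclideanSpace.single (i j) (1 : ℝ))]
  simp [pe, mul_comm]

lemma taylor_unit {Ω K : EE d → ℝ} (hΩ : IsCZDensity d ((n : ℕ∞) + 1) Ω)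
    (hK : K = fun x => Ω x / ‖x‖ ^ d) : ∃ C : ℝ, 0 ≤ C ∧ ∀ u v : EE d, ‖u‖ = 1 → ‖v‖ ≤ 1 / 2 →
    |K (u + v) - ∑ k ∈ Finset.range (n + 1), (k.factorial : ℝ)⁻¹ * (iteratedFDeriv ℝ k K u (fun _ => v))|
      ≤ C * ‖v‖ ^ (n + 1) := by
  have hcpt : IsCompact (closedBall (0 : EE d) (3 / 2) \ ball 0 (1 / 2)) :=
    (isCompact_closedBall _ _).diff isOpen_ball
  have hcont : ContinuousOn (iteratedFDeriv ℝ (n + 1) K) (closedBall (0 : EE d) (3 / 2) \ ball 0 (1 / 2)) := by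
    intro x hx
    have hx0 : x ≠ 0 := by
      rintro rfl
      exact hx.2 (by simp)
    exact ((K_contDiffAt hΩ hK hx0).continuousAt_iteratedFDeriv (by norm_cast)).continuousWithinAt
  obtain ⟨B, hB⟩ := hcpt.exists_bound_of_continuousOn hcont
  refine ⟨(n.factorial : ℝ)⁻¹ * max B 0, by positivity, fun u v hu hv => ?_⟩
  have hmem : ∀ t ∈ Icc (0 : ℝ) 1, u + t • v ∈ (closedBall (0 : EE d) (3 / 2) \ ball 0 (1 / 2)) := by
    intro t ht
    have h1 : ‖t • v‖ ≤ 1 / 2 := by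
      rw [norm_smul, Real.norm_of_nonneg ht.1]
      nlinarith [ht.2, norm_nonneg v]
    refine ⟨?_, ?_⟩
    · rw [mem_closedBall_zero_iff]
      linarith [norm_add_le u (t • v)]
    · rw [mem_ball_zero_iff, not_lt]
      have := norm_sub_norm_le u (-(t • v))
      rw [norm_neg, sub_neg_eq_add] at this
      linarith
  have hT := map_add_eq_sum_add_integral_iteratedFDeriv (f := K) (x := u) (y := v) (n := n) (by
    intro t ht
    have := hmem t ht
    have hx0 : u + t • v ≠ 0 := by
      intro h0
      rw [h0] at this
      exact this.2 (by simp)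
    exact K_contDiffAt hΩ hK hx0)
  simp only [smul_eq_mul] at hT
  rw [hT, add_sub_cancel_left, abs_mul, abs_of_nonneg (by positivity), mul_assoc]
  apply mul_le_mul_of_nonneg_left _ (by positivity)
  rw [← Real.norm_eq_abs]
  refine (intervalIntegral.norm_integral_le_of_norm_le_const (C := max B 0 * ‖v‖ ^ (n + 1)) ?_).trans (by simp)
  intro t ht
  rw [uIoc_of_le zero_le_one] at ht
  have h1 := hB _ (hmem t ⟨ht.1.le, ht.2⟩)
  have h2 := (iteratedFDeriv ℝ (n + 1) K (u + t • v)).le_opNorm (fun _ => v)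
  rw [Finset.prod_const, Finset.card_univ, Fintype.card_fin] at h2
  rw [norm_mul]
  have h3 : ‖(1 - t) ^ n‖ ≤ 1 := by
    rw [norm_pow]
    apply pow_le_one₀ (norm_nonneg _)
    rw [Real.norm_of_nonneg (by linarith [ht.2])]
    linarith [ht.1]
  calc _ ≤ 1 * (‖iteratedFDeriv ℝ (n + 1) K (u + t • v)‖ * ‖v‖ ^ (n + 1)) := by gcongr
    _ ≤ 1 * (max B 0 * ‖v‖ ^ (n + 1)) := by gcongr; exact h1.trans (le_max_left _ _)
    _ = _ := one_mul _

set_option maxHeartbeats 1000000 in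
lemma taylor {Ω K : EE d → ℝ} (hΩ : IsCZDensity d ((n : ℕ∞) + 1) Ω)
    (hK : K = fun x => Ω x / ‖x‖ ^ d) : 
    ∃ (ι : Type) (_ : Fintype ι) (m : ι → MvPolynomial (Fin d) ℝ) (c : ι → EE d → ℝ) (C : ℝ),
      0 ≤ C ∧ (∀ i, (m i).totalDegree ≤ n) ∧ (∀ i, ContinuousOn (c i) {0}ᶜ) ∧
      ∀ w v, w ≠ 0 → ‖v‖ ≤ ‖w‖ / 2 → 
        |K (w + v) - ∑ i, c i w * pe (m i) v| ≤ C * (‖v‖ / ‖w‖) ^ (n + 1) * ‖w‖ ^ (-(d : ℝ)) := by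
  obtain ⟨C, hC, H⟩ := taylor_unit hΩ hK
  refine ⟨Σ k : Fin (n + 1), (Fin k → Fin d), inferInstance, fun s => ∏ j, X (s.2 j),
    fun s w => ‖w‖ ^ (-(d : ℝ)) * (‖w‖⁻¹ ^ (s.1 : ℕ) * ((s.1 : ℕ).factorial : ℝ)⁻¹) * 
      iteratedFDeriv ℝ s.1 K (‖w‖⁻¹ • w) (fun j => EuclideanSpace.single (s.2 j) (1 : ℝ)), C, hC, ?_, ?_, ?_⟩
  · intro s
    refine (totalDegree_finset_prod _ _).trans ?_
    simp
    omega
  · intro s w hw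
    have hw0 : 0 < ‖w‖ := norm_pos_iff.2 hw
    have hu0 : ‖w‖⁻¹ • w ≠ 0 := smul_ne_zero (by positivity) hw
    have h1 : ContinuousAt (fun w : EE d => ‖w‖⁻¹ • w) w :=
      (continuousAt_id.norm.inv₀ hw0.ne').smul continuousAt_id
    have h2 : ContinuousAt (fun w : EE d => iteratedFDeriv ℝ s.1 K (‖w‖⁻¹ • w)) w := by
      refine ContinuousAt.comp (f := fun w : EE d => ‖w‖⁻¹ • w) (g := iteratedFDeriv ℝ s.1 K) ?_ h1
      have hs := s.1.2
      exact (K_contDiffAt hΩ hK hu0).continuousAt_iteratedFDeriv (by norm_cast; omega)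
    have h3 : ContinuousAt (fun w : EE d => iteratedFDeriv ℝ s.1 K (‖w‖⁻¹ • w) (fun j => EuclideanSpace.single (s.2 j) (1 : ℝ))) w := by
      have := (ContinuousMultilinearMap.apply ℝ (fun _ : Fin s.1 => EE d) ℝ (fun j => EuclideanSpace.single (s.2 j) (1 : ℝ))).continuous.continuousAt
        (x := iteratedFDeriv ℝ s.1 K (‖w‖⁻¹ • w))
      exact ContinuousAt.comp (f := fun w : EE d => iteratedFDeriv ℝ s.1 K (‖w‖⁻¹ • w)) this h2
    refine (ContinuousAt.mul (ContinuousAt.mul ?_ (ContinuousAt.mul ?_ continuousAt_const)) h3).continuousWithinAt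
    · exact continuousAt_id.norm.rpow_const (Or.inl hw0.ne')
    · exact (continuousAt_id.norm.inv₀ hw0.ne').pow _
  · intro w v hw hv
    have hw0 : 0 < ‖w‖ := norm_pos_iff.2 hw
    have hKs : K (w + v) = ‖w‖ ^ (-(d : ℝ)) * K (‖w‖⁻¹ • w + ‖w‖⁻¹ • v) := by
      rw [← smul_add, hK]
      simp only
      rw [hΩ.homog _ (by positivity), norm_smul, Real.norm_of_nonneg (by positivity), Real.rpow_neg hw0.le,
        Real.rpow_natCast, mul_pow, inv_pow]
      field_simp
    have hsum : ∑ s : (Σ k : Fin (n + 1), (Fin k → Fin d)), (‖w‖ ^ (-(d : ℝ)) * (‖w‖⁻¹ ^ (s.1 : ℕ) * ((s.1 : ℕ).factorial : ℝ)⁻¹) * 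
      iteratedFDeriv ℝ s.1 K (‖w‖⁻¹ • w) (fun j => EuclideanSpace.single (s.2 j) (1 : ℝ))) * pe (∏ j, X (s.2 j)) v
        = ‖w‖ ^ (-(d : ℝ)) * ∑ k ∈ Finset.range (n + 1), (k.factorial : ℝ)⁻¹ * (iteratedFDeriv ℝ k K (‖w‖⁻¹ • w) (fun _ => ‖w‖⁻¹ • v)) := by
      rw [Fintype.sum_sigma, Finset.sum_range, Finset.mul_sum]
      refine Finset.sum_congr rfl fun k _ => ?_
      have e := (iteratedFDeriv ℝ k K (‖w‖⁻¹ • w)).map_smul_univ (fun _ => ‖w‖⁻¹) (fun _ => v)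
      rw [e, multilin_expand]
      simp only [Finset.prod_const, Finset.card_univ, Fintype.card_fin, smul_eq_mul, Finset.mul_sum]
      refine Finset.sum_congr rfl fun i _ => ?_
      ring
    rw [hsum, hKs, ← mul_sub, abs_mul, abs_of_nonneg (by positivity), mul_comm]
    apply mul_le_mul_of_nonneg_right _ (by positivity)
    refine (H (‖w‖⁻¹ • w) (‖w‖⁻¹ • v) ?_ ?_).trans (le_of_eq ?_)
    · rw [norm_smul, Real.norm_of_nonneg (by positivity)]; field_simp
    · rw [norm_smul, Real.norm_of_nonneg (by positivity)]; field_simp; linarith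
    · rw [norm_smul, Real.norm_of_nonneg (by positivity)]; ring
end ZT

namespace ZT
open MvPolynomial
variable {d n : ℕ} {ω : ℝ → ℝ} {q r Cω c r0 M Δ : ℝ} {D : Set (EE d)} {K : EE d → ℝ} {CK : ℝ}

/-- pointwise kernel estimate -/
lemma far_pt (hK : Ker d K CK) {Ct : ℝ} (hCt : 0 ≤ Ct) {w v : EE d} {L Tx : ℝ} (hL : 0 < L)
    (hw : L / 8 < ‖w‖) (hv : ‖v‖ ≤ L / 16)
    (hT : |K (w + v) - Tx| ≤ Ct * (‖v‖ / ‖w‖) ^ (n + 1) * ‖w‖ ^ (-(d : ℝ))) :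
    |K (w + v) - Tx| ≤ (CK * 2 ^ (d : ℝ) + Ct) * ((L / ‖w‖) ^ (n + 1) * ‖w‖ ^ (-(d : ℝ))) ∧
    (‖w + v‖ ≤ L / 4 → |Tx| ≤ (CK * 2 ^ (d : ℝ) + Ct) * ((L / ‖w‖) ^ (n + 1) * ‖w‖ ^ (-(d : ℝ)))) := by
  have hw0 : 0 < ‖w‖ := by linarith
  have hC := hK.hC
  set A := (L / ‖w‖) ^ (n + 1) * ‖w‖ ^ (-(d : ℝ)) with hA
  have hA0 : 0 ≤ A := by positivity
  have h2 : (0 : ℝ) ≤ CK * 2 ^ (d : ℝ) := by positivity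
  have h1 : |K (w + v) - Tx| ≤ Ct * A := by
    refine hT.trans ?_
    have : ‖v‖ ≤ L := by linarith
    rw [mul_assoc, hA]
    gcongr
  refine ⟨by nlinarith, fun hle => ?_⟩
  have h3 : |K (w + v)| ≤ CK * 2 ^ (d : ℝ) * ‖w‖ ^ (-(d : ℝ)) := by
    have : ‖w‖ / 2 ≤ ‖w + v‖ := by
      have := norm_sub_norm_le w (-v)
      rw [norm_neg, sub_neg_eq_add] at this
      linarith
    refine (hK.bd_far (by positivity) this).trans (le_of_eq ?_)
    rw [Real.div_rpow (by positivity) (by norm_num), Real.rpow_neg (by norm_num : (0:ℝ) ≤ 2)]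
    field_simp
  have h4 : ‖w‖ ^ (-(d : ℝ)) ≤ A := by
    rw [hA]
    apply le_mul_of_one_le_left (by positivity)
    apply one_le_pow₀
    rw [one_le_div hw0]
    have := norm_sub_norm_le w (-v)
    rw [norm_neg, sub_neg_eq_add] at this
    linarith
  have h5 : CK * 2 ^ (d : ℝ) * ‖w‖ ^ (-(d : ℝ)) ≤ CK * 2 ^ (d : ℝ) * A := by gcongr
  have h6 : |Tx| ≤ |K (w + v)| + |K (w + v) - Tx| := by
    have := abs_sub (K (w + v)) (K (w + v) - Tx)
    rwa [sub_sub_cancel] at this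
  linarith

set_option maxHeartbeats 1000000 in
lemma far (hd : 0 < d) {Ω : EE d → ℝ} (hΩ : IsCZDensity d ((n : ℕ∞) + 1) Ω)
    (hKe : K = fun x => Ω x / ‖x‖ ^ d) (hK : Ker d K CK) (hop : IsOpen D)
    (hb : Bornology.IsBounded D) (hq0 : 0 < q) (hq : q < n + 1) :
    ∃ C : ℝ, 1 ≤ C ∧ ∀ (h : EE d → ℝ) (B L : ℝ) (x0 : EE d), IntegrableOn h D → 0 ≤ B → 0 < L →
    (∀ᵐ x, x ∈ D → |h x| ≤ B * (1 + ‖x - x0‖ / L) ^ q) →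
    ∃ S : MvPolynomial (Fin d) ℝ, S.totalDegree ≤ n ∧ ∀ y, ‖y - x0‖ ≤ L / 16 → 
      |(∫ x in D \ closedBall y (L / 4), h x * K (y - x)) - pe S y| ≤ C * B := by
  obtain ⟨ι, _, m, cc, Ct, hCt, hm, hcc, HT⟩ := taylor hΩ hKe
  set γ : ℝ := n + 1 - q with hγ
  have hγ0 : 0 < γ := by linarith
  have hC := hK.hC
  set C3 := CK * 2 ^ (d : ℝ) + Ct with hC3
  have hC30 : 0 ≤ C3 := by positivity
  have hvd := vd_nonneg d
  set CC := 9 ^ q * C3 * (vd d * (8 ^ γ / γ)) with hCC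
  refine ⟨max 1 CC, le_max_left _ _, fun h B L x0 hh hB hL hbd => ?_⟩
  set E := D \ closedBall x0 (L / 8) with hE
  have hEm : MeasurableSet E := hop.measurableSet.diff measurableSet_closedBall
  have hfar : ∀ x ∈ E, L / 8 < ‖x0 - x‖ := by
    intro x hx
    have := hx.2
    rwa [mem_closedBall, not_le, dist_eq_norm, norm_sub_rev] at this
  have hci : ∀ i, IntegrableOn (fun x => h x * cc i (x0 - x)) E := by
    intro i
    obtain ⟨R, hR⟩ := hb.subset_closedBall x0
    have hcpt : IsCompact (closedBall (0 : EE d) R \ ball 0 (L / 8)) :=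
      (isCompact_closedBall _ _).diff isOpen_ball
    obtain ⟨b, hbb⟩ := hcpt.exists_bound_of_continuousOn ((hcc i).mono (by
      intro x hx h0
      rw [mem_singleton_iff] at h0
      subst h0
      exact hx.2 (by simp [hL])))
    refine Integrable.mul_bdd (c := b) (hh.mono_set sdiff_subset) ?_ ?_
    · have : ContinuousOn (fun x => cc i (x0 - x)) E := by
        apply (hcc i).comp (by fun_prop)
        intro x hx
        have := hfar x hx
        have h0 : 0 < ‖x0 - x‖ := by linarith
        exact norm_pos_iff.1 h0
      exact this.aestronglyMeasurable hEm
    · filter_upwards [ae_restrict_mem hEm] with x hx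
      apply hbb
      refine ⟨?_, ?_⟩
      · have := hR hx.1
        rw [mem_closedBall, dist_eq_norm, norm_sub_rev] at this
        rw [mem_closedBall_zero_iff]
        exact this
      · have := hfar x hx
        rw [mem_ball_zero_iff]
        linarith
  set a : ι → ℝ := fun i => ∫ x in E, h x * cc i (x0 - x) with ha
  refine ⟨∑ i, a i • aff (-x0) 1 (m i), ?_, ?_⟩
  · apply (totalDegree_finset_sum _ _).trans
    apply Finset.sup_le
    intro i _
    exact (totalDegree_smul_le _ _).trans (totalDegree_aff _ _ (hm i))
  intro y hy
  have e1 : pe (∑ i, a i • aff (-x0) 1 (m i)) y = ∫ x in E, h x * ∑ i, cc i (x0 - x) * pe (m i) (y - x0) := by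
    rw [pe_sum]
    have : ∀ x, h x * ∑ i, cc i (x0 - x) * pe (m i) (y - x0) = ∑ i, (h x * cc i (x0 - x)) * pe (m i) (y - x0) := by
      intro x
      rw [Finset.mul_sum]
      exact Finset.sum_congr rfl fun i _ => by ring
    simp_rw [this]
    rw [integral_finset_sum _ (fun i _ => (hci i).mul_const _)]
    refine Finset.sum_congr rfl fun i _ => ?_
    rw [pe_smul, pe_aff, integral_mul_const]
    congr 2
    simp [sub_eq_add_neg, add_comm]
  have hsub : closedBall x0 (L / 8) ⊆ closedBall y (L / 4) := by
    apply closedBall_subset_closedBall'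
    rw [dist_comm, dist_eq_norm]
    linarith
  have e2 : ∫ x in D \ closedBall y (L / 4), h x * K (y - x) = 
      ∫ x in E, (closedBall y (L / 4))ᶜ.indicator (fun x => h x * K (y - x)) x := by
    rw [setIntegral_indicator measurableSet_closedBall.compl]
    congr 2
    ext x
    constructor
    · exact fun hx => ⟨⟨hx.1, fun h2 => hx.2 (hsub h2)⟩, hx.2⟩
    · exact fun hx => ⟨hx.1.1, hx.2⟩
  have hi1 : IntegrableOn ((closedBall y (L / 4))ᶜ.indicator (fun x => h x * K (y - x))) E := by
    have hmm : MeasurableSet (E ∩ (closedBall y (L / 4))ᶜ) := hEm.inter measurableSet_closedBall.compl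
    have := int_away hK (f := h) (S := E ∩ (closedBall y (L / 4))ᶜ) (y := y) (ε := L / 4) hmm
      (hh.mono_set (inter_subset_left.trans sdiff_subset)) (by positivity) (by
        intro x hx
        have := hx.2
        rw [mem_compl_iff, mem_closedBall, not_le, dist_eq_norm, norm_sub_rev] at this
        exact this.le)
    rw [IntegrableOn, integrable_indicator_iff measurableSet_closedBall.compl, IntegrableOn,
      Measure.restrict_restrict measurableSet_closedBall.compl, inter_comm]
    exact this
  have hi2 : IntegrableOn (fun x => h x * ∑ i, cc i (x0 - x) * pe (m i) (y - x0)) E := by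
    have : ∀ x, h x * ∑ i, cc i (x0 - x) * pe (m i) (y - x0) = ∑ i, (h x * cc i (x0 - x)) * pe (m i) (y - x0) := by
      intro x
      rw [Finset.mul_sum]
      exact Finset.sum_congr rfl fun i _ => by ring
    simp_rw [this]
    exact integrable_finset_sum _ (fun i _ => (hci i).mul_const _)
  rw [e1, e2, ← integral_sub hi1 hi2, ← Real.norm_eq_abs]
  obtain ⟨r1, r2⟩ := rad_out' hd hγ0 (show 0 < L / 8 by positivity) x0
  have hEs : E ⊆ (closedBall x0 (L / 8))ᶜ := fun x hx => hx.2
  have hbi : IntegrableOn (fun x => (B * (9 ^ q * C3) * L ^ γ) * ‖x0 - x‖ ^ (-γ - d)) E :=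
    (r1.mono_set hEs).const_mul _
  refine (norm_integral_le_of_norm_le hbi ?_).trans ?_
  · rw [ae_restrict_iff' hEm]
    filter_upwards [hbd] with x hx hxE
    have hw := hfar x hxE
    have hρ : 0 < ‖x0 - x‖ := by linarith
    have hyx : x0 - x + (y - x0) = y - x := by abel
    obtain ⟨p1, p2⟩ := far_pt (n := n) hK hCt (w := x0 - x) (v := y - x0) (Tx := ∑ i, cc i (x0 - x) * pe (m i) (y - x0)) hL hw hy
      (HT _ _ (norm_pos_iff.1 hρ) (by linarith))
    rw [hyx] at p1 p2
    set A := (L / ‖x0 - x‖) ^ (n + 1) * ‖x0 - x‖ ^ (-(d : ℝ)) with hA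
    have hh1 : |h x| ≤ B * (9 ^ q * (‖x0 - x‖ / L) ^ q) := by
      refine (hx hxE.1).trans ?_
      rw [← Real.mul_rpow (by norm_num) (by positivity), norm_sub_rev]
      gcongr
      have : 1 ≤ 8 * (‖x0 - x‖ / L) := by
        rw [← mul_div_assoc, one_le_div hL]
        linarith
      linarith
    have key : |h x| * (C3 * A) ≤ (B * (9 ^ q * C3) * L ^ γ) * ‖x0 - x‖ ^ (-γ - d) := by
      calc |h x| * (C3 * A) ≤ (B * (9 ^ q * (‖x0 - x‖ / L) ^ q)) * (C3 * A) := by gcongr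
        _ = (B * (9 ^ q * C3)) * (((‖x0 - x‖ / L) ^ q * (L / ‖x0 - x‖) ^ (n + 1)) * ‖x0 - x‖ ^ (-(d : ℝ))) := by
          rw [hA]; ring
        _ = (B * (9 ^ q * C3)) * ((L ^ γ * ‖x0 - x‖ ^ (-γ)) * ‖x0 - x‖ ^ (-(d : ℝ))) := by
          congr 2
          have e3 : (L / ‖x0 - x‖) ^ (n + 1) = L ^ ((n : ℝ) + 1) * ‖x0 - x‖ ^ (-((n : ℝ) + 1)) := by
            rw [← Real.rpow_natCast, Real.div_rpow hL.le hρ.le, Real.rpow_neg hρ.le]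
            push_cast
            rfl
          have e4 : (‖x0 - x‖ / L) ^ q = ‖x0 - x‖ ^ q * L ^ (-q) := by
            rw [Real.div_rpow hρ.le hL.le, Real.rpow_neg hL.le]
            rfl
          rw [e3, e4, hγ]
          have e5 : L ^ ((n : ℝ) + 1 - q) = L ^ ((n : ℝ) + 1) * L ^ (-q) := by
            rw [← Real.rpow_add hL]; rfl
          have e6 : ‖x0 - x‖ ^ (-((n : ℝ) + 1 - q)) = ‖x0 - x‖ ^ q * ‖x0 - x‖ ^ (-((n : ℝ) + 1)) := by
            rw [← Real.rpow_add hρ]; congr 1; ring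
          rw [e5, e6]
          ring
        _ = _ := by
          rw [sub_eq_add_neg (-γ), Real.rpow_add hρ]; ring
    refine le_trans ?_ key
    rw [Real.norm_eq_abs]
    by_cases hxy : x ∈ closedBall y (L / 4)
    · rw [indicator_of_notMem (by simpa using hxy), zero_sub, abs_neg, abs_mul]
      gcongr
      apply p2
      rwa [mem_closedBall, dist_eq_norm, norm_sub_rev] at hxy
    · rw [indicator_of_mem (by simpa using hxy), ← mul_sub, abs_mul]
      gcongr
  · rw [integral_const_mul]
    have : ∫ x in E, ‖x0 - x‖ ^ (-γ - d) ≤ vd d * ((L / 8) ^ (-γ) / γ) := by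
      rw [← r2]
      apply setIntegral_mono_set r1 _ hEs.eventuallyLE
      exact Eventually.of_forall fun x => by positivity
    calc (B * (9 ^ q * C3) * L ^ γ) * ∫ x in E, ‖x0 - x‖ ^ (-γ - d) 
        ≤ (B * (9 ^ q * C3) * L ^ γ) * (vd d * ((L / 8) ^ (-γ) / γ)) := by gcongr
      _ = CC * B := by
        rw [Real.div_rpow hL.le (by norm_num), Real.rpow_neg hL.le, Real.rpow_neg (by norm_num : (0:ℝ) ≤ 8), hCC]
        field_simp
      _ ≤ _ := by gcongr; exact le_max_right _ _
end ZT

namespace ZT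
open MvPolynomial
variable {d n : ℕ} {ω : ℝ → ℝ} {q r Cω c r0 M Δ : ℝ} {D : Set (EE d)} {K : EE d → ℝ} {CK : ℝ}

/-- a.e. principal value relation -/
def RT (D : Set (EE d)) (K f g : EE d → ℝ) : Prop :=
  ∀ᵐ y, y ∈ D → Tendsto (fun ε => trunc D K f ε y) (𝓝[>] 0) (𝓝 (g y))

lemma rt_iff (hop : IsOpen D) {f g : EE d → ℝ} :
    IsRestrictedCZ D K f g ↔ (∀ y, y ∉ D → g y = 0) ∧ RT D K f g := by
  unfold IsRestrictedCZ RT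
  rw [ae_restrict_iff' hop.measurableSet]
  rfl

lemma RT.lin (hK : Ker d K CK) (hop : IsOpen D) {f1 f2 g1 g2 : EE d → ℝ} (h1 : RT D K f1 g1)
    (h2 : RT D K f2 g2) (hf1 : IntegrableOn f1 D) (hf2 : IntegrableOn f2 D) (a : ℝ) :
    RT D K (fun x => f1 x + a * f2 x) (fun x => g1 x + a * g2 x) := by
  filter_upwards [h1, h2] with y i1 i2 hy
  refine ((i1 hy).add ((i2 hy).const_mul a)).congr' ?_
  filter_upwards [self_mem_nhdsWithin] with ε hε
  rw [trunc_add hK hop hf1 (hf2.const_mul a) hε, trunc_smul]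

lemma RT.unique {f g1 g2 : EE d → ℝ} (h1 : RT D K f g1) (h2 : RT D K f g2) :
    ∀ᵐ y, y ∈ D → g1 y = g2 y := by
  filter_upwards [h1, h2] with y i1 i2 hy
  exact tendsto_nhds_unique (i1 hy) (i2 hy)

lemma Ap.add {B1 B2 : ℝ} {f1 f2 : EE d → ℝ} {p1 p2 : MvPolynomial (Fin d) ℝ} {x : EE d} {l : ℝ}
    (hl : 0 ≤ l)
    (h1 : Ap ω n B1 f1 p1 x l) (h2 : Ap ω n B2 f2 p2 x l) :
    Ap ω n (B1 + B2) (fun y => f1 y + f2 y) (p1 + p2) x l := by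
  refine ⟨(totalDegree_add _ _).trans (max_le h1.1 h2.1), h1.2.1.add h2.2.1, ?_⟩
  have i1 := (h1.2.1.sub (integrableOn_pe p1 x hl)).abs
  have i2 := (h2.2.1.sub (integrableOn_pe p2 x hl)).abs
  calc ∫ y in cube x l, |f1 y + f2 y - pe (p1 + p2) y| 
      ≤ ∫ y in cube x l, (|f1 y - pe p1 y| + |f2 y - pe p2 y|) := by
        apply integral_mono_of_nonneg (Eventually.of_forall fun _ => abs_nonneg _) (i1.add i2)
        refine Eventually.of_forall fun y => ?_
        have := abs_add_le (f1 y - pe p1 y) (f2 y - pe p2 y)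
        refine le_trans (le_of_eq ?_) this
        show |f1 y + f2 y - pe (p1 + p2) y| = _
        rw [pe_add]; congr 1; ring
    _ = (∫ y in cube x l, |f1 y - pe p1 y|) + ∫ y in cube x l, |f2 y - pe p2 y| := integral_add i1 i2
    _ ≤ _ := by have := h1.2.2; have := h2.2.2; linarith

lemma Ap.smul {B1 : ℝ} {f1 : EE d → ℝ} {p1 : MvPolynomial (Fin d) ℝ} {x : EE d} {l : ℝ} (a : ℝ)
    (h1 : Ap ω n B1 f1 p1 x l) :
    Ap ω n (|a| * B1) (fun y => a * f1 y) (a • p1) x l := by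
  refine ⟨(totalDegree_smul_le _ _).trans h1.1, h1.2.1.const_mul a, ?_⟩
  have : ∀ y, |a * f1 y - pe (a • p1) y| = |a| * |f1 y - pe p1 y| := by
    intro y
    rw [pe_smul, ← mul_sub, abs_mul]
  simp_rw [this]
  rw [integral_const_mul]
  have := mul_le_mul_of_nonneg_left h1.2.2 (abs_nonneg a)
  linarith

lemma Ap.congr {B1 : ℝ} {f1 f2 : EE d → ℝ} {p1 : MvPolynomial (Fin d) ℝ} {x : EE d} {l : ℝ}
    (h1 : Ap ω n B1 f1 p1 x l) (h : ∀ᵐ y, y ∈ cube x l → f1 y = f2 y) : Ap ω n B1 f2 p1 x l := by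
  have h' : f1 =ᵐ[volume.restrict (cube x l)] f2 := by
    rw [EventuallyEq, ae_restrict_iff' (measurableSet_cube x l)]; exact h
  refine ⟨h1.1, (integrable_congr h').1 h1.2.1, ?_⟩
  rw [← integral_congr_ae (f := fun y => |f1 y - pe p1 y|)]
  · exact h1.2.2
  · filter_upwards [h'] with y hy
    rw [hy]

lemma Ap.mono {B1 B2 : ℝ} {f1 : EE d → ℝ} {p1 : MvPolynomial (Fin d) ℝ} {x : EE d} {l : ℝ}
    (h1 : Ap ω n B1 f1 p1 x l) (hw : 0 ≤ ω l) (hl : 0 ≤ l) (h : B1 ≤ B2) : Ap ω n B2 f1 p1 x l := by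
  refine ⟨h1.1, h1.2.1, h1.2.2.trans ?_⟩
  gcongr

lemma Ap.sum {ι : Type*} (s : Finset ι) {x : EE d} {l : ℝ} (hl : 0 ≤ l) (B a : ι → ℝ)
    (f : ι → EE d → ℝ) (h : ∀ i ∈ s, ∃ p, Ap ω n (B i) (f i) p x l) :
    ∃ p, Ap ω n (∑ i ∈ s, |a i| * B i) (fun y => ∑ i ∈ s, a i * f i y) p x l := by
  classical
  induction s using Finset.induction_on with
  | empty => exact ⟨0, by simp, by simp, by simp⟩
  | insert i s hi ih =>
    obtain ⟨p, hp⟩ := ih fun j hj => h j (Finset.mem_insert_of_mem hj)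
    obtain ⟨p', hp'⟩ := h i (Finset.mem_insert_self _ _)
    refine ⟨a i • p' + p, ?_⟩
    simp_rw [Finset.sum_insert hi]
    exact (hp'.smul (a i)).add hl hp

/-- integrals versus lower integrals -/
lemma lint_eq {F : EE d → ℝ} {S : Set (EE d)} (hF : IntegrableOn F S) :
    ∫⁻ x in S, ENNReal.ofReal |F x| = ENNReal.ofReal (∫ x in S, |F x|) := by
  rw [ofReal_integral_eq_lintegral_ofReal hF.abs (Eventually.of_forall fun _ => abs_nonneg _)]

lemma locInt_cube {g : EE d → ℝ} (hg : LocallyIntegrableOn g D) {x : EE d} {l : ℝ} (hl : 0 ≤ l)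
    (hs : cube x l ⊆ D) : IntegrableOn g (cube x l) :=
  (hg.mono_set hs).integrableOn_isCompact (isCompact_cube x l hl)

/-- from the seminorm to `Ap` -/
lemma ap_of_zyg (hpos : ∀ t, 0 < t → 0 < ω t) {g : EE d → ℝ} (hg : LocallyIntegrableOn g D) {N : ℝ}
    (hN : zygSeminorm ω n D g < ENNReal.ofReal N) (x : EE d) (l : ℝ) (hl : 0 < l)
    (hs : cube x l ⊆ D) : ∃ p, Ap ω n N g p x l := by
  have hN0 : 0 < N := by
    by_contra hcon
    rw [ENNReal.ofReal_of_nonpos (not_lt.1 hcon)] at hN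
    exact not_lt_zero hN
  have h1 := lt_of_le_of_lt (le_iSup₂_of_le (f := fun (x₀ : EE d) (l : ℝ) => 
    ⨆ (_ : 0 < l) (_ : cube x₀ l ⊆ D),
    ⨅ (P : EuclideanSpace ℝ (Fin d) → ℝ) (_ : P ∈ PolyLE d n),
      (ENNReal.ofReal (ω l * l ^ d))⁻¹ * ∫⁻ x in cube x₀ l, ENNReal.ofReal |g x - P x|) x l
    (le_iSup₂_of_le hl hs le_rfl)) hN
  simp only [iInf_lt_iff] at h1
  obtain ⟨P, hP, h1⟩ := h1
  obtain ⟨p, hp, rfl⟩ := mem_polyLE.1 hP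
  have hgi := locInt_cube hg hl.le hs
  refine ⟨p, hp, hgi, ?_⟩
  rw [lint_eq (F := fun y => g y - pe p y) (hgi.sub (integrableOn_pe p x hl.le)),
    ← ENNReal.ofReal_inv_of_pos (mul_pos (hpos l hl) (by positivity)),
    ← ENNReal.ofReal_mul (inv_nonneg.2 (mul_pos (hpos l hl) (by positivity)).le)] at h1
  have h2 := (ENNReal.ofReal_lt_ofReal_iff hN0).1 h1
  rw [inv_mul_lt_iff₀ (mul_pos (hpos l hl) (by positivity))] at h2
  linarith

/-- from `Ap` to the seminorm -/
lemma zyg_of_ap (hpos : ∀ t, 0 < t → 0 < ω t) {g : EE d → ℝ} {N : ℝ}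
    (h : ∀ x l, 0 < l → cube x l ⊆ D → ∃ p, Ap ω n N g p x l) :
    zygSeminorm ω n D g ≤ ENNReal.ofReal N := by
  unfold zygSeminorm
  refine iSup₂_le fun x l => iSup₂_le fun hl hs => ?_
  obtain ⟨p, hp, hgi, hi⟩ := h x l hl hs
  refine iInf₂_le_of_le (pe p) (pe_mem hp) ?_
  have hpp : 0 < ω l * l ^ d := mul_pos (hpos l hl) (by positivity)
  rw [lint_eq (F := fun y => g y - pe p y) (hgi.sub (integrableOn_pe p x hl.le)),
    ← ENNReal.ofReal_inv_of_pos hpp, ← ENNReal.ofReal_mul (inv_nonneg.2 hpp.le)]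
  apply ENNReal.ofReal_le_ofReal
  rw [inv_mul_le_iff₀ hpp]
  linarith

/-- measurability of the limit -/
lemma RT.meas (hK : Ker d K CK) (hop : IsOpen D) {f g : EE d → ℝ} (h : RT D K f g)
    (hf : IntegrableOn f D) : AEStronglyMeasurable g (volume.restrict D) := by
  have hm := hf.aestronglyMeasurable
  obtain ⟨f', hf', hff⟩ := hm
  have key : ∀ ε : ℝ, AEStronglyMeasurable (fun y => trunc D K f ε y) (volume.restrict D) := by
    intro ε
    have e : (fun y => trunc D K f ε y) = fun y => ∫ x in D, 
        {z : EE d × EE d | ε < dist z.1 z.2}.indicator (fun z => f' z.2 * K (z.1 - z.2)) (y, x) := by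
      funext y
      have hS : MeasurableSet {x : EE d | ε < dist y x} := by
        apply measurableSet_lt <;> fun_prop
      have : ∀ x, {z : EE d × EE d | ε < dist z.1 z.2}.indicator (fun z => f' z.2 * K (z.1 - z.2)) (y, x) =
          {x : EE d | ε < dist y x}.indicator (fun x => f' x * K (y - x)) x := by
        intro x
        simp [Set.indicator]
      simp_rw [this]
      rw [setIntegral_indicator hS, trunc]
      apply integral_congr_ae
      have hsub : {x | x ∈ D ∧ ε < dist y x} ⊆ D := fun x hx => hx.1
      filter_upwards [ae_restrict_of_ae_restrict_of_subset hsub hff] with x hx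
      rw [hx]
    rw [e]
    apply StronglyMeasurable.aestronglyMeasurable
    have hS : MeasurableSet {z : EE d × EE d | ε < dist z.1 z.2} := by
      apply measurableSet_lt <;> fun_prop
    have hF : StronglyMeasurable ({z : EE d × EE d | ε < dist z.1 z.2}.indicator 
        (fun z : EE d × EE d => f' z.2 * K (z.1 - z.2))) := by
      apply StronglyMeasurable.indicator _ hS
      have h1 : Measurable (fun z : EE d × EE d => f' z.2) := hf'.measurable.comp measurable_snd
      have h2 : Measurable (fun z : EE d × EE d => K (z.1 - z.2)) := hK.meas.comp (by fun_prop)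
      exact (h1.mul h2).stronglyMeasurable
    exact hF.integral_prod_right'
  have ht : Tendsto (fun k : ℕ => 1 / ((k : ℝ) + 1)) atTop (𝓝[>] 0) := by
    rw [tendsto_nhdsWithin_iff]
    exact ⟨tendsto_one_div_add_atTop_nhds_zero_nat, Eventually.of_forall fun k => by
      show (0:ℝ) < _
      positivity⟩
  refine aestronglyMeasurable_of_tendsto_ae atTop (fun k : ℕ => key (1 / ((k : ℝ) + 1))) ?_
  rw [ae_restrict_iff' hop.measurableSet]
  filter_upwards [h] with y hy hyD
  exact (hy hyD).comp ht
end ZT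

namespace ZT
open MvPolynomial
variable {d n : ℕ} {ω : ℝ → ℝ} {q r Cω c r0 M Δ : ℝ} {D : Set (EE d)} {K : EE d → ℝ} {CK : ℝ}

/-- real-variable form of hypothesis (i) -/
def HI (ω : ℝ → ℝ) (n : ℕ) (D : Set (EE d)) (K : EE d → ℝ) : Prop :=
  ∀ p : MvPolynomial (Fin d) ℝ, p.totalDegree ≤ n → ∀ g : EE d → ℝ, (∀ y, y ∉ D → g y = 0) →
    RT D K (pe p) g → LocallyIntegrableOn g D ∧ ∃ N : ℝ, 0 ≤ N ∧ ∀ x l, 0 < l → cube x l ⊆ D → 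
      ∃ p, Ap ω n N g p x l

/-- real-variable form of hypothesis (ii) -/
def HII (ω : ℝ → ℝ) (n : ℕ) (D : Set (EE d)) (K : EE d → ℝ) : Prop :=
  ∃ C : ℝ, 1 ≤ C ∧ ∀ (x0 : EE d) (l : ℝ) (p : MvPolynomial (Fin d) ℝ) (g : EE d → ℝ) (B : ℝ),
    0 < l → cube x0 l ⊆ D → p.IsHomogeneous n → (∀ y, y ∉ D → g y = 0) →
    RT D K (fun x => pe p (x - x0)) g → 0 ≤ B → (∀ x ∈ D, |pe p (x - x0)| ≤ B * max 1 (xi ω n l)) →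
    ∃ S, Ap ω n (C * B) g S x0 l

lemma hi_real (hop : IsOpen D) (hpos : ∀ t, 0 < t → 0 < ω t)
    (hi : ∀ P ∈ PolyLE d n, ∀ g : EuclideanSpace ℝ (Fin d) → ℝ,
      IsRestrictedCZ D K P g →
        LocallyIntegrableOn g D ∧ zygSeminorm ω n D g < ⊤) : HI ω n D K := by
  intro p hp g hg h
  obtain ⟨h1, h2⟩ := hi (pe p) (pe_mem hp) g ((rt_iff hop).2 ⟨hg, h⟩)
  refine ⟨h1, (zygSeminorm ω n D g).toReal + 1, by positivity, ?_⟩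
  apply ap_of_zyg hpos h1
  rw [ENNReal.lt_ofReal_iff_toReal_lt h2.ne]
  linarith

lemma shift_pe (x0 : EE d) (p : MvPolynomial (Fin d) ℝ) : 
    (fun x => pe p (x - x0)) = pe (aff (-x0) 1 p) := by
  funext x
  rw [pe_aff, one_smul, neg_add_eq_sub]

lemma hii_real (hop : IsOpen D) (hω : MD ω n q r Cω) (hI : HI ω n D K)
    (hii : ∃ C : ℝ, 0 < C ∧
      ∀ (x₀ : EuclideanSpace ℝ (Fin d)) (l : ℝ), 0 < l → cube x₀ l ⊆ D →
        ∀ P : EuclideanSpace ℝ (Fin d) → ℝ,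
          (∃ p : MvPolynomial (Fin d) ℝ, p.IsHomogeneous n ∧
            ∀ x, P x = MvPolynomial.eval (fun i => x i - x₀ i) p) →
          ∀ g : EuclideanSpace ℝ (Fin d) → ℝ, IsRestrictedCZ D K P g →
            ∃ S ∈ PolyLE d n,
              (ENNReal.ofReal (l ^ d))⁻¹ *
                  ∫⁻ x in cube x₀ l, ENNReal.ofReal |g x - S x| ≤
                ENNReal.ofReal (C * sSup ((fun x => |P x|) '' D) * omegaTilde ω n l)) :
    HII ω n D K := by
  obtain ⟨C, hC, H⟩ := hii
  refine ⟨max 1 C, le_max_left _ _, fun x0 l p g B hl hs hp hg h hB hbd => ?_⟩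
  obtain ⟨S, hS, hle⟩ := H x0 l hl hs (fun x => pe p (x - x0)) ⟨p, hp, fun x => rfl⟩ g
    ((rt_iff hop).2 ⟨hg, h⟩)
  obtain ⟨s, hs', rfl⟩ := mem_polyLE.1 hS
  have hgl : LocallyIntegrableOn g D := by
    refine (hI (aff (-x0) 1 p) (totalDegree_aff _ _ hp.totalDegree_le) g hg ?_).1
    rw [← shift_pe]
    exact h
  have hgi := locInt_cube hgl hl.le hs
  refine ⟨s, hs', hgi, ?_⟩
  have hld : (0 : ℝ) < l ^ d := by positivity
  have hmx : 0 < max 1 (xi ω n l) := lt_of_lt_of_le one_pos (le_max_left _ _)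
  have hsup : sSup ((fun x => |pe p (x - x0)|) '' D) ≤ B * max 1 (xi ω n l) := by
    apply csSup_le ⟨_, mem_image_of_mem _ (hs (mem_cube_self x0 hl.le))⟩
    rintro _ ⟨x, hx, rfl⟩
    exact hbd x hx
  have hwl := hω.pos l hl
  have hrhs : C * sSup ((fun x => |pe p (x - x0)|) '' D) * omegaTilde ω n l ≤ max 1 C * B * ω l := by
    unfold omegaTilde
    calc C * sSup ((fun x => |pe p (x - x0)|) '' D) * (ω l / max 1 (xi ω n l)) 
        ≤ C * (B * max 1 (xi ω n l)) * (ω l / max 1 (xi ω n l)) := by gcongr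
      _ = C * B * ω l := by field_simp
      _ ≤ _ := by gcongr; exact le_max_right _ _
  rw [lint_eq (F := fun y => g y - pe s y) (hgi.sub (integrableOn_pe s x0 hl.le)),
    ← ENNReal.ofReal_inv_of_pos hld, ← ENNReal.ofReal_mul (inv_nonneg.2 hld.le)] at hle
  have h2 := hle.trans (ENNReal.ofReal_le_ofReal hrhs)
  rw [ENNReal.ofReal_le_ofReal_iff (by positivity), inv_mul_le_iff₀ hld] at h2
  linarith

lemma poly_expand {p : MvPolynomial (Fin d) ℝ} (hp : p.totalDegree ≤ n) (x0 : EE d) :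
    p = ∑ a ∈ multi d n, coeff a (aff x0 1 p) • aff (-x0) 1 (monomial a 1) := by
  apply pe_ext
  intro x
  rw [pe_eq_recenter p x0, pe_sum]
  set P := aff x0 1 p with hP
  have hPd : P.totalDegree ≤ n := totalDegree_aff _ _ hp
  have h1 : P = ∑ a ∈ multi d n, coeff a P • monomial a (1 : ℝ) := by
    conv_lhs => rw [P.as_sum]
    rw [Finset.sum_subset (support_subset_multi hPd)]
    · refine Finset.sum_congr rfl fun a _ => ?_
      rw [smul_monomial, smul_eq_mul, mul_one]
    · intro a _ ha
      rw [notMem_support_iff.1 ha, monomial_zero]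
  conv_lhs => rw [h1]
  rw [pe_sum]
  refine Finset.sum_congr rfl fun a _ => ?_
  rw [pe_smul, pe_smul, pe_aff, one_smul, neg_add_eq_sub]

lemma RT.sum (hK : Ker d K CK) (hop : IsOpen D) {ι : Type*} (s : Finset ι) (a : ι → ℝ)
    (f g : ι → EE d → ℝ) (h : ∀ i, RT D K (f i) (g i)) (hf : ∀ i, IntegrableOn (f i) D) :
    RT D K (fun x => ∑ i ∈ s, a i * f i x) (fun x => ∑ i ∈ s, a i * g i x) := by
  classical
  induction s using Finset.induction_on with
  | empty =>
    refine Eventually.of_forall fun y _ => ?_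
    simp [trunc]
  | insert i s hi ih =>
    have := RT.lin hK hop ih (h i) (integrable_finset_sum _ fun j _ => (hf j).const_mul (a j)) (hf i) (a i)
    simp_rw [Finset.sum_insert hi, add_comm (a i * _)]
    exact this

lemma low_part (hd : 0 < d) (hK : Ker d K CK) (hop : IsOpen D) (hne : D.Nonempty)
    (hb : Bornology.IsBounded D) (hω : MD ω n q r Cω) (hI : HI ω n D K) :
    ∃ C : ℝ, 1 ≤ C ∧ ∀ (p : MvPolynomial (Fin d) ℝ) (B : ℝ) (g : EE d → ℝ), p.totalDegree ≤ n → 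
    0 ≤ B → (∀ x ∈ D, |pe p x| ≤ B) → RT D K (pe p) g → 
    ∀ x l, 0 < l → cube x l ⊆ D → ∃ S, Ap ω n (C * B) g S x l := by
  obtain ⟨xs, hxs⟩ := hne
  obtain ⟨ls, hls, hsub⟩ : ∃ ls : ℝ, 0 < ls ∧ cube xs ls ⊆ D := by
    obtain ⟨ε, hε, hh⟩ := Metric.isOpen_iff.1 hop xs hxs
    refine ⟨ε / (2 * (d + 1)), by positivity, fun y hy => hh ?_⟩
    have := norm_sub_le_of_mem_cube (by positivity) hy
    rw [mem_ball, dist_eq_norm]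
    refine this.trans_lt ?_
    rw [← mul_div_assoc, div_lt_iff₀ (by positivity)]
    nlinarith
  have hT := fun a : Fin d →₀ ℕ => poly_T hd hK hop hb (aff (-xs) 1 (monomial a (1 : ℝ)))
  choose G hG0 hG using hT
  have hN : ∀ a : Fin d →₀ ℕ, ∃ N : ℝ, 0 ≤ N ∧ (a ∈ multi d n → ∀ x l, 0 < l → cube x l ⊆ D → 
      ∃ p, Ap ω n N (G a) p x l) := by
    intro a
    by_cases ha : a ∈ multi d n
    · have hdeg : (monomial a (1 : ℝ)).totalDegree ≤ n := by
        rw [totalDegree_monomial _ one_ne_zero]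
        exact mem_multi.1 ha
      obtain ⟨_, N, hN, h⟩ := hI _ (totalDegree_aff (-xs) 1 hdeg) (G a) (hG0 a) (Eventually.of_forall (hG a))
      exact ⟨N, hN, fun _ => h⟩
    · exact ⟨0, le_rfl, fun h => absurd h ha⟩
  choose N hN0 hN using hN
  obtain ⟨C, hC, hco⟩ := coeff_bound d n
  set CC := ∑ a ∈ multi d n, C * (ls ^ a.degree)⁻¹ * N a with hCC
  refine ⟨max 1 CC, le_max_left _ _, fun p B g hp hB hbd hg x l hl hs => ?_⟩
  have hcoe : ∀ a, |coeff a (aff xs 1 p)| ≤ C * (ls ^ a.degree)⁻¹ * B := by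
    intro a
    refine (hco p hp xs ls hls a).trans ?_
    gcongr
    exact avg_le_of_ae hls hB (Eventually.of_forall fun x hx => hbd x (hsub hx))
  have hR := RT.sum hK hop (multi d n) (fun a => coeff a (aff xs 1 p)) 
    (fun a => pe (aff (-xs) 1 (monomial a (1 : ℝ)))) G (fun a => Eventually.of_forall (hG a))
    (fun a => integrableOn_pe_D hb _)
  have e : (fun x => ∑ a ∈ multi d n, coeff a (aff xs 1 p) * pe (aff (-xs) 1 (monomial a (1 : ℝ))) x) = pe p := by
    funext x
    conv_rhs => rw [poly_expand hp xs]
    rw [pe_sum]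
    simp_rw [pe_smul]
  rw [e] at hR
  obtain ⟨S, hS⟩ := Ap.sum (ω := ω) (n := n) (multi d n) hl.le N (fun a => coeff a (aff xs 1 p)) G 
    (fun a ha => hN a ha x l hl hs)
  refine ⟨S, (hS.congr ?_).mono (hω.pos l hl).le hl.le ?_⟩
  · filter_upwards [hR.unique hg] with y hy hyc
    exact hy (hs hyc)
  · calc ∑ a ∈ multi d n, |coeff a (aff xs 1 p)| * N a 
        ≤ ∑ a ∈ multi d n, (C * (ls ^ a.degree)⁻¹ * B) * N a := by
          gcongr with a ha
          · exact hN0 a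
          · exact hcoe a
      _ = CC * B := by
          rw [hCC, Finset.sum_mul]
          exact Finset.sum_congr rfl fun a _ => by ring
      _ ≤ _ := by gcongr; exact le_max_right _ _
end ZT

namespace ZT
open MvPolynomial
variable {d n : ℕ} {ω : ℝ → ℝ} {q r Cω c r0 M Δ : ℝ} {D : Set (EE d)} {K : EE d → ℝ} {CK : ℝ}

lemma poly_part (h : Ctx ω n q r Cω D c r0 M Δ) (hd : 0 < d) (hK : Ker d K CK) (hne : D.Nonempty)
    (hb : Bornology.IsBounded D) (hI : HI ω n D K) (hII : HII ω n D K) :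
    ∃ C κ : ℝ, 1 ≤ C ∧ 0 < κ ∧ ∀ f N, Fn ω n D f N → 
    ∀ (x0 : EE d) (L ρ : ℝ) (p : MvPolynomial (Fin d) ℝ) (gp : EE d → ℝ), 0 < L → L ≤ c * r0 → 
    cube x0 L ⊆ D → Ap ω n N f p x0 L → 0 < ρ → ρ ≤ κ * L → cube x0 ρ ⊆ D → 
    RT D K (pe p) gp → ∃ S, Ap ω n (C * N) gp S x0 ρ := by
  obtain ⟨Cb, κ, hCb, hκ, Hb⟩ := growth_bc h
  obtain ⟨Cl, hCl, Hl⟩ := low_part hd hK h.op hne hb h.md hI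
  obtain ⟨Ct, hCt, Ht⟩ := hII
  refine ⟨Ct * Cb + Cl * Cb, κ, by nlinarith, hκ, fun f N hf x0 L ρ p gp hL hLr hs hp hρ hρκ hs2 hgp => ?_⟩
  have hN := hf.hN
  have hbd := fun x hx => Hb f N hf x0 L ρ p hL hLr hs hp hρ hρκ x hx
  obtain ⟨gt, ht0, ht⟩ := poly_T hd hK h.op hb (aff (-x0) 1 (top n x0 p))
  obtain ⟨gl, hl0, hl⟩ := poly_T hd hK h.op hb (low n x0 p)
  obtain ⟨S1, hS1⟩ := Ht x0 ρ (top n x0 p) gt (Cb * N) hρ hs2 (top_hom _ _ _) ht0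
    (by rw [shift_pe]; exact Eventually.of_forall ht) (by positivity) (fun x hx => (hbd x hx).1)
  obtain ⟨S2, hS2⟩ := Hl (low n x0 p) (Cb * N) gl (low_deg _ hp.1) (by positivity)
    (fun x hx => (hbd x hx).2) (Eventually.of_forall hl) x0 ρ hρ hs2
  have hR := RT.lin hK h.op (f1 := pe (aff (-x0) 1 (top n x0 p))) (f2 := pe (low n x0 p)) (g1 := gt) (g2 := gl)
    (Eventually.of_forall ht) (Eventually.of_forall hl) (integrableOn_pe_D hb _) (integrableOn_pe_D hb _) 1
  have e : (fun x => pe (aff (-x0) 1 (top n x0 p)) x + 1 * pe (low n x0 p) x) = pe p := by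
    funext x
    rw [pe_split n x0 p x, ← shift_pe, one_mul]
  rw [e] at hR
  refine ⟨S1 + S2, ((hS1.add hρ.le hS2).congr ?_).mono (h.md.pos ρ hρ).le hρ.le (by linarith)⟩
  filter_upwards [hR.unique hgp] with y hy hyc
  rw [← hy (hs2 hyc), one_mul]

set_option maxHeartbeats 1000000 in
lemma osc_part (h : Ctx ω n q r Cω D c r0 M Δ) (hd : 0 < d) {Ω : EE d → ℝ}
    (hΩ : IsCZDensity d ((n : ℕ∞) + 1) Ω)
    (hKe : K = fun x => Ω x / ‖x‖ ^ d) (hK : Ker d K CK) 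
    (hb : Bornology.IsBounded D) :
    ∃ C : ℝ, 1 ≤ C ∧ ∀ f N, Fn ω n D f N → 
    ∀ (x0 : EE d) (L : ℝ) (p : MvPolynomial (Fin d) ℝ) (G : EE d → ℝ), 0 < L → L ≤ c * r0 → 
    cube x0 L ⊆ D → Ap ω n N f p x0 L → 
    RT D K (fun x => f x + (-1) * pe p x) G → 
    ∃ S : MvPolynomial (Fin d) ℝ, S.totalDegree ≤ n ∧ ∀ᵐ y, ‖y - x0‖ ≤ L / 16 → 
      |G y - pe S y| ≤ C * N * ω L := by
  obtain ⟨Ca, hCa, Ha⟩ := growth_a h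
  obtain ⟨Ch, β, hCh, hβ, hβ1, Hh⟩ := holder_near h
  obtain ⟨Cf, hCf, Hf⟩ := far hd hΩ hKe hK h.op hb h.md.q_pos h.md.hq1
  have hvd := vd_nonneg d
  have hCK := hK.hC
  refine ⟨Cf * Ca + Ch * CK * (vd d * ((1 / 4) ^ β / β)), ?_, ?_⟩
  · have : 0 ≤ Ch * CK * (vd d * ((1 / 4) ^ β / β)) := by positivity
    nlinarith
  intro f N hf x0 L p G hL hLr hs hp hG
  have hN := hf.hN
  have hwL := h.md.pos L hL
  have hhi : IntegrableOn (fun x => f x + (-1) * pe p x) D := hf.int.add ((integrableOn_pe_D hb p).const_mul _)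
  have hleb := ae_lebPt h.op hf.int.locallyIntegrableOn
  obtain ⟨S, hS, HS⟩ := Hf (fun x => f x + (-1) * pe p x) (Ca * N * ω L) L x0 hhi (by positivity) hL (by
    filter_upwards [hleb] with x hx hxD
    have := Ha f N hf x0 L p hL hLr hs hp x hxD (hx hxD)
    rwa [neg_one_mul, ← sub_eq_add_neg])
  refine ⟨S, hS, ?_⟩
  filter_upwards [hG, hleb] with y hy hly hy0
  have hball : closedBall y (L / 4) ⊆ D := by
    intro x hx
    apply hs
    apply mem_cube_of_norm
    rw [mem_closedBall, dist_eq_norm] at hx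
    have := norm_sub_le_norm_sub_add_norm_sub x y x0
    linarith
  have hyD : y ∈ D := hball (mem_closedBall_self (by positivity))
  set a := Ch * N * ω L * (L⁻¹) ^ β with ha
  have ha0 : 0 ≤ a := by positivity
  have hhol : ∀ᵐ x, x ∈ closedBall y (L / 4) → 
      |(f x + (-1) * pe p x) - (f y + (-1) * pe p y)| ≤ a * ‖y - x‖ ^ β := by
    filter_upwards [hleb] with x hx hxb
    have hxD := hball hxb
    rw [mem_closedBall, dist_eq_norm] at hxb
    have := Hh f N hf x0 L p hL hLr hs hp x y (by linarith) hxb (hx hxD) (hly hyD)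
    rw [neg_one_mul, ← sub_eq_add_neg, neg_one_mul, ← sub_eq_add_neg]
    refine this.trans (le_of_eq ?_)
    rw [ha, div_eq_mul_inv, Real.mul_rpow (norm_nonneg _) (by positivity), norm_sub_rev x y]
    ring
  have hpv := pv hd hK h.op hhi (by positivity) hball ha0 hβ hhol
  have hGV := tendsto_nhds_unique (hy hyD) hpv
  have hnear := (hol_int hd hK (F := fun x => (f x + (-1) * pe p x) - (f y + (-1) * pe p y)) (by positivity) ha0 hβ 
    (((hhi.mono_set hball).aestronglyMeasurable).sub aestronglyMeasurable_const) hhol).2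
  have hfar := HS y hy0
  rw [hGV, VV]
  have e : a * CK * (vd d * ((L / 4) ^ β / β)) = Ch * CK * (vd d * ((1 / 4) ^ β / β)) * N * ω L := by
    rw [ha, div_eq_mul_inv L, Real.mul_rpow hL.le (by norm_num), Real.inv_rpow hL.le, one_div]
    have : 0 < L ^ β := by positivity
    field_simp
  rw [e] at hnear
  have hab := abs_add_le ((∫ x in D \ closedBall y (L / 4), (f x + (-1) * pe p x) * K (y - x)) - pe S y)
    (∫ x in closedBall y (L / 4), ((f x + (-1) * pe p x) - (f y + (-1) * pe p y)) * K (y - x))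
  have e2 : ∀ A B C : ℝ, A + B - C = (A - C) + B := by intros; ring
  rw [e2]
  calc _ ≤ _ := hab
    _ ≤ Cf * (Ca * N * ω L) + Ch * CK * (vd d * ((1 / 4) ^ β / β)) * N * ω L := add_le_add hfar hnear
    _ = _ := by ring

lemma ap_of_ae {G : EE d → ℝ} {S : MvPolynomial (Fin d) ℝ} {x : EE d} {l a : ℝ} (hl : 0 < l) (ha : 0 ≤ a)
    (hw : 0 < ω l) (hS : S.totalDegree ≤ n) 
    (hm : AEStronglyMeasurable G (volume.restrict (cube x l)))
    (h : ∀ᵐ y, y ∈ cube x l → |G y - pe S y| ≤ a * ω l) : Ap ω n a G S x l := by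
  have hi := integrableOn_pe S x hl.le
  refine ⟨hS, ?_, ?_⟩
  · have h1 : IntegrableOn (fun y => G y - pe S y) (cube x l) := by
      refine IntegrableOn.of_bound (C := a * ω l) ?_ ?_ ?_
      · rw [volume_cube x hl.le]; exact ENNReal.ofReal_lt_top
      · exact hm.sub hi.aestronglyMeasurable
      · rw [ae_restrict_iff' (measurableSet_cube x l)]
        exact h
    have := h1.add hi
    refine this.congr (Eventually.of_forall fun y => ?_)
    simp
  · have := avg_le_of_ae (F := fun y => G y - pe S y) hl (by positivity) h
    rw [inv_mul_le_iff₀ (by positivity)] at this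
    linarith

lemma good_cube (h : Ctx ω n q r Cω D c r0 M Δ) (hd : 0 < d) {Ω : EE d → ℝ}
    (hΩ : IsCZDensity d ((n : ℕ∞) + 1) Ω)
    (hKe : K = fun x => Ω x / ‖x‖ ^ d) (hK : Ker d K CK) (hne : D.Nonempty)
    (hb : Bornology.IsBounded D) (hI : HI ω n D K) (hII : HII ω n D K) :
    ∃ C κ : ℝ, 1 ≤ C ∧ 0 < κ ∧ κ ≤ 1 / (16 * d) ∧ ∀ f N, Fn ω n D f N → ∀ g, RT D K f g → 
    ∀ (x0 : EE d) (L : ℝ), 0 < L → L ≤ c * r0 → cube x0 L ⊆ D → 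
    ∃ S, Ap ω n (C * N) g S x0 (κ * L) := by
  obtain ⟨C1, κ, hC1, hκ, H1⟩ := poly_part h hd hK hne hb hI hII
  obtain ⟨C2, hC2, H2⟩ := osc_part h hd hΩ hKe hK hb
  have hd' : (1 : ℝ) ≤ d := by exact_mod_cast hd
  have hCω := h.md.hC
  set κ' := min κ (1 / (16 * d)) with hκ'
  have hk0 : 0 < κ' := lt_min hκ (by positivity)
  have hk1 : κ' ≤ 1 / (16 * d) := min_le_right _ _
  have hk2 : κ' ≤ 1 := hk1.trans (by rw [div_le_one (by positivity)]; linarith)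
  have hk3 : d * κ' ≤ 1 / 16 := by
    rw [le_div_iff₀ (by positivity)] at hk1
    linarith
  refine ⟨C2 * (Cω * (κ'⁻¹) ^ q) + C1, κ', ?_, hk0, hk1, fun f N hf g hg x0 L hL hLr hs => ?_⟩
  · have : 0 ≤ C2 * (Cω * (κ'⁻¹) ^ q) := by positivity
    linarith
  have hN := hf.hN
  obtain ⟨p, hp⟩ := hf.ap x0 L hL hs
  have hl : 0 < κ' * L := by positivity
  have hs2 : cube x0 (κ' * L) ⊆ D := (cube_mono (by nlinarith)).trans hs
  obtain ⟨gp, hgp0, hgp⟩ := poly_T hd hK h.op hb p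
  obtain ⟨S1, hS1⟩ := H1 f N hf x0 L (κ' * L) p gp hL hLr hs hp hl
    (mul_le_mul_of_nonneg_right (min_le_left _ _) hL.le) hs2 (Eventually.of_forall hgp)
  have hR := RT.lin hK h.op hg (Eventually.of_forall hgp : RT D K (pe p) gp) hf.int (integrableOn_pe_D hb p) (-1)
  obtain ⟨S2, hS2, hae⟩ := H2 f N hf x0 L p _ hL hLr hs hp hR
  have hwl := h.md.pos _ hl
  have hA : Ap ω n (C2 * (Cω * (κ'⁻¹) ^ q) * N) (fun x => g x + (-1) * gp x) S2 x0 (κ' * L) := by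
    apply ap_of_ae hl (by positivity) hwl hS2
    · have := hR.meas hK h.op (hf.int.add ((integrableOn_pe_D hb p).const_mul (-1)))
      exact this.mono_measure (Measure.restrict_mono hs2 le_rfl)
    · filter_upwards [hae] with y hy hyc
      have h3 := norm_sub_le_of_mem_cube hl.le hyc
      refine (hy (h3.trans ?_)).trans ?_
      · nlinarith
      · have := h.md.scale hk0 hk2 hL
        calc C2 * N * ω L ≤ C2 * N * (Cω * κ'⁻¹ ^ q * ω (κ' * L)) := by gcongr
          _ = _ := by ring
  refine ⟨S2 + S1, ((hA.add hl.le hS1).congr ?_).mono hwl.le hl.le (by linarith)⟩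
  refine Eventually.of_forall fun y _ => ?_
  show g y + (-1) * gp y + gp y = g y
  ring
end ZT

namespace ZT
open MvPolynomial
variable {d n : ℕ} {ω : ℝ → ℝ} {q r Cω c r0 M Δ : ℝ} {D : Set (EE d)} {K : EE d → ℝ} {CK : ℝ}

lemma small_cube (hop : IsOpen D) {x : EE d} (hx : x ∈ D) {a : ℝ} (ha : 0 < a) :
    ∃ l : ℝ, 0 < l ∧ l ≤ a ∧ cube x l ⊆ D := by
  obtain ⟨ε, hε, hh⟩ := Metric.isOpen_iff.1 hop x hx
  refine ⟨min a (ε / (2 * (d + 1))), lt_min ha (by positivity), min_le_left _ _, fun y hy => hh ?_⟩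
  have h1 : y ∈ cube x (ε / (2 * (d + 1))) := cube_mono (min_le_right _ _) hy
  have := norm_sub_le_of_mem_cube (by positivity) h1
  rw [mem_ball, dist_eq_norm]
  refine this.trans_lt ?_
  rw [← mul_div_assoc, div_lt_iff₀ (by positivity)]
  nlinarith

lemma cube_nhds (x : EE d) {l : ℝ} (hl : 0 < l) : cube x l ∈ 𝓝 x :=
  Filter.mem_of_superset (closedBall_mem_nhds x (by positivity)) (closedBall_subset_cube x l)

/-- goodness of `g` at all admissible small cubes -/
def Good (ω : ℝ → ℝ) (n : ℕ) (D : Set (EE d)) (κ b B : ℝ) (g : EE d → ℝ) : Prop :=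
  ∀ (x0 : EE d) (L : ℝ), 0 < L → L ≤ b → cube x0 L ⊆ D → ∃ S, Ap ω n B g S x0 (κ * L)

lemma Good.loc (hop : IsOpen D) {κ b B : ℝ} {g : EE d → ℝ} (hκ : 0 < κ) (hb : 0 < b)
    (hg : Good ω n D κ b B g) : LocallyIntegrableOn g D := by
  intro x hx
  obtain ⟨l, hl, hla, hs⟩ := small_cube hop hx hb
  obtain ⟨S, hS⟩ := hg x l hl hla hs
  exact ⟨cube x (κ * l), mem_nhdsWithin_of_mem_nhds (cube_nhds x (by positivity)), hS.2.1⟩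

lemma cube_size (hd : 0 < d) (h : Ctx ω n q r Cω D c r0 M Δ) {x : EE d} {l : ℝ} (hl : 0 < l)
    (hs : cube x l ⊆ D) : l ≤ 2 * Δ := by
  set e : EE d := EuclideanSpace.single ⟨0, hd⟩ (1 : ℝ) with he
  have hn : ‖e‖ = 1 := by simp [he]
  have h1 : x + (l / 2) • e ∈ cube x l := by
    apply mem_cube_of_norm
    rw [add_sub_cancel_left, norm_smul, hn, Real.norm_eq_abs, abs_of_pos (by positivity), mul_one]
  have := h.dia _ (hs h1) _ (hs (mem_cube_self x hl.le))
  rw [add_sub_cancel_left, norm_smul, hn, Real.norm_eq_abs, abs_of_pos (by positivity), mul_one] at this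
  linarith

lemma all_cubes (h : Ctx ω n q r Cω D c r0 M Δ) (hd : 0 < d) {κ : ℝ} (hκ : 0 < κ) (hκ1 : κ ≤ 1) :
    ∃ C : ℝ, 1 ≤ C ∧ ∀ B (g : EE d → ℝ), 0 ≤ B → Good ω n D κ (c * r0) B g → 
    ∀ x l, 0 < l → cube x l ⊆ D → ∃ p, Ap ω n (C * B) g p x l := by
  have hc := h.hc
  have hr0 := h.hr0
  have hΔ := h.hΔ
  have hcr : 0 < c * r0 := by positivity
  set m := min 1 (c * r0 / (2 * Δ)) with hm
  have hm0 : 0 < m := lt_min one_pos (by positivity)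
  have hm1 : m ≤ 1 := min_le_left _ _
  have hm2 : m * (2 * Δ) ≤ c * r0 := by
    rw [← le_div_iff₀ (by positivity)]
    exact min_le_right _ _
  have hM' : 0 ≤ (d : ℝ) / (κ * m) := by positivity
  obtain ⟨C, hC, H⟩ := carrot d n hM' h.md
  refine ⟨C, hC, fun B g hB hg x0 l hl hs => ?_⟩
  have hloc := hg.loc h.op hκ hcr
  have hl2 := cube_size hd h hl hs
  have hml : m * l ≤ c * r0 := le_trans (by gcongr) hm2
  obtain ⟨S, hS⟩ := hg x0 (m * l) (by positivity) hml ((cube_mono (by nlinarith)).trans hs)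
  have hwl := h.md.pos l hl
  refine ⟨S, ap_of_ae hl (by positivity) hwl hS.1 (locInt_cube hloc hl.le hs).aestronglyMeasurable ?_⟩
  filter_upwards [ae_lebPt h.op hloc] with x hx hxc
  have h1 := H g B x x0 (κ * (m * l)) hB (by positivity) (by
      have := norm_sub_le_of_mem_cube hl.le hxc
      rw [norm_sub_rev]
      refine this.trans (le_of_eq ?_)
      field_simp) (hx (hs hxc)) (by
      intro t ht ht1
      have h2 : cube (x + t • (x0 - x)) (t * (m * l)) ⊆ D := by
        refine Subset.trans (cube_mono ?_) ((cube_star hxc ht ht1).trans hs)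
        have : m * l ≤ l := by nlinarith
        gcongr
      have h3 := hg (x + t • (x0 - x)) (t * (m * l)) (by positivity) 
        (le_trans (by nlinarith [mul_pos hm0 hl]) hml) h2
      rwa [mul_left_comm] at h3) S hS
  refine h1.trans ?_
  have : ω (κ * (m * l)) ≤ ω l := by
    apply h.md.mono _ _ (by positivity)
    have : m * l ≤ l := by nlinarith
    nlinarith
  gcongr

set_option maxHeartbeats 1000000 in
/-- pointwise bound of `g` on the center of a big cube -/
lemma big_cube (h : Ctx ω n q r Cω D c r0 M Δ) (hd : 0 < d) (hK : Ker d K CK) :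
    ∃ C : ℝ, 1 ≤ C ∧ ∀ f N, Fn ω n D f N → ∀ g, RT D K f g → ∀ z, cube z (c * r0) ⊆ D → 
    ∀ᵐ y, ‖y - z‖ ≤ c * r0 / 16 → |g y| ≤ C * N := by
  have hc := h.hc
  have hr0 := h.hr0
  have hL : 0 < c * r0 := by positivity
  set L := c * r0 with hLdef
  obtain ⟨Ch, β, hCh, hβ, hβ1, Hh⟩ := holder_near h
  obtain ⟨Cl, hCl, Hl⟩ := pe_lip d n
  have hvd := vd_nonneg d
  have hCK := hK.hC
  have hwL := h.md.pos L hL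
  set A := Ch * ω L + Cl * (ω L + (L ^ d)⁻¹) with hA
  have hA0 : 0 ≤ A := by positivity
  set CC := CK * (L / 4) ^ (-(d : ℝ)) + A * (L⁻¹) ^ β * CK * (vd d * ((L / 4) ^ β / β)) with hCC
  refine ⟨max 1 CC, le_max_left _ _, fun f N hf g hg z hs => ?_⟩
  have hN := hf.hN
  obtain ⟨p, hp⟩ := hf.ap z L hL hs
  have hleb := ae_lebPt h.op hf.int.locallyIntegrableOn
  filter_upwards [hg, hleb] with y hy hly hy0
  have hcube : closedBall y (L / 4) ⊆ cube z L := by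
    intro x hx
    apply mem_cube_of_norm
    rw [mem_closedBall, dist_eq_norm] at hx
    have := norm_sub_le_norm_sub_add_norm_sub x y z
    linarith
  have hball := hcube.trans hs
  have hyb : y ∈ closedBall y (L / 4) := mem_closedBall_self (by positivity)
  have hyD : y ∈ D := hball hyb
  set a := A * N * (L⁻¹) ^ β with ha
  have ha0 : 0 ≤ a := by positivity
  have hhol : ∀ᵐ x, x ∈ closedBall y (L / 4) → |f x - f y| ≤ a * ‖y - x‖ ^ β := by
    filter_upwards [hleb] with x hx hxb
    have hxD := hball hxb
    have hxc := hcube hxb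
    rw [mem_closedBall, dist_eq_norm] at hxb
    have h1 := Hh f N hf z L p hL le_rfl hs hp x y (by linarith) hxb (hx hxD) (hly hyD)
    have h2 := Hl p hp.1 z L hL x hxc y (hcube hyb)
    have h3 := avg_pe_le hf hL hs hp
    set T := ‖x - y‖ / L with hT
    have hT0 : 0 ≤ T := by positivity
    have hT1 : T ≤ 1 := by rw [hT, div_le_one hL]; linarith
    have hTβ : T ≤ T ^ β := by
      rcases hT0.eq_or_lt with h0 | h0
      · rw [← h0, Real.zero_rpow hβ.ne']
      · calc T = T ^ (1 : ℝ) := (Real.rpow_one T).symm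
          _ ≤ T ^ β := Real.rpow_le_rpow_of_exponent_ge h0 hT1 hβ1
    have h4 : |pe p x - pe p y| ≤ Cl * T ^ β * (N * (ω L + (L ^ d)⁻¹)) := by
      refine h2.trans ?_
      gcongr
    have h5 : |f x - f y| ≤ |(f x - pe p x) - (f y - pe p y)| + |pe p x - pe p y| := by
      refine le_trans (le_of_eq ?_) (abs_add_le _ _)
      congr 1; ring
    have h6 : a * ‖y - x‖ ^ β = A * N * T ^ β := by
      rw [ha, hT, div_eq_mul_inv, Real.mul_rpow (norm_nonneg _) (by positivity), norm_sub_rev x y]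
      ring
    rw [h6]
    calc |f x - f y| ≤ Ch * N * ω L * T ^ β + Cl * T ^ β * (N * (ω L + (L ^ d)⁻¹)) := by linarith
      _ = A * N * T ^ β := by rw [hA]; ring
  have hpv := pv hd hK h.op hf.int (by positivity) hball ha0 hβ hhol
  have hGV := tendsto_nhds_unique (hy hyD) hpv
  have hnear := (hol_int hd hK (F := fun x => f x - f y) (by positivity) ha0 hβ 
    (((hf.int.mono_set hball).aestronglyMeasurable).sub aestronglyMeasurable_const) hhol).2
  have hfar : |∫ x in D \ closedBall y (L / 4), f x * K (y - x)| ≤ CK * (L / 4) ^ (-(d : ℝ)) * N := by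
    have hEm : MeasurableSet (D \ closedBall y (L / 4)) := h.op.measurableSet.diff measurableSet_closedBall
    have hEi : IntegrableOn (fun x => (CK * (L / 4) ^ (-(d : ℝ))) * |f x|) (D \ closedBall y (L / 4)) :=
      (hf.int.mono_set sdiff_subset).abs.const_mul _
    rw [← Real.norm_eq_abs]
    refine (norm_integral_le_of_norm_le hEi ?_).trans ?_
    · filter_upwards [ae_restrict_mem hEm] with x hx
      have h7 := hx.2
      rw [mem_closedBall, not_le, dist_eq_norm, norm_sub_rev] at h7
      have := hK.bd_far (by positivity) h7.le
      rw [Real.norm_eq_abs, abs_mul, mul_comm]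
      gcongr
    · rw [integral_const_mul]
      gcongr
      refine le_trans ?_ hf.l1
      exact setIntegral_mono_set hf.int.abs (Eventually.of_forall fun _ => abs_nonneg _) 
        (sdiff_subset : D \ closedBall y (L / 4) ⊆ D).eventuallyLE
  rw [hGV, VV]
  refine (abs_add_le _ _).trans ?_
  calc _ ≤ CK * (L / 4) ^ (-(d : ℝ)) * N + a * CK * (vd d * ((L / 4) ^ β / β)) := add_le_add hfar hnear
    _ = CC * N := by rw [hCC, ha]; ring
    _ ≤ _ := by gcongr; exact le_max_right _ _

set_option maxHeartbeats 1000000 in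
lemma g_bdd (h : Ctx ω n q r Cω D c r0 M Δ) (hd : 0 < d) (hK : Ker d K CK) {κ C1 : ℝ} (hκ : 0 < κ)
    (hκ1 : κ ≤ 1 / (16 * d)) (hC1 : 1 ≤ C1) :
    ∃ C : ℝ, 1 ≤ C ∧ ∀ f N, Fn ω n D f N → ∀ g, RT D K f g → Good ω n D κ (c * r0) (C1 * N) g → 
    ∀ᵐ x, x ∈ D → |g x| ≤ C * N := by
  have hc := h.hc
  have hr0 := h.hr0
  have hM := h.hM
  have hL : 0 < c * r0 := by positivity
  obtain ⟨C2, hC2, H2⟩ := big_cube h hd hK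
  obtain ⟨C3, hC3, H3⟩ := carrot d n (show 0 ≤ M * r0 / (κ * (c * r0)) by positivity) h.md
  obtain ⟨C4, hC4, H4⟩ := pe_growth d n
  set l := κ * (c * r0) with hldef
  have hl : 0 < l := by positivity
  have hwl := h.md.pos l hl
  set E := (1 + M * r0 / l) ^ n with hE
  have hE0 : 0 ≤ E := by positivity
  set CC := C3 * C1 * ω l + C4 * E * (C2 + C1 * ω l) with hCC
  refine ⟨max 1 CC, le_max_left _ _, fun f N hf g hg hgood => ?_⟩
  have hN := hf.hN
  have hloc := hgood.loc h.op hκ hL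
  filter_upwards [ae_lebPt h.op hloc] with x hx hxD
  obtain ⟨z, hz1, -, hz3⟩ := h.geo x hxD x hxD r0 hr0 (by simp [hr0.le]) le_rfl
  have hcub : ∀ s : ℝ, 0 < s → s ≤ 1 → cube (x + s • (z - x)) (s * (c * r0)) ⊆ D := fun s a b => (hz3 s a b).1
  have hzD : cube z (c * r0) ⊆ D := cube_one hcub
  obtain ⟨S, hS⟩ := hgood z (c * r0) hL le_rfl hzD
  have h1 := H3 g (C1 * N) x z l (by positivity) hl (by
    refine hz1.trans (le_of_eq ?_)
    field_simp) (hx hxD) (by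
    intro t ht ht1
    have := hgood (x + t • (z - x)) (t * (c * r0)) (by positivity) (by nlinarith) (hcub t ht ht1)
    rwa [mul_left_comm] at this) S hS
  have h2 := H4 S hS.1 z l hl x
  have hd' : (1 : ℝ) ≤ d := by exact_mod_cast hd
  have hlz : cube z l ⊆ D := by
    refine (cube_mono ?_).trans hzD
    have : κ ≤ 1 := hκ1.trans (by rw [div_le_one (by positivity)]; linarith)
    nlinarith
  have h3 : (l ^ d)⁻¹ * ∫ y in cube z l, |g y| ≤ C2 * N := by
    apply avg_le_of_ae hl (by positivity)
    filter_upwards [H2 f N hf g hg z hzD] with y hy hyc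
    apply hy
    refine (norm_sub_le_of_mem_cube hl.le hyc).trans ?_
    rw [le_div_iff₀ (by positivity)] at hκ1
    rw [hldef]
    nlinarith
  have h4 : (l ^ d)⁻¹ * ∫ y in cube z l, |pe S y| ≤ (C2 + C1 * ω l) * N := by
    have i1 : IntegrableOn g (cube z l) := hS.2.1
    have i2 := integrableOn_pe S z hl.le
    have i3 : IntegrableOn (fun y => |g y - pe S y|) (cube z l) := (i1.sub i2).abs
    have : ∫ y in cube z l, |pe S y| ≤ (∫ y in cube z l, |g y|) + ∫ y in cube z l, |g y - pe S y| := by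
      rw [← integral_add i1.abs i3]
      refine integral_mono i2.abs (i1.abs.add i3) fun y => ?_
      have := abs_sub (g y) (g y - pe S y)
      rwa [sub_sub_cancel] at this
    have h5 := hS.2.2
    have hld : 0 < l ^ d := by positivity
    rw [inv_mul_le_iff₀ hld] at h3 ⊢
    calc ∫ y in cube z l, |pe S y| ≤ _ := this
      _ ≤ l ^ d * (C2 * N) + C1 * N * ω l * l ^ d := add_le_add h3 h5
      _ = _ := by ring
  have h5 : (1 + ‖x - z‖ / l) ^ n ≤ E := by
    rw [hE, norm_sub_rev]
    gcongr
  have h6 : |pe S x| ≤ C4 * E * ((C2 + C1 * ω l) * N) := by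
    refine h2.trans ?_
    gcongr
  have h7 : |g x| ≤ |g x - pe S x| + |pe S x| := by
    refine le_trans (le_of_eq ?_) (abs_add_le _ _)
    congr 1; ring
  calc |g x| ≤ C3 * (C1 * N) * ω l + C4 * E * ((C2 + C1 * ω l) * N) := by linarith
    _ = CC * N := by rw [hCC]; ring
    _ ≤ _ := by gcongr; exact le_max_right _ _

lemma core (h : Ctx ω n q r Cω D c r0 M Δ) (hd : 0 < d) {Ω : EE d → ℝ}
    (hΩ : IsCZDensity d ((n : ℕ∞) + 1) Ω)
    (hKe : K = fun x => Ω x / ‖x‖ ^ d) (hK : Ker d K CK) (hne : D.Nonempty)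
    (hb : Bornology.IsBounded D) (hI : HI ω n D K) (hII : HII ω n D K) :
    ∃ C : ℝ, 1 ≤ C ∧ ∀ f N, Fn ω n D f N → ∀ g, RT D K f g → 
      (∀ x l, 0 < l → cube x l ⊆ D → ∃ p, Ap ω n (C * N) g p x l) ∧ IntegrableOn g D ∧
      ∫ x in D, |g x| ≤ C * N := by
  obtain ⟨C1, κ, hC1, hκ, hκ1, H1⟩ := good_cube h hd hΩ hKe hK hne hb hI hII
  have hd' : (1 : ℝ) ≤ d := by exact_mod_cast hd
  have hκ2 : κ ≤ 1 := hκ1.trans (by rw [div_le_one (by positivity)]; linarith)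
  obtain ⟨C2, hC2, H2⟩ := all_cubes h hd hκ hκ2
  obtain ⟨C3, hC3, H3⟩ := g_bdd h hd hK hκ hκ1 hC1
  have hv : volume D ≠ ⊤ := hb.measure_lt_top.ne
  set v := volume.real D with hvd
  have hv0 : 0 ≤ v := measureReal_nonneg
  have ha : 1 ≤ C2 * C1 := by nlinarith
  refine ⟨C2 * C1 + C3 * v, by nlinarith, fun f N hf g hg => ?_⟩
  have hN := hf.hN
  have hgood : Good ω n D κ (c * r0) (C1 * N) g := fun x0 L => H1 f N hf g hg x0 L
  have hbd := H3 f N hf g hg hgood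
  rw [← ae_restrict_iff' h.op.measurableSet] at hbd
  have hgi : IntegrableOn g D := by
    refine IntegrableOn.of_bound (C := C3 * N) hb.measure_lt_top (hg.meas hK h.op hf.int) ?_
    exact hbd
  refine ⟨fun x l hl hs => ?_, hgi, ?_⟩
  · obtain ⟨p, hp⟩ := H2 (C1 * N) g (by positivity) hgood x l hl hs
    refine ⟨p, hp.mono (h.md.pos l hl).le hl.le ?_⟩
    have : 0 ≤ C3 * v * N := by positivity
    linarith
  · calc ∫ x in D, |g x| ≤ ∫ x in D, C3 * N := by
          apply integral_mono_of_nonneg (Eventually.of_forall fun _ => abs_nonneg _) _ hbd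
          exact integrableOn_const hv
      _ = v * (C3 * N) := by rw [setIntegral_const, smul_eq_mul]
      _ ≤ _ := by
        have : 0 ≤ C2 * C1 * N := by positivity
        linarith
end ZT

namespace ZT
open MvPolynomial
variable {d n : ℕ} {ω : ℝ → ℝ} {q r Cω c r0 M Δ : ℝ} {D : Set (EE d)} {K : EE d → ℝ} {CK : ℝ}

lemma integrable_of_l1 (hop : IsOpen D) {f : EE d → ℝ} (hf : LocallyIntegrableOn f D) (h : l1Norm D f < ⊤) :
    IntegrableOn f D := by
  refine ⟨hf.aestronglyMeasurable, ?_⟩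
  rw [hasFiniteIntegral_iff_norm]
  exact h

lemma exists_ctx (hD : IsLipschitzDomain D) (hω : MD ω n q r Cω) : 
    ∃ c r0 M Δ, Ctx ω n q r Cω D c r0 M Δ := by
  obtain ⟨c, r0, M, h1, h2, h3, h4, h5, h6⟩ := exists_geo hD
  refine ⟨c, r0, M, max 1 (diam D), hω, hD.1, le_max_left _ _, fun x hx y hy => ?_, h1, h2, h3, h4, h5, h6⟩
  rw [← dist_eq_norm]
  exact (dist_le_diam_of_mem hD.2.2.1 hx hy).trans (le_max_right _ _)

lemma main_pos (hd : 0 < d) (hω : MD ω n q r Cω) (hD : IsLipschitzDomain D) {Ω : EE d → ℝ}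
    (hΩ : IsCZDensity d ((n : ℕ∞) + 1) Ω)
    (hKe : K = fun x => Ω x / ‖x‖ ^ d) (hI : HI ω n D K) (hII : HII ω n D K) :
    ∃ C' : ℝ, 0 < C' ∧
      ∀ f g : EuclideanSpace ℝ (Fin d) → ℝ,
        LocallyIntegrableOn f D → zygSeminorm ω n D f < ⊤ → l1Norm D f < ⊤ →
        IsRestrictedCZ D K f g →
        LocallyIntegrableOn g D ∧
          zygSeminorm ω n D g + l1Norm D g ≤
            ENNReal.ofReal C' * (zygSeminorm ω n D f + l1Norm D f) := by
  obtain ⟨c, r0, M, Δ, h⟩ := exists_ctx hD hω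
  obtain ⟨CK, hK⟩ := exists_ker hd hΩ hKe
  obtain ⟨C, hC, H⟩ := core h hd hΩ hKe hK hD.2.1.nonempty hD.2.2.1 hI hII
  refine ⟨2 * C, by positivity, fun f g hfl hfz hf1 hfg => ?_⟩
  have hfi := integrable_of_l1 h.op hfl hf1
  have hRT := ((rt_iff h.op).1 hfg).2
  set W := zygSeminorm ω n D f + l1Norm D f with hW
  have hWt : W ≠ ⊤ := (ENNReal.add_lt_top.2 ⟨hfz, hf1⟩).ne
  have key : ∀ ε : ℝ, 0 < ε → IntegrableOn g D ∧ 
      zygSeminorm ω n D g + l1Norm D g ≤ ENNReal.ofReal (2 * C * (W.toReal + ε)) := by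
    intro ε hε
    have hN0 : 0 < W.toReal + ε := by positivity
    have hWlt : W < ENNReal.ofReal (W.toReal + ε) := by
      rw [ENNReal.lt_ofReal_iff_toReal_lt hWt]
      linarith
    have hFn : Fn ω n D f (W.toReal + ε) := by
      refine ⟨hN0.le, hfi, ?_, ?_⟩
      · have : l1Norm D f ≤ ENNReal.ofReal (W.toReal + ε) := le_trans le_add_self hWlt.le
        rw [l1Norm, lint_eq hfi] at this
        exact (ENNReal.ofReal_le_ofReal_iff hN0.le).1 this
      · exact ap_of_zyg h.md.pos hfl (lt_of_le_of_lt le_self_add hWlt)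
    obtain ⟨a1, a2, a3⟩ := H f _ hFn g hRT
    refine ⟨a2, ?_⟩
    have b1 := zyg_of_ap h.md.pos a1
    have b2 : l1Norm D g ≤ ENNReal.ofReal (C * (W.toReal + ε)) := by
      rw [l1Norm, lint_eq a2]
      exact ENNReal.ofReal_le_ofReal a3
    refine (add_le_add b1 b2).trans (le_of_eq ?_)
    rw [← ENNReal.ofReal_add (by positivity) (by positivity)]
    congr 1; ring
  refine ⟨(key 1 one_pos).1.locallyIntegrableOn, ?_⟩
  have hfin : zygSeminorm ω n D g + l1Norm D g ≠ ⊤ :=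
    ((key 1 one_pos).2.trans_lt ENNReal.ofReal_lt_top).ne
  rw [← ENNReal.ofReal_toReal hWt, ← ENNReal.ofReal_mul (by positivity), 
    ← ENNReal.ofReal_toReal hfin]
  apply ENNReal.ofReal_le_ofReal
  apply le_of_forall_pos_le_add
  intro ε hε
  have := (key (ε / (2 * C)) (by positivity)).2
  rw [← ENNReal.ofReal_toReal hfin, ENNReal.ofReal_le_ofReal_iff (by positivity)] at this
  refine this.trans (le_of_eq ?_)
  field_simp

lemma main_d0 (hd : d = 0) (hD : IsLipschitzDomain D) :
    ∃ C' : ℝ, 0 < C' ∧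
      ∀ f g : EuclideanSpace ℝ (Fin d) → ℝ,
        LocallyIntegrableOn f D → zygSeminorm ω n D f < ⊤ → l1Norm D f < ⊤ →
        IsRestrictedCZ D K f g →
        LocallyIntegrableOn g D ∧
          zygSeminorm ω n D g + l1Norm D g ≤
            ENNReal.ofReal C' * (zygSeminorm ω n D f + l1Norm D f) := by
  subst hd
  refine ⟨1, one_pos, fun f g _ _ _ hfg => ?_⟩
  have hg : ∀ᵐ y ∂(volume.restrict D), g y = 0 := by
    filter_upwards [hfg.2] with y hy
    refine tendsto_nhds_unique hy (tendsto_const_nhds.congr' ?_)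
    filter_upwards [self_mem_nhdsWithin] with ε hε
    have hε' : (0 : ℝ) < ε := hε
    have : {x ∈ D | ε < dist y x} = ∅ := by
      ext x
      simp only [mem_setOf_eq, mem_empty_iff_false, iff_false, not_and, not_lt]
      intro _
      rw [Subsingleton.elim x y, dist_self]
      exact hε'.le
    rw [this]
    simp
  have hz : zygSeminorm ω n D g = 0 := by
    rw [← nonpos_iff_eq_zero]
    refine iSup₂_le fun x l => iSup₂_le fun hl hs => ?_
    refine iInf₂_le_of_le (pe 0) (pe_mem (by simp)) ?_
    have : ∫⁻ y in cube x l, ENNReal.ofReal |g y - pe 0 y| = 0 := by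
      rw [lintegral_congr_ae (g := fun _ => 0)]
      · simp
      · filter_upwards [ae_restrict_of_ae_restrict_of_subset hs hg] with y hy
        simp [hy]
    rw [this, mul_zero]
  have h1 : l1Norm D g = 0 := by
    unfold l1Norm
    rw [lintegral_congr_ae (g := fun _ => 0)]
    · simp
    · filter_upwards [hg] with y hy
      simp [hy]
  refine ⟨?_, by rw [hz, h1]; simp⟩
  apply IntegrableOn.locallyIntegrableOn
  exact (integrable_zero _ _ _).congr (by filter_upwards [hg] with y hy; simp [hy])

lemma md_id : MD (fun t => t) 1 (3 / 2) (1 / 2) 1 := by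
  refine ⟨one_pos, by norm_num, by norm_num, by norm_num, by norm_num, le_rfl, fun t h => h,
    fun s t _ h => h, fun s t hs ht => ?_, fun s t hs hs1 ht => ?_, continuousOn_id⟩
  · rw [one_mul]
    gcongr
    calc s = s ^ (1 : ℝ) := (Real.rpow_one s).symm
      _ ≤ _ := Real.rpow_le_rpow_of_exponent_le hs (by norm_num)
  · rw [one_mul]
    gcongr
    calc s = s ^ (1 : ℝ) := (Real.rpow_one s).symm
      _ ≤ _ := Real.rpow_le_rpow_of_exponent_ge hs hs1 (by norm_num)

lemma zero_cube (h0 : ∀ t, 0 < t → ω t = 0) {g : EE d → ℝ} (h : zygSeminorm ω n D g < ⊤) 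
    (x : EE d) (l : ℝ) (hl : 0 < l) (hs : cube x l ⊆ D) :
    ∃ p : MvPolynomial (Fin d) ℝ, p.totalDegree ≤ n ∧ 
      ∫⁻ y in cube x l, ENNReal.ofReal |g y - pe p y| = 0 := by
  have h1 := lt_of_le_of_lt (le_iSup₂_of_le (f := fun (x₀ : EE d) (l : ℝ) => 
    ⨆ (_ : 0 < l) (_ : cube x₀ l ⊆ D),
    ⨅ (P : EuclideanSpace ℝ (Fin d) → ℝ) (_ : P ∈ PolyLE d n),
      (ENNReal.ofReal (ω l * l ^ d))⁻¹ * ∫⁻ x in cube x₀ l, ENNReal.ofReal |g x - P x|) x l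
    (le_iSup₂_of_le hl hs le_rfl)) h
  simp only [iInf_lt_iff] at h1
  obtain ⟨P, hP, h1⟩ := h1
  obtain ⟨p, hp, rfl⟩ := mem_polyLE.1 hP
  refine ⟨p, hp, ?_⟩
  rw [h0 l hl, zero_mul, ENNReal.ofReal_zero, ENNReal.inv_zero] at h1
  by_contra hne
  rw [ENNReal.top_mul hne] at h1
  exact lt_irrefl _ h1

lemma zero_zyg (h0 : ∀ t, 0 < t → ω t = 0) {g : EE d → ℝ} (h : zygSeminorm ω n D g < ⊤) :
    zygSeminorm ω n D g = 0 := by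
  rw [← nonpos_iff_eq_zero]
  refine iSup₂_le fun x l => iSup₂_le fun hl hs => ?_
  obtain ⟨p, hp, hz⟩ := zero_cube h0 h x l hl hs
  refine iInf₂_le_of_le (pe p) (pe_mem hp) ?_
  rw [hz, mul_zero]

lemma ap_of_lint_zero {g : EE d → ℝ} (hg : LocallyIntegrableOn g D) {x : EE d} {l : ℝ} (hl : 0 < l)
    (hs : cube x l ⊆ D) {p : MvPolynomial (Fin d) ℝ} (hp : p.totalDegree ≤ n)
    (h : ∫⁻ y in cube x l, ENNReal.ofReal |g y - pe p y| = 0) : Ap (fun t => t) n 0 g p x l := by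
  have hgi := locInt_cube hg hl.le hs
  refine ⟨hp, hgi, ?_⟩
  rw [lint_eq (F := fun y => g y - pe p y) (hgi.sub (integrableOn_pe p x hl.le)), ENNReal.ofReal_eq_zero] at h
  simpa using h

/-- functions that are locally polynomials are polynomials -/
lemma glob_poly (hop : IsOpen D) (hc : IsPreconnected D) (hne : D.Nonempty) {f : EE d → ℝ}
    (H : ∀ x l, 0 < l → cube x l ⊆ D → ∃ p : MvPolynomial (Fin d) ℝ, p.totalDegree ≤ n ∧ 
      ∀ᵐ y, y ∈ cube x l → f y = pe p y) :
    ∃ p : MvPolynomial (Fin d) ℝ, p.totalDegree ≤ n ∧ ∀ᵐ y, y ∈ D → f y = pe p y := by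
  classical
  have H' : ∀ x : EE d, ∃ (l : ℝ) (p : MvPolynomial (Fin d) ℝ), x ∈ D → 0 < l ∧ cube x l ⊆ D ∧
      p.totalDegree ≤ n ∧ ∀ᵐ y, y ∈ cube x l → f y = pe p y := by
    intro x
    by_cases hx : x ∈ D
    · obtain ⟨l, hl, -, hs⟩ := small_cube hop hx one_pos
      obtain ⟨p, hp, hh⟩ := H x l hl hs
      exact ⟨l, p, fun _ => ⟨hl, hs, hp, hh⟩⟩
    · exact ⟨0, 0, fun h => absurd h hx⟩
  choose l p hlp using H'
  letI : TopologicalSpace (MvPolynomial (Fin d) ℝ) := ⊥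
  haveI : DiscreteTopology (MvPolynomial (Fin d) ℝ) := ⟨rfl⟩
  have hcont : ContinuousOn p D := by
    intro x hx
    obtain ⟨hl, hs, hp, hh⟩ := hlp x hx
    refine (continuousWithinAt_const (b := p x)).congr_of_eventuallyEq ?_ rfl
    have hnb : ball x (l x / 4) ∈ 𝓝[D] x := mem_nhdsWithin_of_mem_nhds (ball_mem_nhds _ (by positivity))
    filter_upwards [hnb, self_mem_nhdsWithin] with y hy hyD
    obtain ⟨hl2, hs2, hp2, hh2⟩ := hlp y hyD
    rw [mem_ball, dist_eq_norm] at hy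
    set m := min (l y) (l x / 2) with hm
    have hm0 : 0 < m := lt_min hl2 (by positivity)
    have c1 : cube y m ⊆ cube x (l x) := by
      apply cube_subset_cube
      have : m ≤ l x / 2 := min_le_right _ _
      linarith
    have c2 : cube y m ⊆ cube y (l y) := cube_mono (min_le_left _ _)
    have : p y - p x = 0 := by
      apply poly_zero_of_cube (x₀ := y) hm0
      rw [setIntegral_congr_ae (g := fun _ => (0 : ℝ)) (measurableSet_cube y m)]
      · simp
      · filter_upwards [hh, hh2] with u h1 h2 hu
        rw [pe_sub, ← h1 (c1 hu), ← h2 (c2 hu)]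
        simp
    exact sub_eq_zero.1 this
  obtain ⟨x0, hx0⟩ := hne
  refine ⟨p x0, (hlp x0 hx0).2.2.1, ?_⟩
  have : volume {y | ¬ (y ∈ D → f y = pe (p x0) y)} = 0 := by
    apply measure_null_of_locally_null
    intro x hx
    simp only [mem_setOf_eq, Classical.not_imp] at hx
    obtain ⟨hl, hs, hp, hh⟩ := hlp x hx.1
    rw [hc.constant hcont hx.1 hx0] at hh
    refine ⟨{y | ¬ (y ∈ cube x (l x) → f y = pe (p x0) y)}, ?_, hh⟩
    filter_upwards [self_mem_nhdsWithin, mem_nhdsWithin_of_mem_nhds (cube_nhds x hl)] with y hy hyc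
    simp only [mem_setOf_eq, Classical.not_imp] at hy ⊢
    exact ⟨hyc, hy.2⟩
  exact this

lemma main_zero (hd : 0 < d) (h0 : ∀ t, 0 < t → ω t = 0) (hD : IsLipschitzDomain D) {Ω : EE d → ℝ}
    (hΩ : IsCZDensity d (((1 : ℕ) : ℕ∞) + 1) Ω)
    (hKe : K = fun x => Ω x / ‖x‖ ^ d) 
    (hi : ∀ P ∈ PolyLE d 1, ∀ g : EuclideanSpace ℝ (Fin d) → ℝ,
      IsRestrictedCZ D K P g →
        LocallyIntegrableOn g D ∧ zygSeminorm ω 1 D g < ⊤)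
    (hii : ∃ C : ℝ, 0 < C ∧
      ∀ (x₀ : EuclideanSpace ℝ (Fin d)) (l : ℝ), 0 < l → cube x₀ l ⊆ D →
        ∀ P : EuclideanSpace ℝ (Fin d) → ℝ,
          (∃ p : MvPolynomial (Fin d) ℝ, p.IsHomogeneous 1 ∧
            ∀ x, P x = MvPolynomial.eval (fun i => x i - x₀ i) p) →
          ∀ g : EuclideanSpace ℝ (Fin d) → ℝ, IsRestrictedCZ D K P g →
            ∃ S ∈ PolyLE d 1,
              (ENNReal.ofReal (l ^ d))⁻¹ *
                  ∫⁻ x in cube x₀ l, ENNReal.ofReal |g x - S x| ≤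
                ENNReal.ofReal (C * sSup ((fun x => |P x|) '' D) * omegaTilde ω 1 l)) :
    ∃ C' : ℝ, 0 < C' ∧
      ∀ f g : EuclideanSpace ℝ (Fin d) → ℝ,
        LocallyIntegrableOn f D → zygSeminorm ω 1 D f < ⊤ → l1Norm D f < ⊤ →
        IsRestrictedCZ D K f g →
        LocallyIntegrableOn g D ∧
          zygSeminorm ω 1 D g + l1Norm D g ≤
            ENNReal.ofReal C' * (zygSeminorm ω 1 D f + l1Norm D f) := by
  have hop := hD.1
  have hI : HI (fun t => t) 1 D K := by
    intro p hp g hg h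
    obtain ⟨h1, h2⟩ := hi (pe p) (pe_mem hp) g ((rt_iff hop).2 ⟨hg, h⟩)
    refine ⟨h1, 0, le_rfl, fun x l hl hs => ?_⟩
    obtain ⟨p, hp, hz⟩ := zero_cube h0 h2 x l hl hs
    exact ⟨p, ap_of_lint_zero h1 hl hs hp hz⟩
  have hII : HII (fun t => t) 1 D K := by
    obtain ⟨C, hC, H⟩ := hii
    refine ⟨1, le_rfl, fun x0 l p g B hl hs hp hg h hB hbd => ?_⟩
    obtain ⟨S, hS, hle⟩ := H x0 l hl hs (fun x => pe p (x - x0)) ⟨p, hp, fun x => rfl⟩ g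
      ((rt_iff hop).2 ⟨hg, h⟩)
    obtain ⟨s, hs', rfl⟩ := mem_polyLE.1 hS
    have hgl : LocallyIntegrableOn g D := by
      refine (hI (aff (-x0) 1 p) (totalDegree_aff _ _ hp.totalDegree_le) g hg ?_).1
      rw [← shift_pe]
      exact h
    rw [omegaTilde, h0 l hl, zero_div, mul_zero, ENNReal.ofReal_zero, nonpos_iff_eq_zero, 
      mul_eq_zero, ENNReal.inv_eq_zero] at hle
    have := hle.resolve_left ENNReal.ofReal_ne_top
    exact ⟨s, (ap_of_lint_zero hgl hl hs hs' this).mono hl.le hl.le (by positivity)⟩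
  obtain ⟨C', hC', H⟩ := main_pos hd md_id hD hΩ hKe hI hII
  refine ⟨C', hC', fun f g hfl hfz hf1 hfg => ?_⟩
  have hfz0 : zygSeminorm (fun t => t) 1 D f = 0 := by
    have := zyg_of_ap (ω := fun t => t) (n := 1) (D := D) (g := f) (N := 0) (fun t ht => ht) (fun x l hl hs => by
      obtain ⟨p, hp, hz⟩ := zero_cube h0 hfz x l hl hs
      exact ⟨p, ap_of_lint_zero hfl hl hs hp hz⟩)
    rwa [ENNReal.ofReal_zero, nonpos_iff_eq_zero] at this
  obtain ⟨hg1, hg2⟩ := H f g hfl (by rw [hfz0]; exact ENNReal.zero_lt_top) hf1 hfg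
  refine ⟨hg1, ?_⟩
  obtain ⟨p, hp, hfp⟩ := glob_poly (n := 1) hop hD.2.1.isPreconnected hD.2.1.nonempty (f := f) (by
    intro x l hl hs
    obtain ⟨p, hp, hz⟩ := zero_cube h0 hfz x l hl hs
    refine ⟨p, hp, ?_⟩
    have hgi : IntegrableOn (fun y => f y - pe p y) (cube x l) :=
      (locInt_cube hfl hl.le hs).sub (integrableOn_pe p x hl.le)
    rw [lintegral_eq_zero_iff' (hgi.abs.aestronglyMeasurable.aemeasurable.ennreal_ofReal), EventuallyEq,
      ae_restrict_iff' (measurableSet_cube x l)] at hz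
    filter_upwards [hz] with y hy hyc
    have := hy hyc
    simp only [Pi.zero_apply, ENNReal.ofReal_eq_zero] at this
    exact sub_eq_zero.1 (abs_nonpos_iff.1 this))
  have hpg : IsRestrictedCZ D K (pe p) g := by
    refine ⟨hfg.1, ?_⟩
    filter_upwards [hfg.2] with y hy
    refine hy.congr fun ε => ?_
    apply integral_congr_ae
    have hsub : {x | x ∈ D ∧ ε < dist y x} ⊆ D := fun x hx => hx.1
    rw [← ae_restrict_iff' hop.measurableSet] at hfp
    filter_upwards [ae_restrict_of_ae_restrict_of_subset hsub hfp] with x hx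
    rw [hx]
  have hz := zero_zyg h0 (hi (pe p) (pe_mem hp) g hpg).2
  rw [hz, zero_add, zero_zyg h0 hfz, zero_add]
  rw [hfz0, zero_add] at hg2
  exact le_trans le_add_self hg2

lemma zero_order (hω : IsModulusOfOrder ω n) (h0 : ∀ t, 0 < t → ω t = 0) : n = 1 := by
  apply le_antisymm _ hω.npos
  apply hω.minimal 1 one_pos
  refine ⟨⟨1, by norm_num, by norm_num, 1, one_pos, fun s t hs ht => ?_⟩, 
    ⟨1 / 2, by norm_num, by norm_num, 1, one_pos, fun s t hs _ ht => ?_⟩⟩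
  · rw [h0 t ht, h0 (s * t) (by positivity), mul_zero]
  · rw [h0 t ht, h0 (s * t) (by positivity), mul_zero]

end ZT

/-- **T(P) theorem for Zygmund spaces (sufficiency).** If (i) `T_D P ∈ 𝒞_ω(D)` for every
polynomial `P ∈ 𝒫_n(D)` and (ii) the quantitative bound for homogeneous polynomials of
degree `n` holds, then the restricted operator `T_D` is bounded on `𝒞_ω(D)`. -/
theorem statement_0 {d n : ℕ} (ω : ℝ → ℝ) (hω : IsModulusOfOrder ω n)
    (D : Set (EuclideanSpace ℝ (Fin d))) (hD : IsLipschitzDomain D)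
    (Ω K : EuclideanSpace ℝ (Fin d) → ℝ)
    (hΩ : IsCZDensity d ((n : ℕ∞) + 1) Ω)
    (hK : K = fun x => Ω x / ‖x‖ ^ d)
    (hi : ∀ P ∈ PolyLE d n, ∀ g : EuclideanSpace ℝ (Fin d) → ℝ,
      IsRestrictedCZ D K P g →
        LocallyIntegrableOn g D ∧ zygSeminorm ω n D g < ⊤)
    (hii : ∃ C : ℝ, 0 < C ∧
      ∀ (x₀ : EuclideanSpace ℝ (Fin d)) (l : ℝ), 0 < l → cube x₀ l ⊆ D →
        ∀ P : EuclideanSpace ℝ (Fin d) → ℝ,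
          (∃ p : MvPolynomial (Fin d) ℝ, p.IsHomogeneous n ∧
            ∀ x, P x = MvPolynomial.eval (fun i => x i - x₀ i) p) →
          ∀ g : EuclideanSpace ℝ (Fin d) → ℝ, IsRestrictedCZ D K P g →
            ∃ S ∈ PolyLE d n,
              (ENNReal.ofReal (l ^ d))⁻¹ *
                  ∫⁻ x in cube x₀ l, ENNReal.ofReal |g x - S x| ≤
                ENNReal.ofReal (C * sSup ((fun x => |P x|) '' D) * omegaTilde ω n l)) :
    ∃ C' : ℝ, 0 < C' ∧
      ∀ f g : EuclideanSpace ℝ (Fin d) → ℝ,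
        LocallyIntegrableOn f D → zygSeminorm ω n D f < ⊤ → l1Norm D f < ⊤ →
        IsRestrictedCZ D K f g →
        LocallyIntegrableOn g D ∧
          zygSeminorm ω n D g + l1Norm D g ≤
            ENNReal.ofReal C' * (zygSeminorm ω n D f + l1Norm D f) := by
  rcases Nat.eq_zero_or_pos d with hd | hd
  · exact ZT.main_d0 hd hD
  by_cases h0 : ∃ t, 0 < t ∧ ω t ≠ 0
  · obtain ⟨q, r, C, hmd⟩ := ZT.exists_MD hω h0
    have hI := ZT.hi_real hD.1 hmd.pos hi
    exact ZT.main_pos hd hmd hD hΩ hK hI (ZT.hii_real hD.1 hmd hI hii)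
  · push Not at h0
    have hn := ZT.zero_order hω h0
    subst hn
    exact ZT.main_zero hd h0 hD hΩ hK hi hii

end
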